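/- For all k ≥ 1, d ∈ ℕ, ε > 0 and all positive integers ℓ_0, ℓ_1, …, ℓ_d and n_0, n_1, …, n_d, there exists a constant C > 0 such that: for every measurable A ⊆ ℝ^k with 0 < |A| < ∞ and |A+A| ≤ (2^{k+d+1}−ε)|A|, there exist a natural number d' ≤ d, a finite set X ⊆ ℝ^k, a symmetric d'-GAP P ⊆ ℝ^k which is ℓ_{d'}-proper and n_{d'}-full, and a symmetric parallelotope Q ⊆ ℝ^k, such that: A ⊆ X+P+Q; #X ≤ C; #P·|Q| ≤ C|A|; for every integer ℓ with 1 ≤ ℓ ≤ ℓ_{d'}, the iterated sumset ℓ_{d'}·X is ((ℓ_{d'}·ℓ)·((P+Q)/ℓ))-separated; and the iterated sumset ℓ_{d'}·P is (ℓ_{d'}Q)-separated. -/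

import Mathlib

open Set Pointwise MeasureTheory ENNReal

/-- A symmetric `d`-GAP in `ℝ^k` with side parameters `m`, which is `s`-proper
(the parametrisation is injective on the `s`-fold dilated index box) and `n`-full
(each side has `2 m i + 1 ≥ n` points). -/
def IsSymGAPProperFull (k d s n : ℕ) (P : Set (Fin k → ℝ)) : Prop :=
  ∃ (a : Fin d → (Fin k → ℝ)) (m : Fin d → ℕ),
    P = (fun lam : Fin d → ℤ => ∑ i, (lam i : ℝ) • a i) ''
          {lam | ∀ i, |lam i| ≤ (m i : ℤ)} ∧
    Set.InjOn (fun lam : Fin d → ℤ => ∑ i, (lam i : ℝ) • a i)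
      {lam | ∀ i, |lam i| ≤ ((s * m i : ℕ) : ℤ)} ∧
    (∀ i, n ≤ 2 * m i + 1)

/-- A symmetric parallelotope in `ℝ^k`: `{∑ i, λ i • v i : λ i ∈ [-1,1]}`. -/
def IsSymParallelotope (k : ℕ) (Q : Set (Fin k → ℝ)) : Prop :=
  ∃ v : Fin k → (Fin k → ℝ),
    Q = (fun lam : Fin k → ℝ => ∑ i, lam i • v i) '' (Set.Icc (-1) 1)

/-- The `m`-fold iterated sumset `m · S = {s₁ + ⋯ + s_m : sᵢ ∈ S}`. -/
def iterSumset {V : Type*} [AddCommMonoid V] (m : ℕ) (S : Set V) : Set V :=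
  {x | ∃ f : Fin m → V, (∀ i, f i ∈ S) ∧ x = ∑ i, f i}

/-- `S` is `B`-separated: differences of distinct elements of `S` avoid `B`. -/
def IsSeparated {V : Type*} [SubtractionMonoid V] (B S : Set V) : Prop :=
  ∀ s ∈ S, ∀ s' ∈ S, s ≠ s' → s - s' ∉ B

/-- The push-forward of a `ℤ`-homogeneous seminorm along a surjective homomorphism. -/
noncomputable def Seminorm.pushforward {M M' : Type*} [AddCommGroup M]
    [AddCommGroup M'] (p : Seminorm ℤ M) (f : M →+ M')
    (y : M') : ℝ :=
  ⨅ w : {w : ℕ × M // 0 < w.1 ∧ f w.2 = (w.1 : ℤ) • y}, p w.1.2 / w.1.1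

section pushforward

variable {M M' : Type*} [AddCommGroup M] [AddCommGroup M']
  (p : Seminorm ℤ M) {f : M →+ M'}

theorem Seminorm.pushforward_le_div {n : ℕ} (hn : 0 < n) {x : M} {y : M'}
    (h : f x = (n : ℤ) • y) : p.pushforward f y ≤ p x / n := by
  refine ciInf_le ⟨0, ?_⟩ (⟨(n, x), hn, h⟩ : {w : ℕ × M // 0 < w.1 ∧ f w.2 = (w.1 : ℤ) • y})
  rintro _ ⟨w, rfl⟩
  have := apply_nonneg p w.1.2
  positivity

theorem Seminorm.pushforward_apply_le (x : M) : p.pushforward f (f x) ≤ p x := by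
  simpa using p.pushforward_le_div (f := f) one_pos (x := x) (y := f x) (by simp)

theorem Seminorm.exists_of_pushforward_lt (hf : Function.Surjective f) {y : M'} {r : ℝ}
    (h : p.pushforward f y < r) :
    ∃ n : ℕ, ∃ x : M, 0 < n ∧ f x = (n : ℤ) • y ∧ p x < n * r := by
  obtain ⟨x₀, hx₀⟩ := hf y
  have : Nonempty {w : ℕ × M // 0 < w.1 ∧ f w.2 = (w.1 : ℤ) • y} :=
    ⟨⟨(1, x₀), one_pos, by simp [hx₀]⟩⟩
  obtain ⟨⟨⟨n, x⟩, hn, hx⟩, hlt⟩ := exists_lt_of_ciInf_lt h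
  have hn' : (0 : ℝ) < n := by exact_mod_cast hn
  refine ⟨n, x, hn, hx, ?_⟩
  rw [div_lt_iff₀ hn'] at hlt
  linarith

theorem Seminorm.pushforward_nonneg (y : M') : 0 ≤ p.pushforward f y :=
  Real.iInf_nonneg fun _ => div_nonneg (apply_nonneg p _) (Nat.cast_nonneg _)

theorem Seminorm.pushforward_add_le (hf : Function.Surjective f) (y z : M') :
    p.pushforward f (y + z) ≤ p.pushforward f y + p.pushforward f z := by
  refine le_of_forall_pos_le_add fun ε hε => ?_
  obtain ⟨n, x, hn, hx, hpx⟩ := p.exists_of_pushforward_lt hf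
    (lt_add_of_pos_right (p.pushforward f y) (half_pos hε))
  obtain ⟨m, w, hm, hw, hpw⟩ := p.exists_of_pushforward_lt hf
    (lt_add_of_pos_right (p.pushforward f z) (half_pos hε))
  have hn' : (0 : ℝ) < n := by exact_mod_cast hn
  have hm' : (0 : ℝ) < m := by exact_mod_cast hm
  have h1 : f ((m : ℤ) • x + (n : ℤ) • w) = ((n * m : ℕ) : ℤ) • (y + z) := by
    rw [map_add, map_zsmul, map_zsmul, hx, hw]; push_cast; module
  refine (p.pushforward_le_div (Nat.mul_pos hn hm) h1).trans ?_
  have h2 : p ((m : ℤ) • x + (n : ℤ) • w) ≤ m * p x + n * p w := by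
    refine (map_add_le_add p _ _).trans (le_of_eq ?_)
    rw [map_smul_eq_mul, map_smul_eq_mul]; simp
  rw [div_le_iff₀ (by exact_mod_cast Nat.mul_pos hn hm)]
  push_cast
  nlinarith [mul_lt_mul_of_pos_left hpx hm', mul_lt_mul_of_pos_left hpw hn']

theorem Seminorm.pushforward_smul (hf : Function.Surjective f) (a : ℤ) (y : M') :
    p.pushforward f (a • y) = ‖a‖ * p.pushforward f y := by
  rcases eq_or_ne a 0 with rfl | ha
  · have h1 := p.pushforward_apply_le (f := f) 0
    have h2 := p.pushforward_nonneg (f := f) 0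
    simp only [map_zero] at h1
    simp [le_antisymm h1 h2]
  have ha' : (0 : ℝ) < ‖a‖ := norm_pos_iff.2 ha
  apply le_antisymm
  · rw [mul_comm, ← div_le_iff₀ ha']
    refine le_of_forall_gt_imp_ge_of_dense fun r hr => ?_
    obtain ⟨n, x, hn, hx, hpx⟩ := p.exists_of_pushforward_lt hf hr
    have hn' : (0 : ℝ) < n := by exact_mod_cast hn
    rw [div_le_iff₀ ha']
    have h1 : f (a • x) = (n : ℤ) • (a • y) := by rw [map_zsmul, hx, smul_comm]
    refine (p.pushforward_le_div hn h1).trans ?_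
    rw [map_smul_eq_mul, div_le_iff₀ hn']
    nlinarith
  · refine le_of_forall_gt_imp_ge_of_dense fun r hr => ?_
    obtain ⟨n, x, hn, hx, hpx⟩ := p.exists_of_pushforward_lt hf hr
    have hn' : (0 : ℝ) < n := by exact_mod_cast hn
    have h1 : f (a.sign • x) = ((n * a.natAbs : ℕ) : ℤ) • y := by
      rw [map_zsmul, hx]
      push_cast
      rw [← Int.sign_mul_self_eq_abs a]
      module
    have h2 := p.pushforward_le_div (Nat.mul_pos hn (Int.natAbs_pos.2 ha)) h1
    have h3 : p (a.sign • x) = p x := by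
      rw [map_smul_eq_mul, Int.norm_eq_abs]
      have : |a.sign| = 1 := by rw [Int.abs_sign_of_ne_zero ha]
      rw [← Int.cast_abs, this]; simp
    rw [h3, le_div_iff₀ (by exact_mod_cast Nat.mul_pos hn (Int.natAbs_pos.2 ha))] at h2
    have h4 : ((n * a.natAbs : ℕ) : ℝ) = n * ‖a‖ := by
      push_cast
      rw [Int.norm_eq_abs]
      simp
    rw [h4] at h2
    have : n * (‖a‖ * p.pushforward f y) < n * r := by nlinarith
    exact (lt_of_mul_lt_mul_left this hn'.le).le

/-- The push-forward as a bundled seminorm. -/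
noncomputable def Seminorm.push (hf : Function.Surjective f) : Seminorm ℤ M' :=
  Seminorm.of (p.pushforward f) (p.pushforward_add_le hf) (p.pushforward_smul hf)

theorem Seminorm.push_apply_le (hf : Function.Surjective f) (x : M) : p.push hf (f x) ≤ p x :=
  p.pushforward_apply_le x

theorem Seminorm.exists_of_push_lt (hf : Function.Surjective f) {y : M'} {r : ℝ}
    (h : p.push hf y < r) :
    ∃ n : ℕ, ∃ x : M, 0 < n ∧ f x = (n : ℤ) • y ∧ p x < n * r :=
  p.exists_of_pushforward_lt hf h

/-- If the kernel is cyclic, elements of small push-forward norm lift to elements of small norm. -/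
theorem Seminorm.exists_lift_of_push_lt (hf : Function.Surjective f) {b : M}
    (hfb : f b = 0) (hker : ∀ x, f x = 0 → ∃ s : ℤ, x = s • b) {y : M'} {r : ℝ} (h : p.push hf y < r) :
    ∃ x, f x = y ∧ p x < r + p b / 2 := by
  obtain ⟨n, x, hn, hx, hpx⟩ := p.exists_of_push_lt hf h
  obtain ⟨x₀, rfl⟩ := hf y
  have hn' : (0 : ℝ) < n := by exact_mod_cast hn
  obtain ⟨s, hs⟩ := hker (x - (n : ℤ) • x₀) (by rw [map_sub, hx, map_zsmul, sub_self])
  set q : ℤ := round ((s : ℝ) / n) with hq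
  have hqs : |(s : ℝ) - n * q| ≤ n / 2 := by
    have h1 := abs_sub_round ((s : ℝ) / n)
    rw [← hq] at h1
    have h2 : (s : ℝ) - n * q = n * ((s : ℝ) / n - q) := by field_simp
    rw [h2, abs_mul, abs_of_pos hn']
    nlinarith
  refine ⟨x₀ + q • b, by rw [map_add, map_zsmul, hfb]; simp, ?_⟩
  have h3 : (n : ℤ) • (x₀ + q • b) = x - (s - n * q) • b := by
    have : x = (n : ℤ) • x₀ + s • b := by rw [← hs]; abel
    rw [this]; module
  have h4 : n * p (x₀ + q • b) ≤ p x + n / 2 * p b := by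
    have h5 : n * p (x₀ + q • b) = p ((n : ℤ) • (x₀ + q • b)) := by
      rw [map_smul_eq_mul]; simp
    rw [h5, h3]
    refine (map_sub_le_add p _ _).trans ?_
    rw [map_smul_eq_mul, Int.norm_eq_abs]
    push_cast
    gcongr
  have h6 : n * p (x₀ + q • b) < n * (r + p b / 2) := by nlinarith
  exact lt_of_mul_lt_mul_left h6 hn'.le

end pushforward

theorem Seminorm.eq_zero_of_finite_balls {M : Type*} [AddCommGroup M] [IsAddTorsionFree M]
    {p : Seminorm ℤ M} (hp : ∀ r, {x | p x ≤ r}.Finite) {x : M} (hx : p x = 0) : x = 0 := by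
  by_contra h
  have hinj : Function.Injective (fun n : ℤ => n • x) := smul_left_injective ℤ h
  refine Set.infinite_range_of_injective hinj ((hp 0).subset ?_)
  rintro _ ⟨n, rfl⟩
  simp [map_smul_eq_mul, hx]

theorem Seminorm.map_sum_le {R M ι : Type*} [SeminormedRing R] [AddCommGroup M] [Module R M]
    (p : Seminorm R M) (s : Finset ι) (f : ι → M) : p (∑ i ∈ s, f i) ≤ ∑ i ∈ s, p (f i) :=
  Finset.le_sum_of_subadditive p (map_zero p).le (map_add_le_add p) s f

/-- In a nonzero discrete normed group there is a shortest nonzero vector. -/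
theorem Seminorm.exists_shortest {M : Type*} [AddCommGroup M]
    {p : Seminorm ℤ M} (hp : ∀ r, {x | p x ≤ r}.Finite) {x₀ : M} (hx₀ : x₀ ≠ 0) :
    ∃ b : M, b ≠ 0 ∧ p b ≤ p x₀ ∧ ∀ x, x ≠ 0 → p b ≤ p x := by
  have hfin : ({x | p x ≤ p x₀} \ {0}).Finite := (hp _).sdiff
  obtain ⟨b, ⟨hb1, hb2⟩, hb⟩ := hfin.exists_minimalFor p _ ⟨x₀, le_refl (p x₀), hx₀⟩
  refine ⟨b, hb2, hb1, fun x hx => ?_⟩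
  by_contra! hlt
  exact hlt.not_ge (hb ⟨hlt.le.trans hb1, hx⟩ hlt.le)

/-- The quotient by a shortest nonzero vector is torsion-free. -/
theorem Seminorm.mem_zmultiples_of_shortest {M : Type*} [AddCommGroup M]
    {p : Seminorm ℤ M} {b : M} (hpb : 0 < p b)
    (hb : ∀ x, x ≠ 0 → p b ≤ p x) {n : ℕ} (hn : n ≠ 0) {y : M} {s : ℤ}
    (h : (n : ℤ) • y = s • b) : ∃ q : ℤ, y = q • b := by
  have hn' : (0 : ℝ) < n := by exact_mod_cast Nat.pos_of_ne_zero hn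
  refine ⟨s / n, ?_⟩
  by_contra hne
  have h1 := hb _ (sub_ne_zero.2 hne)
  have h2 : (n : ℤ) • (y - (s / n) • b) = (s % n) • b := by
    rw [smul_sub, h, Int.emod_def]; module
  have h3 : n * p (y - (s / n) • b) = |((s % n : ℤ) : ℝ)| * p b := by
    rw [← Int.norm_eq_abs, ← map_smul_eq_mul, ← h2, map_smul_eq_mul]; simp
  have h4 : |((s % n : ℤ) : ℝ)| < n := by
    rw [abs_of_nonneg (by exact_mod_cast Int.emod_nonneg _ (by exact_mod_cast hn))]
    exact_mod_cast Int.emod_lt_of_pos s (by exact_mod_cast Nat.pos_of_ne_zero hn)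
  nlinarith

theorem isAddTorsionFree_quotient_of_shortest {M : Type*} [AddCommGroup M]
    {p : Seminorm ℤ M} {b : M} (hpb : 0 < p b) (hb : ∀ x, x ≠ 0 → p b ≤ p x) :
    IsAddTorsionFree (M ⧸ AddSubgroup.zmultiples b) := by
  refine ⟨fun n hn x y hxy => ?_⟩
  induction x using QuotientAddGroup.induction_on with | H x => ?_
  induction y using QuotientAddGroup.induction_on with | H y => ?_
  have h1 : ((n • x : M) : M ⧸ AddSubgroup.zmultiples b) = ((n • y : M) : M ⧸ _) := hxy
  rw [QuotientAddGroup.eq, AddSubgroup.mem_zmultiples_iff] at h1 ⊢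
  obtain ⟨s, hs⟩ := h1
  obtain ⟨q, hq⟩ := Seminorm.mem_zmultiples_of_shortest hpb hb hn (y := -x + y) (s := s) (by
    rw [hs]; module)
  exact ⟨q, hq.symm⟩

theorem finrank_quotient_zmultiples {M : Type*} [AddCommGroup M] [Module.Finite ℤ M]
    [IsAddTorsionFree M] {b : M} (hb : b ≠ 0) :
    Module.finrank ℤ (M ⧸ AddSubgroup.zmultiples b) + 1 = Module.finrank ℤ M := by
  have h1 := Submodule.finrank_quotient_add_finrank (R := ℤ) (M := M) (ℤ ∙ b)
  have h2 : Module.finrank ℤ (ℤ ∙ b) = 1 :=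
    (LinearEquiv.finrank_eq (LinearEquiv.toSpanNonzeroSingleton ℤ M b hb)).symm.trans
      (Module.finrank_self ℤ)
  rw [h2] at h1
  rw [← h1]
  congr 1
  have hcoe : (ℤ ∙ b).toAddSubgroup = AddSubgroup.zmultiples b := by
    ext x; simp [Submodule.mem_span_singleton, AddSubgroup.mem_zmultiples_iff]
  exact LinearEquiv.finrank_eq
    ((QuotientAddGroup.quotientAddEquivOfEq hcoe.symm).toIntLinearEquiv)

/-- A generating family, of size the rank, along which the coordinates of a vector are controlled
by its norm. -/
theorem exists_reduced_generators (D : ℕ) : ∃ C : ℝ, 1 ≤ C ∧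
    ∀ (M : Type) [AddCommGroup M] [Module.Finite ℤ M] [IsAddTorsionFree M]
      (p : Seminorm ℤ M), Module.finrank ℤ M = D → (∀ r, {x | p x ≤ r}.Finite) →
      ∃ b : Fin D → M, (∀ i, b i ≠ 0) ∧ (∀ x, ∃ t : Fin D → ℤ, x = ∑ i, t i • b i) ∧
        ∀ (t : Fin D → ℤ) (i : Fin D), |(t i : ℝ)| * p (b i) ≤ C * p (∑ i, t i • b i) := by
  induction D with
  | zero =>
    refine ⟨1, le_refl _, fun M _ _ _ p hrank _ => ⟨fun i => i.elim0, fun i => i.elim0, ?_,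
      fun _ i => i.elim0⟩⟩
    have := Module.finrank_zero_iff.1 hrank
    exact fun x => ⟨fun i => i.elim0, Subsingleton.elim _ _⟩
  | succ D ih =>
    obtain ⟨C, hC, ih⟩ := ih
    refine ⟨1 + 4 * C * (D + 1), by nlinarith, fun M _ _ _ p hrank hp => ?_⟩
    have hnt : Nontrivial M := Module.nontrivial_of_finrank_pos (R := ℤ) (by omega)
    obtain ⟨x₀, hx₀⟩ := exists_ne (0 : M)
    obtain ⟨b, hb0, -, hb⟩ := p.exists_shortest hp hx₀
    have hpb : 0 < p b := lt_of_le_of_ne (apply_nonneg p b)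
      fun h => hb0 (p.eq_zero_of_finite_balls hp h.symm)
    let f : M →+ M ⧸ AddSubgroup.zmultiples b := QuotientAddGroup.mk' _
    have hf : Function.Surjective f := QuotientAddGroup.mk'_surjective _
    have hfb : f b = 0 := (QuotientAddGroup.eq_zero_iff b).2 (AddSubgroup.mem_zmultiples b)
    have hker : ∀ x, f x = 0 → ∃ s : ℤ, x = s • b := fun x hx => by
      obtain ⟨s, hs⟩ := AddSubgroup.mem_zmultiples_iff.1 ((QuotientAddGroup.eq_zero_iff x).1 hx)
      exact ⟨s, hs.symm⟩
    have htf := isAddTorsionFree_quotient_of_shortest hpb hb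
    have hfin : Module.Finite ℤ (M ⧸ AddSubgroup.zmultiples b) :=
      Module.Finite.of_surjective f.toIntLinearMap hf
    have hballs : ∀ r, {y | p.push hf y ≤ r}.Finite := fun r => by
      refine ((hp (r + 1 + p b / 2)).image f).subset fun y hy => ?_
      obtain ⟨x, hx, hpx⟩ := p.exists_lift_of_push_lt hf hfb hker
        (lt_of_le_of_lt hy (lt_add_one r))
      exact ⟨x, hpx.le, hx⟩
    obtain ⟨b', hb'0, hspan, hbound⟩ := ih _ (p.push hf)
      (by have := finrank_quotient_zmultiples hb0; omega) hballs
    have hlift : ∀ i, ∃ x, f x = b' i ∧ p x ≤ 4 * p.push hf (b' i) := fun i => by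
      have hpos : 0 < p.push hf (b' i) := lt_of_le_of_ne (apply_nonneg _ _)
        fun h => hb'0 i ((p.push hf).eq_zero_of_finite_balls hballs h.symm)
      obtain ⟨x, hx, hpx⟩ := p.exists_lift_of_push_lt hf hfb hker
        (show p.push hf (b' i) < 2 * p.push hf (b' i) by linarith)
      have hx0 : x ≠ 0 := by rintro rfl; exact hb'0 i (by rw [← hx, map_zero])
      have := hb x hx0
      exact ⟨x, hx, by linarith⟩
    choose c hc hpc using hlift
    have hmap : ∀ t : Fin (D + 1) → ℤ,
        f (∑ i, t i • (Fin.cons b c : Fin (D + 1) → M) i) = ∑ i, t i.succ • b' i := fun t => by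
      simp [Fin.sum_univ_succ, hfb, hc]
    have htail : ∀ (t : Fin (D + 1) → ℤ) (i : Fin D), |(t i.succ : ℝ)| * p (c i) ≤
        4 * C * p (∑ i, t i • (Fin.cons b c : Fin (D + 1) → M) i) := fun t i => by
      have h1 := hbound (fun i => t i.succ) i
      have h2 := p.push_apply_le hf (∑ i, t i • (Fin.cons b c : Fin (D + 1) → M) i)
      rw [hmap] at h2
      have h3 := mul_le_mul_of_nonneg_left (hpc i) (abs_nonneg (t i.succ : ℝ))
      have h4 := mul_le_mul_of_nonneg_left h2 (zero_le_one.trans hC)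
      linarith
    refine ⟨Fin.cons b c, fun i => ?_, fun x => ?_, fun t i => ?_⟩
    · refine Fin.cases hb0 (fun i => ?_) i
      rw [Fin.cons_succ]
      rintro h
      exact hb'0 i (by rw [← hc, h, map_zero])
    · obtain ⟨t, ht⟩ := hspan (f x)
      obtain ⟨s, hs⟩ := hker (x - ∑ i, t i • c i) (by
        rw [map_sub, ht, map_sum]; simp [hc])
      refine ⟨Fin.cons s t, ?_⟩
      rw [Fin.sum_univ_succ]
      simp only [Fin.cons_zero, Fin.cons_succ]
      rw [← hs]; abel
    · set x := ∑ i, t i • (Fin.cons b c : Fin (D + 1) → M) i with hx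
      have hx0 := apply_nonneg p x
      refine Fin.cases ?_ (fun i => ?_) i
      · rw [Fin.cons_zero]
        have h1 : t 0 • b = x - ∑ i : Fin D, t i.succ • c i := by
          rw [hx, Fin.sum_univ_succ]; simp
        have h2 : p (∑ i : Fin D, t i.succ • c i) ≤ D * (4 * C * p x) := by
          refine (p.map_sum_le _ _).trans ?_
          refine (Finset.sum_le_card_nsmul _ _ (4 * C * p x) fun i _ => ?_).trans (by simp)
          rw [map_smul_eq_mul, Int.norm_eq_abs]
          exact htail t i
        rw [← Int.norm_eq_abs, ← map_smul_eq_mul, h1]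
        refine (map_sub_le_add p _ _).trans ?_
        nlinarith [mul_nonneg (zero_le_one.trans hC) hx0]
      · rw [Fin.cons_succ]
        refine (htail t i).trans ?_
        have : 0 ≤ C * p x * D := by positivity
        nlinarith [mul_nonneg (zero_le_one.trans hC) hx0]

theorem exists_reduced_generators_of_le (D₀ : ℕ) : ∃ C : ℝ, 1 ≤ C ∧ ∀ D ≤ D₀,
    ∀ (M : Type) [AddCommGroup M] [Module.Finite ℤ M] [IsAddTorsionFree M]
      (p : Seminorm ℤ M), Module.finrank ℤ M = D → (∀ r, {x | p x ≤ r}.Finite) →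
      ∃ b : Fin D → M, (∀ i, b i ≠ 0) ∧ (∀ x, ∃ t : Fin D → ℤ, x = ∑ i, t i • b i) ∧
        ∀ (t : Fin D → ℤ) (i : Fin D), |(t i : ℝ)| * p (b i) ≤ C * p (∑ i, t i • b i) := by
  choose C hC h using exists_reduced_generators
  have hle : ∀ D ≤ D₀, C D ≤ ∑ i ∈ Finset.range (D₀ + 1), C i := fun D hD =>
    Finset.single_le_sum (f := C) (fun i _ => zero_le_one.trans (hC i))
      (Finset.mem_range.2 (by omega))
  refine ⟨∑ i ∈ Finset.range (D₀ + 1), C i, (hC 0).trans (hle 0 (Nat.zero_le _)),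
    fun D hD M _ _ _ p hrank hp => ?_⟩
  obtain ⟨b, hb0, hspan, hb⟩ := h D M p hrank hp
  exact ⟨b, hb0, hspan, fun t i => (hb t i).trans
    (mul_le_mul_of_nonneg_right (hle D hD) (apply_nonneg _ _))⟩

/-- A `ℤ`-homogeneous seminorm dominated by the norm is `ℝ`-homogeneous. -/
theorem Seminorm.real_smul_of_le {V : Type*} [NormedAddCommGroup V] [NormedSpace ℝ V]
    (q : Seminorm ℤ V) {B : ℝ} (hB : ∀ y, q y ≤ B * ‖y‖) (s : ℝ) (y : V) :
    q (s • y) = |s| * q y := by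
  have hy := apply_nonneg q y
  have hBy : 0 ≤ B * ‖y‖ := hy.trans (hB y)
  have key : ∀ n : ℕ, n * |q (s • y) - (|s| * q y)| ≤ B * ‖y‖ + q y := fun n => by
    set z : ℤ := ⌊n * s⌋ with hz
    have hz1 : |n * s - z| ≤ 1 := by
      rw [abs_le]; constructor <;> linarith [Int.floor_le (n * s), Int.lt_floor_add_one (n * s)]
    have e1 : (n : ℝ) * q (s • y) = q ((n * s) • y) := by
      have : ((n : ℝ) * s) • y = (n : ℤ) • (s • y) := by
        rw [mul_smul, Nat.cast_smul_eq_nsmul ℝ, natCast_zsmul]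
      rw [this, map_smul_eq_mul q (n : ℤ)]
      simp
    have e2 : |(z : ℝ)| * q y = q ((z : ℝ) • y) := by
      rw [Int.cast_smul_eq_zsmul ℝ, map_smul_eq_mul, Int.norm_eq_abs]
    have h1 : |q ((n * s) • y) - q ((z : ℝ) • y)| ≤ B * ‖y‖ := by
      refine (abs_sub_map_le_sub q _ _).trans ?_
      rw [← sub_smul]
      refine (hB _).trans ?_
      rw [norm_smul, Real.norm_eq_abs]
      nlinarith
    have h2 : |(|(z : ℝ)| * q y) - (n * |s|) * q y| ≤ q y := by
      rw [← sub_mul, abs_mul, abs_of_nonneg hy]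
      have : |(|(z : ℝ)| - n * |s|)| ≤ 1 := by
        have := abs_abs_sub_abs_le (z : ℝ) (n * s)
        rw [abs_mul, Nat.abs_cast] at this
        rw [abs_sub_comm] at hz1
        exact this.trans hz1
      nlinarith
    have h3 : n * |q (s • y) - (|s| * q y)| = |n * q (s • y) - (n * |s|) * q y| := by
      rw [mul_assoc, ← mul_sub, abs_mul, Nat.abs_cast]
    rw [h3, e1]
    rw [← e2] at h1
    calc _ ≤ _ := abs_sub_le _ (|(z : ℝ)| * q y) _
      _ ≤ _ := add_le_add h1 h2
  by_contra hne
  have hpos : 0 < |q (s • y) - (|s| * q y)| := abs_pos.2 (sub_ne_zero.2 hne)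
  obtain ⟨n, hn⟩ := exists_nat_gt ((B * ‖y‖ + q y) / |q (s • y) - (|s| * q y)|)
  rw [div_lt_iff₀ hpos] at hn
  exact hn.not_ge (key n)

/-- The symmetric parallelotope spanned by `v`. -/
def symParallelotope {k : ℕ} (v : Fin k → Fin k → ℝ) : Set (Fin k → ℝ) :=
  (fun lam : Fin k → ℝ => ∑ i, lam i • v i) '' (Set.Icc (-1) 1)

theorem mem_symParallelotope {k : ℕ} {v : Fin k → Fin k → ℝ} {y : Fin k → ℝ} :
    y ∈ symParallelotope v ↔ ∃ c : Fin k → ℝ, (∀ i, |c i| ≤ 1) ∧ ∑ i, c i • v i = y := by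
  simp only [symParallelotope, mem_image, mem_Icc, Pi.le_def, abs_le]
  constructor
  · rintro ⟨c, ⟨h1, h2⟩, rfl⟩; exact ⟨c, fun i => ⟨h1 i, h2 i⟩, rfl⟩
  · rintro ⟨c, h, rfl⟩; exact ⟨c, ⟨fun i => (h i).1, fun i => (h i).2⟩, rfl⟩

/-- Coordinatewise cast of integer vectors to real vectors. -/
def intCastVec (k : ℕ) : (Fin k → ℤ) →+ (Fin k → ℝ) where
  toFun z i := z i
  map_zero' := by ext; simp
  map_add' x y := by ext; simp

/-- Balls of a norm on `ℝ^k` are comparable to parallelotopes. -/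
theorem exists_symParallelotope_comparable (k : ℕ) : ∃ C : ℝ, 1 ≤ C ∧
    ∀ q : Seminorm ℤ (Fin k → ℝ), (∃ B, ∀ y, q y ≤ B * ‖y‖) →
      (∀ r, {z : Fin k → ℤ | q (intCastVec k z) ≤ r}.Finite) → ∀ ρ : ℝ, 0 < ρ →
      ∃ v : Fin k → Fin k → ℝ, (∀ y, q y ≤ ρ → y ∈ symParallelotope v) ∧
        ∀ y ∈ symParallelotope v, q y ≤ C * ρ := by
  obtain ⟨C, hC, h⟩ := exists_reduced_generators k
  refine ⟨1 + k * C, by nlinarith [(Nat.cast_nonneg k : (0 : ℝ) ≤ k)], fun q ⟨B, hB⟩ hfin ρ hρ => ?_⟩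
  have hhom := q.real_smul_of_le hB
  let p : Seminorm ℤ (Fin k → ℤ) := q.comp (intCastVec k).toIntLinearMap
  have hpq : ∀ z, p z = q (intCastVec k z) := fun z => rfl
  obtain ⟨b, hb0, hspan, hb⟩ := h (Fin k → ℤ) p (Module.finrank_fin_fun ℤ) hfin
  have hbpos : ∀ i, 0 < p (b i) := fun i => lt_of_le_of_ne (apply_nonneg p _)
    fun h => hb0 i (p.eq_zero_of_finite_balls hfin h.symm)
  let e : Fin k → Fin k → ℝ := fun i => intCastVec k (b i)
  have hsum : ∀ t : Fin k → ℤ, intCastVec k (∑ i, t i • b i) = ∑ i, (t i : ℝ) • e i := fun t => by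
    rw [map_sum]
    refine Finset.sum_congr rfl fun i _ => ?_
    rw [map_zsmul, Int.cast_smul_eq_zsmul ℝ]
  have hreal : ∀ (s : Fin k → ℝ) (i : Fin k), |s i| * p (b i) ≤ C * q (∑ i, s i • e i) := by
    intro s i
    set y := ∑ i, s i • e i with hy
    set S := ∑ i, q (e i) with hS
    have key : ∀ n : ℕ, n * (|s i| * p (b i) - C * q y) ≤ C * S + p (b i) := fun n => by
      have hfl : ∀ j, |n * s j - ⌊n * s j⌋| ≤ 1 := fun j => by
        rw [abs_le]
        constructor <;> linarith [Int.floor_le (n * s j), Int.lt_floor_add_one (n * s j)]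
      have h1 := hb (fun j => ⌊n * s j⌋) i
      rw [hpq (∑ i, _), hsum] at h1
      have h2 : q (∑ j, (⌊n * s j⌋ : ℝ) • e j) ≤ n * q y + S := by
        have e1 : ∑ j, (⌊n * s j⌋ : ℝ) • e j
            = (n : ℝ) • y - ∑ j, (n * s j - ⌊n * s j⌋) • e j := by
          rw [hy, Finset.smul_sum, ← Finset.sum_sub_distrib]
          refine Finset.sum_congr rfl fun j _ => ?_
          module
        rw [e1]
        refine (map_sub_le_add q _ _).trans (add_le_add ?_ ?_)
        · rw [hhom, Nat.abs_cast]
        · refine (q.map_sum_le _ _).trans (Finset.sum_le_sum fun j _ => ?_)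
          rw [hhom]
          exact mul_le_of_le_one_left (apply_nonneg q _) (hfl j)
      have h3 : n * |s i| ≤ |(⌊n * s i⌋ : ℝ)| + 1 := by
        have := abs_sub_abs_le_abs_sub (n * s i) (⌊n * s i⌋ : ℝ)
        rw [abs_mul, Nat.abs_cast] at this
        linarith [hfl i]
      have h4 := mul_le_mul_of_nonneg_left h2 (zero_le_one.trans hC)
      have h5 := mul_le_mul_of_nonneg_right h3 (hbpos i).le
      nlinarith
    by_contra! hlt
    obtain ⟨n, hn⟩ := exists_nat_gt ((C * S + p (b i)) / (|s i| * p (b i) - C * q y))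
    rw [div_lt_iff₀ (by linarith)] at hn
    exact hn.not_ge (key n)
  have hspanR : ∀ y : Fin k → ℝ, ∃ s : Fin k → ℝ, y = ∑ i, s i • e i := by
    intro y
    choose t ht using fun j : Fin k => hspan (Pi.single j 1)
    refine ⟨fun i => ∑ j, y j * t j i, ?_⟩
    have h1 : ∀ j, (Pi.single j 1 : Fin k → ℝ) = ∑ i, (t j i : ℝ) • e i := fun j => by
      rw [← hsum, ← ht]
      ext l
      by_cases hl : l = j
      · subst hl; simp [intCastVec]
      · simp [intCastVec, hl]
    have h2 : y = ∑ j, y j • (Pi.single j 1 : Fin k → ℝ) := by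
      ext l
      simp [Finset.sum_apply, Pi.single_apply]
    conv_lhs => rw [h2]
    simp_rw [h1, Finset.smul_sum, Finset.sum_smul, mul_smul]
    exact Finset.sum_comm
  have hCρ : 0 < C * ρ := by positivity
  refine ⟨fun i => (C * ρ / p (b i)) • e i, fun y hy => ?_, fun y hy => ?_⟩
  · obtain ⟨s, hs⟩ := hspanR y
    rw [mem_symParallelotope]
    refine ⟨fun i => s i * p (b i) / (C * ρ), fun i => ?_, ?_⟩
    · rw [abs_div, abs_mul, abs_of_pos (hbpos i), abs_of_pos hCρ, div_le_one hCρ]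
      refine (hreal s i).trans ?_
      rw [← hs]
      gcongr
    · rw [hs]
      refine Finset.sum_congr rfl fun i _ => ?_
      have := (hbpos i).ne'
      rw [smul_smul]
      congr 1
      field_simp
  · obtain ⟨c, hc, rfl⟩ := mem_symParallelotope.1 hy
    refine (q.map_sum_le _ _).trans ?_
    refine (Finset.sum_le_card_nsmul _ _ (C * ρ) fun i _ => ?_).trans ?_
    · rw [smul_smul, hhom, ← hpq, abs_mul, abs_div, abs_of_pos (hbpos i), abs_of_pos hCρ]
      have := (hbpos i).ne'
      have : |c i| * (C * ρ / p (b i)) * p (b i) = |c i| * (C * ρ) := by field_simp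
      rw [this]
      exact mul_le_of_le_one_left hCρ.le (hc i)
    · simp only [Finset.card_univ, Fintype.card_fin, nsmul_eq_mul]
      nlinarith

/-- The finiteness and continuity conditions on a seminorm on `R × ℝ^k` which make it behave like
a norm restricted to a product of a lattice and a vector space. -/
structure Seminorm.IsLatticeLike {k : ℕ} {R : Type} [AddCommGroup R]
    (p : Seminorm ℤ (R × (Fin k → ℝ))) : Prop where
  finite_fst : ∀ r, {ρ | ∃ y, p (ρ, y) ≤ r}.Finite
  bound_snd : ∃ B, ∀ y, p (0, y) ≤ B * ‖y‖
  finite_snd : ∀ r, {z : Fin k → ℤ | p (0, intCastVec k z) ≤ r}.Finite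

theorem Seminorm.map_sum_zsmul_le {M ι : Type*} [AddCommGroup M] [Fintype ι]
    (p : Seminorm ℤ M) (t : ι → ℤ) (x : ι → M) {c : ℝ} (h : ∀ i, |(t i : ℝ)| * p (x i) ≤ c) :
    p (∑ i, t i • x i) ≤ Fintype.card ι * c := by
  refine (p.map_sum_le _ _).trans ((Finset.sum_le_card_nsmul _ _ c fun i _ => ?_).trans_eq ?_)
  · rw [map_smul_eq_mul, Int.norm_eq_abs]
    exact h i
  · rw [Finset.card_univ, nsmul_eq_mul]

theorem exists_lift_fst_of_push_lt {k : ℕ} {R : Type} [AddCommGroup R] [IsAddTorsionFree R]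
    (p : Seminorm ℤ (R × (Fin k → ℝ)))
    (hf : Function.Surjective (AddMonoidHom.fst R (Fin k → ℝ))) {ρ : R} {r : ℝ}
    (h : p.push hf ρ < r) : ∃ y, p (ρ, y) < r := by
  obtain ⟨n, ⟨x, y⟩, hn, hx, hlt⟩ := p.exists_of_push_lt hf h
  have hn' : (0 : ℝ) < n := by exact_mod_cast hn
  have hxy : ((x, y) : R × (Fin k → ℝ)) = (n : ℤ) • (ρ, (n : ℝ)⁻¹ • y) := by
    refine Prod.ext hx ?_
    change y = (n : ℤ) • ((n : ℝ)⁻¹ • y)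
    rw [← Int.cast_smul_eq_zsmul ℝ, smul_smul, Int.cast_natCast, mul_inv_cancel₀ hn'.ne', one_smul]
  refine ⟨(n : ℝ)⁻¹ • y, ?_⟩
  rw [hxy, map_smul_eq_mul p (n : ℤ)] at hlt
  simp only [Int.norm_natCast] at hlt
  exact lt_of_mul_lt_mul_left hlt hn'.le

/-- If no short relation exists, a lattice-like ball is comparable to a generalised arithmetic
progression plus a parallelotope. -/
theorem exists_gap_of_no_relation (k D : ℕ) : ∃ C₂ : ℝ, 1 ≤ C₂ ∧
    ∀ (L : ℕ) (R : Type) [AddCommGroup R] [Module.Finite ℤ R] [IsAddTorsionFree R]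
      (p : Seminorm ℤ (R × (Fin k → ℝ))), Module.finrank ℤ R = D → p.IsLatticeLike →
      (∀ ρ, p (ρ, 0) ≤ L * C₂ → ρ = 0) →
      ∃ (a : Fin D → Fin k → ℝ) (m : Fin D → ℕ) (v : Fin k → Fin k → ℝ),
        (∀ ρ y, p (ρ, y) ≤ 1 → ∃ t : Fin D → ℤ, (∀ i, |t i| ≤ m i) ∧
          y - ∑ i, (t i : ℝ) • a i ∈ symParallelotope v) ∧
        (∀ t : Fin D → ℤ, (∀ i, |t i| ≤ m i) → ∀ y ∈ symParallelotope v,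
          ∃ ρ, p (ρ, ∑ i, (t i : ℝ) • a i + y) ≤ C₂) ∧
        (∀ t : Fin D → ℤ, (∀ i, |t i| ≤ L * m i) →
          (∑ i, (t i : ℝ) • a i) ∈ (L : ℝ) • symParallelotope v → t = 0) := by
  obtain ⟨C, hC, hgen⟩ := exists_reduced_generators D
  obtain ⟨C', hC', hpar⟩ := exists_symParallelotope_comparable k
  have hD : (0 : ℝ) ≤ D := Nat.cast_nonneg D
  set C₁ : ℝ := 1 + D * (2 * C) with hC₁
  have hC₁1 : 1 ≤ C₁ := by nlinarith
  refine ⟨D * (2 * C) + C' * C₁, by nlinarith, ?_⟩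
  intro L R _ _ _ p hrank hp hrel
  have hf : Function.Surjective (AddMonoidHom.fst R (Fin k → ℝ)) := Prod.fst_surjective
  set N := p.push hf with hN
  have hNle : ∀ ρ y, N ρ ≤ p (ρ, y) := fun ρ y => p.push_apply_le hf (ρ, y)
  have hNfin : ∀ r, {ρ | N ρ ≤ r}.Finite := fun r =>
    (hp.finite_fst (r + 1)).subset fun ρ hρ => by
      obtain ⟨y, hy⟩ := exists_lift_fst_of_push_lt p hf (lt_of_le_of_lt hρ (lt_add_one r))
      exact ⟨y, hy.le⟩
  obtain ⟨c, hc0, hspan, hc⟩ := hgen R N hrank hNfin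
  have hμ : ∀ i, 0 < N (c i) := fun i => lt_of_le_of_ne (apply_nonneg N _)
    fun h => hc0 i (N.eq_zero_of_finite_balls hNfin h.symm)
  choose a ha using fun i => exists_lift_fst_of_push_lt p hf (r := 2 * N (c i)) (ρ := c i)
    (by linarith [hμ i])
  obtain ⟨v, hv1, hv2⟩ := hpar (p.comp (AddMonoidHom.inr R (Fin k → ℝ)).toIntLinearMap)
    hp.bound_snd hp.finite_snd C₁ (by linarith)
  replace hv1 : ∀ y, p (0, y) ≤ C₁ → y ∈ symParallelotope v := hv1
  replace hv2 : ∀ y ∈ symParallelotope v, p (0, y) ≤ C' * C₁ := hv2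
  set m : Fin D → ℕ := fun i => ⌊C / N (c i)⌋₊ with hm
  have hsum : ∀ t : Fin D → ℤ, ∑ i, t i • ((c i, a i) : R × (Fin k → ℝ))
      = (∑ i, t i • c i, ∑ i, (t i : ℝ) • a i) := fun t => by
    refine Prod.ext ?_ ?_
    · rw [Prod.fst_sum]; rfl
    · rw [Prod.snd_sum]
      refine Finset.sum_congr rfl fun i _ => ?_
      rw [Int.cast_smul_eq_zsmul ℝ]; rfl
  have hsmall : ∀ (t : Fin D → ℤ) (s : ℝ), (∀ i, |(t i : ℝ)| * N (c i) ≤ s * C) →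
      p (∑ i, t i • c i, ∑ i, (t i : ℝ) • a i) ≤ s * (D * (2 * C)) := fun t s ht => by
    rw [← hsum]
    refine (p.map_sum_zsmul_le t _ (c := s * (2 * C)) fun i => ?_).trans_eq ?_
    · have := mul_le_mul_of_nonneg_left (ha i).le (abs_nonneg (t i : ℝ))
      linarith [ht i]
    · rw [Fintype.card_fin]; ring
  have hmul : ∀ (t : Fin D → ℤ) (s : ℕ), (∀ i, |t i| ≤ s * m i) →
      ∀ i, |(t i : ℝ)| * N (c i) ≤ s * C := fun t s ht i => by
    have h1 : |(t i : ℝ)| ≤ s * m i := by exact_mod_cast ht i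
    have h2 : (m i : ℝ) ≤ C / N (c i) := Nat.floor_le (by have := hμ i; positivity)
    rw [le_div_iff₀ (hμ i)] at h2
    calc |(t i : ℝ)| * N (c i) ≤ s * m i * N (c i) := by gcongr
      _ = s * (m i * N (c i)) := by ring
      _ ≤ s * C := by gcongr
  refine ⟨a, m, v, fun ρ y hρ => ?_, fun t ht y hy => ?_, fun t ht hmem => ?_⟩
  · obtain ⟨t, rfl⟩ := hspan ρ
    have ht : ∀ i, |(t i : ℝ)| * N (c i) ≤ C := fun i => by
      have h1 := hc t i
      have h2 := (hNle _ y).trans hρ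
      nlinarith
    refine ⟨t, fun i => ?_, hv1 _ ?_⟩
    · rw [← Int.natCast_natAbs, Nat.cast_le, hm]
      apply Nat.le_floor
      rw [le_div_iff₀ (hμ i), Nat.cast_natAbs, Int.cast_abs]
      exact ht i
    · have : ((0, y - ∑ i, (t i : ℝ) • a i) : R × (Fin k → ℝ))
          = (∑ i, t i • c i, y) - (∑ i, t i • c i, ∑ i, (t i : ℝ) • a i) := by
        simp
      rw [this]
      refine (map_sub_le_add p _ _).trans ?_
      have := hsmall t 1 (by simpa using ht)
      linarith
  · refine ⟨∑ i, t i • c i, ?_⟩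
    have : ((∑ i, t i • c i, ∑ i, (t i : ℝ) • a i + y) : R × (Fin k → ℝ))
          = (∑ i, t i • c i, ∑ i, (t i : ℝ) • a i) + (0, y) := by simp
    rw [this]
    refine (map_add_le_add p _ _).trans ?_
    have := hsmall t 1 (by simpa using hmul t 1 (by simpa using ht))
    linarith [hv2 y hy]
  · obtain ⟨y, hy, hye⟩ := hmem
    have h0 : ∑ i, t i • c i = 0 := by
      apply hrel
      have : ((∑ i, t i • c i, 0) : R × (Fin k → ℝ))
          = (∑ i, t i • c i, ∑ i, (t i : ℝ) • a i) - (L : ℤ) • (0, y) := by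
        refine Prod.ext ?_ ?_
        · simp
        · rw [Prod.snd_sub, Prod.smul_snd, ← Int.cast_smul_eq_zsmul ℝ, ← hye]; simp
      rw [this]
      refine (map_sub_le_add p _ _).trans ?_
      rw [map_smul_eq_mul p (L : ℤ), Int.norm_natCast]
      have h1 := hsmall t L (hmul t L (by exact_mod_cast ht))
      have h2 := mul_le_mul_of_nonneg_left (hv2 y hy) (Nat.cast_nonneg (α := ℝ) L)
      linarith
    ext i
    have h1 := hc t i
    rw [h0, map_zero, mul_zero] at h1
    have h2 : |(t i : ℝ)| = 0 := by
      by_contra hne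
      have : 0 < |(t i : ℝ)| := lt_of_le_of_ne (abs_nonneg _) (Ne.symm hne)
      nlinarith [mul_pos this (hμ i)]
    simpa using h2

/-- Passing to the quotient by a shortest vector of the lattice part preserves lattice-likeness. -/
theorem Seminorm.IsLatticeLike.push {k : ℕ} {R R' : Type} [AddCommGroup R] [AddCommGroup R']
    {p : Seminorm ℤ (R × (Fin k → ℝ))} (hp : p.IsLatticeLike) {g : R →+ R'}
    (hf : Function.Surjective (g.prodMap (AddMonoidHom.id (Fin k → ℝ)))) {c : ℝ}
    (hlift : ∀ ρ' y r, p.push hf (ρ', y) < r → ∃ ρ, g ρ = ρ' ∧ p (ρ, y) < r + c) :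
    (p.push hf).IsLatticeLike := by
  have hlift' : ∀ ρ' y r, p.push hf (ρ', y) ≤ r → ∃ ρ, g ρ = ρ' ∧ p (ρ, y) ≤ r + 1 + c :=
    fun ρ' y r h => by
      obtain ⟨ρ, h1, h2⟩ := hlift ρ' y (r + 1) (lt_of_le_of_lt h (lt_add_one r))
      exact ⟨ρ, h1, h2.le⟩
  refine ⟨fun r => ?_, ?_, fun r => ?_⟩
  · refine ((hp.finite_fst (r + 1 + c)).image g).subset ?_
    rintro ρ' ⟨y, hy⟩
    obtain ⟨ρ, rfl, h⟩ := hlift' _ _ _ hy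
    exact ⟨ρ, ⟨y, h⟩, rfl⟩
  · obtain ⟨B, hB⟩ := hp.bound_snd
    refine ⟨B, fun y => le_trans ?_ (hB y)⟩
    simpa using p.push_apply_le hf (0, y)
  · set r' := r + 1 + c
    refine ((hp.finite_fst r').biUnion (t := fun ρ => {z : Fin k → ℤ | p (ρ, intCastVec k z) ≤ r'})
      fun ρ _ => ?_).subset ?_
    · rcases Set.eq_empty_or_nonempty {z : Fin k → ℤ | p (ρ, intCastVec k z) ≤ r'} with h | ⟨z₀, hz₀⟩
      · rw [h]; exact Set.finite_empty
      · refine ((hp.finite_snd (r' + r')).image (· + z₀)).subset fun z hz => ⟨z - z₀, ?_, by simp⟩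
        have : ((0, intCastVec k (z - z₀)) : R × (Fin k → ℝ))
            = (ρ, intCastVec k z) - (ρ, intCastVec k z₀) := by simp
        change p (0, intCastVec k (z - z₀)) ≤ r' + r'
        rw [this]
        exact (map_sub_le_add p _ _).trans (add_le_add hz hz₀)
    · intro z hz
      obtain ⟨ρ, -, h⟩ := hlift' _ _ _ hz
      have hρ : ρ ∈ {ρ | ∃ y, p (ρ, y) ≤ r'} := ⟨_, h⟩
      exact Set.mem_biUnion hρ h

/-- A lattice-like ball is comparable to a generalised arithmetic progression, of rank at most that
of the lattice, plus a parallelotope, with no relation among the generators of height at most `L`. -/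
theorem exists_gap_of_isLatticeLike (k L D : ℕ) : ∃ C : ℝ, 1 ≤ C ∧
    ∀ (R : Type) [AddCommGroup R] [Module.Finite ℤ R] [IsAddTorsionFree R]
      (p : Seminorm ℤ (R × (Fin k → ℝ))), Module.finrank ℤ R = D → p.IsLatticeLike →
      ∃ D' ≤ D, ∃ (a : Fin D' → Fin k → ℝ) (m : Fin D' → ℕ) (v : Fin k → Fin k → ℝ),
        (∀ ρ y, p (ρ, y) ≤ 1 → ∃ t : Fin D' → ℤ, (∀ i, |t i| ≤ m i) ∧
          y - ∑ i, (t i : ℝ) • a i ∈ symParallelotope v) ∧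
        (∀ t : Fin D' → ℤ, (∀ i, |t i| ≤ m i) → ∀ y ∈ symParallelotope v,
          ∃ ρ, p (ρ, ∑ i, (t i : ℝ) • a i + y) ≤ C) ∧
        (∀ t : Fin D' → ℤ, (∀ i, |t i| ≤ L * m i) →
          (∑ i, (t i : ℝ) • a i) ∈ (L : ℝ) • symParallelotope v → t = 0) := by
  induction D with
  | zero =>
    obtain ⟨C, hC, h⟩ := exists_gap_of_no_relation k 0
    refine ⟨C, hC, fun R _ _ _ p hrank hp => ⟨0, le_refl _, h L R p hrank hp fun ρ _ => ?_⟩⟩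
    have := Module.finrank_zero_iff.1 hrank
    exact Subsingleton.elim _ _
  | succ D ih =>
    obtain ⟨C₁, hC₁, h₁⟩ := ih
    obtain ⟨C₂, hC₂, h₂⟩ := exists_gap_of_no_relation k (D + 1)
    have hLC : 0 ≤ L * C₂ := by positivity
    refine ⟨C₁ + C₂ + L * C₂, by linarith, fun R _ _ _ p hrank hp => ?_⟩
    by_cases hrel : ∀ ρ, p (ρ, 0) ≤ L * C₂ → ρ = 0
    · obtain ⟨a, m, v, ha, hb, hc⟩ := h₂ L R p hrank hp hrel
      refine ⟨D + 1, le_refl _, a, m, v, ha, fun t ht y hy => ?_, hc⟩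
      obtain ⟨ρ, hρ⟩ := hb t ht y hy
      exact ⟨ρ, by linarith⟩
    push Not at hrel
    obtain ⟨ρ₀, hρ₀, hne⟩ := hrel
    let p₀ : Seminorm ℤ R := p.comp (AddMonoidHom.inl R (Fin k → ℝ)).toIntLinearMap
    have hp₀ : ∀ ρ, p₀ ρ = p (ρ, 0) := fun ρ => rfl
    have hfin : ∀ r, {ρ | p₀ ρ ≤ r}.Finite := fun r =>
      (hp.finite_fst r).subset fun ρ hρ => ⟨0, hρ⟩
    obtain ⟨b, hb0, hb1, hb⟩ := p₀.exists_shortest hfin hne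
    have hpb : 0 < p₀ b := lt_of_le_of_ne (apply_nonneg p₀ _)
      fun h => hb0 (p₀.eq_zero_of_finite_balls hfin h.symm)
    have := isAddTorsionFree_quotient_of_shortest hpb hb
    set R' := R ⧸ AddSubgroup.zmultiples b
    let g : R →+ R' := QuotientAddGroup.mk' _
    have hf : Function.Surjective (g.prodMap (AddMonoidHom.id (Fin k → ℝ))) :=
      Function.Surjective.prodMap (QuotientAddGroup.mk'_surjective _) Function.surjective_id
    have : Module.Finite ℤ R' := Module.Finite.of_surjective g.toIntLinearMap
      (QuotientAddGroup.mk'_surjective _)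
    have hker : ∀ x, g.prodMap (AddMonoidHom.id (Fin k → ℝ)) x = 0 → ∃ s : ℤ, x = s • (b, 0) := by
      rintro ⟨x, y⟩ hx
      obtain ⟨h1, h2⟩ := Prod.ext_iff.1 hx
      obtain ⟨s, hs⟩ := AddSubgroup.mem_zmultiples_iff.1 ((QuotientAddGroup.eq_zero_iff x).1 h1)
      refine ⟨s, Prod.ext hs.symm ?_⟩
      simpa using h2
    have hgb : g.prodMap (AddMonoidHom.id (Fin k → ℝ)) (b, 0) = 0 :=
      Prod.ext ((QuotientAddGroup.eq_zero_iff b).2 (AddSubgroup.mem_zmultiples b)) rfl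
    have hlift : ∀ ρ' y r, p.push hf (ρ', y) < r → ∃ ρ, g ρ = ρ' ∧ p (ρ, y) < r + p₀ b / 2 := by
      intro ρ' y r h
      obtain ⟨⟨ρ, y'⟩, h1, h2⟩ := p.exists_lift_of_push_lt hf hgb hker h
      obtain ⟨h3, h4⟩ := Prod.ext_iff.1 h1
      obtain rfl : y' = y := h4
      exact ⟨ρ, h3, h2⟩
    have hrank' : Module.finrank ℤ R' = D := by
      have : Module.finrank ℤ R' + 1 = Module.finrank ℤ R := finrank_quotient_zmultiples hb0
      omega
    obtain ⟨D', hD', a, m, v, ha, hb', hc⟩ := h₁ R' (p.push hf) hrank' (hp.push hf hlift)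
    refine ⟨D', hD'.trans (Nat.le_succ D), a, m, v, fun ρ y hρ => ?_, fun t ht y hy => ?_, hc⟩
    · exact ha (g ρ) y ((p.push_apply_le hf (ρ, y)).trans hρ)
    · obtain ⟨ρ', hρ'⟩ := hb' t ht y hy
      obtain ⟨ρ, -, hρ⟩ := hlift _ _ (C₁ + 1) (lt_of_le_of_lt hρ' (lt_add_one _))
      have := hp₀ ρ₀
      exact ⟨ρ, by linarith⟩

/-- The box of integer vectors `t` with `|t i| ≤ m i`. -/
noncomputable def intBox {ι : Type*} [Fintype ι] [DecidableEq ι] (m : ι → ℕ) : Finset (ι → ℤ) :=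
  Fintype.piFinset fun i => Finset.Icc (-(m i : ℤ)) (m i)

theorem mem_intBox {ι : Type*} [Fintype ι] [DecidableEq ι] {m : ι → ℕ} {t : ι → ℤ} :
    t ∈ intBox m ↔ ∀ i, |t i| ≤ m i := by
  simp [intBox, abs_le]

theorem card_intBox {ι : Type*} [Fintype ι] [DecidableEq ι] (m : ι → ℕ) :
    (intBox m).card = ∏ i, (2 * m i + 1) := by
  rw [intBox, Fintype.card_piFinset]
  refine Finset.prod_congr rfl fun i _ => ?_
  rw [Int.card_Icc]
  omega

theorem card_intBox_mul_le {ι : Type*} [Fintype ι] [DecidableEq ι] (m : ι → ℕ) {c : ℕ}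
    (hc : 1 ≤ c) : (intBox fun i => c * m i).card ≤ c ^ Fintype.card ι * (intBox m).card := by
  rw [card_intBox, card_intBox, ← Finset.card_univ, ← Finset.prod_const, ← Finset.prod_mul_distrib]
  exact Finset.prod_le_prod' fun i _ => by nlinarith

theorem isCompact_symParallelotope {k : ℕ} (v : Fin k → Fin k → ℝ) :
    IsCompact (symParallelotope v) :=
  isCompact_Icc.image (by fun_prop)

theorem smul_mem_symParallelotope {k : ℕ} {v : Fin k → Fin k → ℝ} {y : Fin k → ℝ}
    (hy : y ∈ symParallelotope v) {s : ℝ} (hs : |s| ≤ 1) : s • y ∈ symParallelotope v := by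
  obtain ⟨c, hc, rfl⟩ := mem_symParallelotope.1 hy
  refine mem_symParallelotope.2 ⟨fun i => s * c i, fun i => ?_, ?_⟩
  · rw [abs_mul]; exact mul_le_one₀ hs (abs_nonneg _) (hc i)
  · rw [Finset.smul_sum]; simp_rw [smul_smul]

theorem smul_add_smul_mem_symParallelotope {k : ℕ} {v : Fin k → Fin k → ℝ} {x y : Fin k → ℝ}
    (hx : x ∈ symParallelotope v) (hy : y ∈ symParallelotope v) {r s : ℝ} (h : |r| + |s| ≤ 1) :
    r • x + s • y ∈ symParallelotope v := by
  obtain ⟨c, hc, rfl⟩ := mem_symParallelotope.1 hx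
  obtain ⟨d, hd, rfl⟩ := mem_symParallelotope.1 hy
  refine mem_symParallelotope.2 ⟨fun i => r * c i + s * d i, fun i => ?_, ?_⟩
  · refine (abs_add_le _ _).trans ?_
    rw [abs_mul, abs_mul]
    nlinarith [hc i, hd i, abs_nonneg r, abs_nonneg s]
  · rw [Finset.smul_sum, Finset.smul_sum, ← Finset.sum_add_distrib]
    refine Finset.sum_congr rfl fun i _ => ?_
    module

/-- The seminorm `x ↦ ‖φ x‖` attached to an additive map into a normed space. -/
noncomputable def AddMonoidHom.normSeminormInt {M W : Type*} [AddCommGroup M]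
    [NormedAddCommGroup W] [NormedSpace ℝ W] (φ : M →+ W) : Seminorm ℤ M :=
  Seminorm.of (fun x => ‖φ x‖) (fun x y => by rw [map_add]; exact norm_add_le _ _) fun n x => by
    rw [map_zsmul, ← Int.cast_smul_eq_zsmul ℝ, norm_smul, Int.norm_eq_abs, Real.norm_eq_abs]

theorem finite_setOf_forall_abs_le {ι : Type*} [Finite ι] (c : ι → ℝ) :
    {t : ι → ℤ | ∀ i, |(t i : ℝ)| ≤ c i}.Finite := by
  have := Fintype.ofFinite ι
  classical
  refine (intBox fun i => ⌈c i⌉₊).finite_toSet.subset fun t ht => ?_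
  rw [Finset.mem_coe, mem_intBox]
  intro i
  have h : |(t i : ℝ)| ≤ ⌈c i⌉₊ := (ht i).trans (Nat.le_ceil _)
  exact_mod_cast h

theorem exists_gap_of_gap_add_ball (k L D₀ : ℕ) : ∃ C : ℕ, 1 ≤ C ∧
    ∀ D ≤ D₀, ∀ (a : Fin D → Fin k → ℝ) (m : Fin D → ℕ), (∀ i, 1 ≤ m i) → ∀ δ : ℝ, 0 < δ →
      ∃ D' ≤ D, ∃ (a' : Fin D' → Fin k → ℝ) (m' : Fin D' → ℕ) (v : Fin k → Fin k → ℝ),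
        (∀ t ∈ intBox m, ∀ y, ‖y‖ ≤ δ → ∃ t' ∈ intBox m',
          ∑ i, (t i : ℝ) • a i + y - ∑ i, (t' i : ℝ) • a' i ∈ symParallelotope v) ∧
        (∀ t' ∈ intBox m', ∀ y ∈ symParallelotope v, ∃ t ∈ intBox fun i => C * m i,
          ‖∑ i, (t' i : ℝ) • a' i + y - ∑ i, (t i : ℝ) • a i‖ ≤ C * δ) ∧
        (∀ t : Fin D' → ℤ, (∀ i, |t i| ≤ L * m' i) →
          (∑ i, (t i : ℝ) • a' i) ∈ (L : ℝ) • symParallelotope v → t = 0) := by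
  choose C hC h using exists_gap_of_isLatticeLike k L
  have hle : ∀ D ≤ D₀, C D ≤ ⌈∑ i ∈ Finset.range (D₀ + 1), C i⌉₊ := fun D hD =>
    (Finset.single_le_sum (f := C) (fun i _ => zero_le_one.trans (hC i))
      (Finset.mem_range.2 (Nat.lt_succ_of_le hD))).trans (Nat.le_ceil _)
  refine ⟨⌈∑ i ∈ Finset.range (D₀ + 1), C i⌉₊, ?_, fun D hD a m hm δ hδ => ?_⟩
  · exact_mod_cast (hC 0).trans (hle 0 (Nat.zero_le _))
  replace hle := hle D hD
  set K := ⌈∑ i ∈ Finset.range (D₀ + 1), C i⌉₊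
  have hm' : ∀ i, (0 : ℝ) < m i := fun i => by exact_mod_cast hm i
  let φ : (Fin D → ℤ) × (Fin k → ℝ) →+ (Fin D → ℝ) × (Fin k → ℝ) :=
    { toFun := fun x => (fun i => x.1 i / m i, δ⁻¹ • (x.2 - ∑ i, (x.1 i : ℝ) • a i))
      map_zero' := by ext <;> simp
      map_add' := fun x y => by
        refine Prod.ext ?_ ?_
        · ext i; simp [add_div]
        · simp only [Prod.fst_add, Prod.snd_add, Pi.add_apply, Int.cast_add, add_smul,
            Finset.sum_add_distrib]
          module }
  set p := φ.normSeminormInt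
  have hp : ∀ ρ y r, 0 ≤ r → (p (ρ, y) ≤ r ↔
      (∀ i, |(ρ i : ℝ)| ≤ r * m i) ∧ ‖y - ∑ i, (ρ i : ℝ) • a i‖ ≤ r * δ) := fun ρ y r hr => by
    change ‖φ (ρ, y)‖ ≤ r ↔ _
    rw [Prod.norm_def, max_le_iff, pi_norm_le_iff_of_nonneg hr]
    refine and_congr (forall_congr' fun i => ?_) ?_
    · change ‖(ρ i : ℝ) / m i‖ ≤ r ↔ _
      rw [norm_div, Real.norm_eq_abs, Real.norm_natCast, div_le_iff₀ (hm' i)]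
    · change ‖δ⁻¹ • (y - ∑ i, (ρ i : ℝ) • a i)‖ ≤ r ↔ _
      rw [norm_smul, norm_inv, Real.norm_of_nonneg hδ.le, inv_mul_le_iff₀ hδ, mul_comm]
  have hp' : ∀ ρ y r, p (ρ, y) ≤ r →
      (∀ i, |(ρ i : ℝ)| ≤ r * m i) ∧ ‖y - ∑ i, (ρ i : ℝ) • a i‖ ≤ r * δ :=
    fun ρ y r h => (hp ρ y r ((apply_nonneg p _).trans h)).1 h
  have hlat : p.IsLatticeLike := by
    refine ⟨fun r => (finite_setOf_forall_abs_le fun i => r * m i).subset ?_, ⟨δ⁻¹, fun y => ?_⟩,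
      fun r => (finite_setOf_forall_abs_le fun _ => r * δ).subset fun z hz i => ?_⟩
    · rintro ρ ⟨y, hy⟩
      exact (hp' _ _ _ hy).1
    · refine (hp _ _ _ (by positivity)).2 ⟨fun i => ?_, ?_⟩
      · simp only [Pi.zero_apply, Int.cast_zero, abs_zero]; positivity
      · simp only [Pi.zero_apply, Int.cast_zero, zero_smul, Finset.sum_const_zero, sub_zero]
        apply le_of_eq
        field_simp
    · have h1 := (hp' _ _ _ hz).2
      simp only [Pi.zero_apply, Int.cast_zero, zero_smul, Finset.sum_const_zero, sub_zero] at h1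
      exact (norm_le_pi_norm (intCastVec k z) i).trans h1
  obtain ⟨D', hD', a', m', v, h1, h2, h3⟩ := h D (Fin D → ℤ) p (Module.finrank_fin_fun ℤ) hlat
  refine ⟨D', hD', a', m', v, fun t ht y hy => ?_, fun t' ht' y hy => ?_, h3⟩
  · have ht1 : ∀ i, |(t i : ℝ)| ≤ 1 * m i := fun i => by
      rw [one_mul]; exact_mod_cast mem_intBox.1 ht i
    obtain ⟨t', ht', h⟩ := h1 t (∑ i, (t i : ℝ) • a i + y)
      ((hp _ _ _ zero_le_one).2 ⟨ht1, by simpa using hy⟩)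
    exact ⟨t', mem_intBox.2 ht', h⟩
  · obtain ⟨ρ, hρ⟩ := h2 t' (mem_intBox.1 ht') y hy
    obtain ⟨h4, h5⟩ := hp' _ _ _ (hρ.trans hle)
    exact ⟨ρ, mem_intBox.2 fun i => by exact_mod_cast h4 i, h5⟩

/-- Distinct points of the progression have disjoint half-parallelotopes around them. -/
theorem pairwiseDisjoint_half_symParallelotope {k D L : ℕ} (hL : 2 ≤ L) {a : Fin D → Fin k → ℝ}
    {m : Fin D → ℕ} {v : Fin k → Fin k → ℝ}
    (h : ∀ t : Fin D → ℤ, (∀ i, |t i| ≤ L * m i) →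
      (∑ i, (t i : ℝ) • a i) ∈ (L : ℝ) • symParallelotope v → t = 0) :
    (intBox m : Set (Fin D → ℤ)).PairwiseDisjoint
      fun t => (∑ i, (t i : ℝ) • a i) +ᵥ ((2⁻¹ : ℝ) • symParallelotope v) := by
  have hL0 : (L : ℝ) ≠ 0 := by positivity
  have hL1 : (1 : ℝ) ≤ L := by exact_mod_cast (by omega : 1 ≤ L)
  intro t ht s hs hne
  rw [Function.onFun, Set.disjoint_left]
  rintro _ ⟨_, ⟨y, hy, rfl⟩, rfl⟩ ⟨_, ⟨z, hz, rfl⟩, hzy⟩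
  refine hne (sub_eq_zero.1 (h (t - s) (fun i => ?_) ?_))
  · have h1 := mem_intBox.1 ht i
    have h2 := mem_intBox.1 hs i
    rw [Pi.sub_apply]
    have h3 := abs_sub (t i) (s i)
    have : (2 : ℤ) * m i ≤ L * m i := by gcongr; exact_mod_cast hL
    linarith
  · rw [Set.mem_smul_set_iff_inv_smul_mem₀ hL0]
    have : ∑ i, ((t - s) i : ℝ) • a i = (2⁻¹ : ℝ) • z + (-2⁻¹ : ℝ) • y := by
      simp only [Pi.sub_apply, Int.cast_sub, sub_smul, Finset.sum_sub_distrib]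
      simp only [vadd_eq_add] at hzy
      rw [neg_smul, ← sub_eq_add_neg, sub_eq_sub_iff_add_eq_add, ← hzy]
      abel
    rw [this]
    refine smul_mem_symParallelotope (smul_add_smul_mem_symParallelotope hz hy (by norm_num)) ?_
    rw [abs_inv, Nat.abs_cast]
    exact inv_le_one_of_one_le₀ hL1

theorem card_mul_volume_symParallelotope_le {k D D' L C : ℕ} (hL : 2 ≤ L) (hC : 1 ≤ C)
    {a : Fin D → Fin k → ℝ} {m : Fin D → ℕ} {δ : ℝ} (hδ : 0 < δ) {a' : Fin D' → Fin k → ℝ}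
    {m' : Fin D' → ℕ} {v : Fin k → Fin k → ℝ}
    (h : ∀ t : Fin D' → ℤ, (∀ i, |t i| ≤ L * m' i) →
      (∑ i, (t i : ℝ) • a' i) ∈ (L : ℝ) • symParallelotope v → t = 0)
    (h' : ∀ t' ∈ intBox m', ∀ y ∈ symParallelotope v, ∃ t ∈ intBox fun i => C * m i,
          ‖∑ i, (t' i : ℝ) • a' i + y - ∑ i, (t i : ℝ) • a i‖ ≤ C * δ) :
    ((intBox m').card : ℝ≥0∞) * volume (symParallelotope v)
      ≤ ((4 * C) ^ k * C ^ D : ℕ) * ((intBox m).card * ENNReal.ofReal δ ^ k) := by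
  have hmeas : ∀ t : Fin D' → ℤ, MeasurableSet
      ((∑ i, (t i : ℝ) • a' i) +ᵥ ((2⁻¹ : ℝ) • symParallelotope v)) := fun t =>
    (((isCompact_symParallelotope v).smul (2⁻¹ : ℝ)).vadd _).measurableSet
  have hvol : ∀ t : Fin D' → ℤ, volume
      ((∑ i, (t i : ℝ) • a' i) +ᵥ ((2⁻¹ : ℝ) • symParallelotope v))
      = ENNReal.ofReal ((2⁻¹ : ℝ) ^ k) * volume (symParallelotope v) := fun t => by
    rw [measure_vadd, Measure.addHaar_smul_of_nonneg volume (by norm_num)]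
    simp
  have h1 := measure_biUnion_finset (μ := volume) (pairwiseDisjoint_half_symParallelotope hL h)
    fun t _ => hmeas t
  simp_rw [hvol] at h1
  rw [Finset.sum_const, nsmul_eq_mul] at h1
  have hsub : (⋃ t ∈ intBox m', (∑ i, (t i : ℝ) • a' i) +ᵥ ((2⁻¹ : ℝ) • symParallelotope v)) ⊆
      ⋃ t ∈ intBox (fun i => C * m i), Metric.closedBall (∑ i, (t i : ℝ) • a i) (C * δ) := by
    refine Set.iUnion₂_subset fun t ht => ?_
    rintro _ ⟨_, ⟨y, hy, rfl⟩, rfl⟩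
    obtain ⟨s, hs, hy'⟩ := h' t ht _ (smul_mem_symParallelotope hy (s := 2⁻¹) (by norm_num))
    refine Set.mem_biUnion hs ?_
    rw [mem_closedBall_iff_norm]
    exact hy'
  have h2 := (measure_mono hsub).trans (measure_biUnion_finset_le (μ := volume) _ _)
  simp_rw [Real.volume_pi_closedBall _ (show 0 ≤ (C : ℝ) * δ by positivity)] at h2
  rw [h1, Finset.sum_const, nsmul_eq_mul, Fintype.card_fin] at h2
  have h3 := card_intBox_mul_le m hC
  rw [Fintype.card_fin] at h3
  have e1 : ENNReal.ofReal ((2⁻¹ : ℝ) ^ k) * 2 ^ k = 1 := by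
    rw [ENNReal.ofReal_pow (by norm_num), ENNReal.ofReal_inv_of_pos (by norm_num), ← mul_pow]
    simp [ENNReal.inv_mul_cancel]
  have e2 : ENNReal.ofReal ((2 * (C * δ)) ^ k) = 2 ^ k * C ^ k * ENNReal.ofReal δ ^ k := by
    rw [ENNReal.ofReal_pow (by positivity), ENNReal.ofReal_mul (by norm_num),
      ENNReal.ofReal_mul (by positivity), mul_pow, mul_pow, mul_assoc]
    simp
  calc ((intBox m').card : ℝ≥0∞) * volume (symParallelotope v)
      = (intBox m').card * (ENNReal.ofReal ((2⁻¹ : ℝ) ^ k) * volume (symParallelotope v))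
          * 2 ^ k := by
        rw [mul_assoc, mul_right_comm, e1, one_mul]
    _ ≤ ((C ^ D * (intBox m).card : ℕ) : ℝ≥0∞) * (2 ^ k * C ^ k * ENNReal.ofReal δ ^ k) * 2 ^ k := by
        rw [e2] at h2
        refine mul_le_mul_left (h2.trans ?_) _
        gcongr
    _ = _ := by
        have : (4 : ℝ≥0∞) ^ k = 2 ^ k * 2 ^ k := by rw [← mul_pow]; norm_num
        push_cast
        rw [mul_pow, this]
        ring

/-- Finitely many nonzero integer vectors can be kept nonzero by a single linear functional. -/
theorem exists_addMonoidHom_int_ne_zero {k : ℕ} (S : Finset (Fin k → ℤ)) :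
    ∃ θ : (Fin k → ℤ) →+ ℤ, ∀ y ∈ S, y ≠ 0 → θ y ≠ 0 := by
  classical
  let f : (Fin k → ℤ) → Polynomial ℤ := fun y => ∑ i : Fin k, Polynomial.monomial (i : ℕ) (y i)
  have hcoeff : ∀ y i, (f y).coeff (i : Fin k) = y i := fun y i => by
    simp [f, Polynomial.finsetSum_coeff, Polynomial.coeff_monomial, Fin.val_inj]
  have hf : ∀ y, y ≠ 0 → f y ≠ 0 := fun y hy h => hy <| by
    ext i
    rw [← hcoeff y i, h]; simp
  have hprod : ∏ y ∈ S.erase 0, f y ≠ 0 :=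
    Finset.prod_ne_zero_iff.2 fun y hy => hf y (Finset.ne_of_mem_erase hy)
  obtain ⟨B, hB⟩ : ∃ B : ℤ, (∏ y ∈ S.erase 0, f y).eval B ≠ 0 := by
    by_contra! h
    exact hprod (Polynomial.funext fun r => by simp [h r])
  rw [Polynomial.eval_prod, Finset.prod_ne_zero_iff] at hB
  refine ⟨⟨⟨fun y => ∑ i, y i * B ^ (i : ℕ), by simp⟩, fun x y => ?_⟩, fun y hy hy0 => ?_⟩
  · simp [add_mul, Finset.sum_add_distrib]
  · have := hB y (Finset.mem_erase.2 ⟨hy0, hy⟩)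
    simpa [f, Polynomial.eval_finsetSum, Polynomial.eval_monomial] using this

theorem card_filter_dvd_val_le {p N : ℕ} [NeZero p] :
    (Finset.univ.filter fun x : ZMod p => N ∣ x.val).card ≤ p / N + 1 := by
  classical
  have h1 : (Finset.univ.filter fun x : ZMod p => N ∣ x.val).card
      ≤ (Finset.range (p / N + 1)).card := by
    refine Finset.card_le_card_of_injOn (fun x => x.val / N) (fun x _ => ?_) fun x hx y hy hxy => ?_
    · simp only [Finset.coe_range, Set.mem_Iio]
      exact Nat.lt_succ_of_le (Nat.div_le_div_right (ZMod.val_lt x).le)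
    · simp only [Finset.coe_filter, Finset.mem_univ, true_and, Set.mem_ofPred_eq] at hx hy
      apply ZMod.val_injective p
      rw [← Nat.div_mul_cancel hx, ← Nat.div_mul_cancel hy]
      exact congrArg (· * N) hxy
  simpa using h1

/-- Some dilate modulo a large prime sends no element of `T` to a residue divisible by `N`. -/
theorem exists_prime_multiplier (T : Finset ℤ) (hT : (0 : ℤ) ∉ T) {N : ℕ} (hN : T.card < N) :
    ∃ p : ℕ, p.Prime ∧ ∃ c : ZMod p, ∀ t ∈ T, ¬ N ∣ (c * (t : ZMod p)).val := by
  classical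
  obtain ⟨p, hp, hprime⟩ := Nat.exists_infinite_primes (N * N + 1 + ∑ t ∈ T, t.natAbs)
  have := Fact.mk hprime
  refine ⟨p, hprime, ?_⟩
  have hne : ∀ t ∈ T, (t : ZMod p) ≠ 0 := fun t ht h => by
    rw [ZMod.intCast_zmod_eq_zero_iff_dvd] at h
    have h0 : t ≠ 0 := fun h => hT (h ▸ ht)
    have h1 := Nat.le_of_dvd (Int.natAbs_pos.2 h0) (Int.natCast_dvd.1 h)
    have h2 := Finset.single_le_sum (f := Int.natAbs) (fun _ _ => Nat.zero_le _) ht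
    omega
  have hcard : ∀ t ∈ T,
      (Finset.univ.filter fun c : ZMod p => N ∣ (c * (t : ZMod p)).val).card ≤ p / N + 1 := by
    intro t ht
    refine le_trans (Finset.card_le_card_of_injOn (fun c => c * (t : ZMod p)) (fun c hc => ?_)
      (fun x _ y _ hxy => mul_right_cancel₀ (hne t ht) hxy))
      (card_filter_dvd_val_le (p := p) (N := N))
    simpa using hc
  have hU := Finset.card_biUnion_le_card_mul T _ _ hcard
  have hlt : T.card * (p / N + 1) < (Finset.univ : Finset (ZMod p)).card := by
    rw [Finset.card_univ, ZMod.card]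
    have h1 : N * (p / N) ≤ p := Nat.mul_div_le p N
    have h2 : N ≤ p / N := (Nat.le_div_iff_mul_le (by omega)).2 (by omega)
    have h3 : (T.card + 1) * (p / N) ≤ N * (p / N) := Nat.mul_le_mul_right _ hN
    nlinarith
  obtain ⟨c, -, hc⟩ := Finset.exists_mem_notMem_of_card_lt_card (hU.trans_lt hlt)
  refine ⟨c, fun t ht h => hc ?_⟩
  exact Finset.mem_biUnion.2 ⟨t, ht, by simpa using h⟩

/-- A proportion at least `1/6` of `G` has a Freiman model of order `6` in `ZMod N`. -/
theorem exists_freiman_model {k N : ℕ} (G S : Finset (Fin k → ℤ)) (hG : G.Nonempty)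
    (hS : ∀ g g' : Fin 6 → Fin k → ℤ, (∀ i, g i ∈ G) → (∀ i, g' i ∈ G) → ∑ i, g i - ∑ i, g' i ∈ S)
    (hN : S.card ≤ N) :
    ∃ G' ⊆ G, G.card ≤ 6 * G'.card ∧ ∃ π : (Fin k → ℤ) → ZMod N,
      ∀ g g' : Fin 6 → Fin k → ℤ, (∀ i, g i ∈ G') → (∀ i, g' i ∈ G') →
        (∑ i, π (g i) = ∑ i, π (g' i) ↔ ∑ i, g i = ∑ i, g' i) := by
  classical
  obtain ⟨θ, hθ⟩ := exists_addMonoidHom_int_ne_zero S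
  obtain ⟨g₀, hg₀⟩ := hG
  have h0 : (0 : Fin k → ℤ) ∈ S := by
    simpa using hS (fun _ => g₀) (fun _ => g₀) (fun _ => hg₀) fun _ => hg₀
  obtain ⟨p, hprime, c, hc⟩ := exists_prime_multiplier ((S.erase 0).image θ)
    (by
      intro h
      obtain ⟨y, hy, hy0⟩ := Finset.mem_image.1 h
      exact hθ y (Finset.mem_of_mem_erase hy) (Finset.ne_of_mem_erase hy) hy0)
    (N := N) (lt_of_le_of_lt Finset.card_image_le
      (lt_of_lt_of_le (Finset.card_lt_card (Finset.erase_ssubset h0)) hN))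
  have := Fact.mk hprime
  have hp0 : 0 < p := hprime.pos
  let r : (Fin k → ℤ) → ℕ := fun g => (c * (θ g : ZMod p)).val
  have hr : ∀ g, r g < p := fun g => ZMod.val_lt _
  have hrcast : ∀ g, ((r g : ℤ) : ZMod p) = c * (θ g : ZMod p) := fun g => by
    simp [r]
  obtain ⟨j, -, hj⟩ := Finset.exists_le_card_fiber_of_nsmul_le_card_of_maps_to (M := ℚ) (s := G)
    (t := Finset.range 6) (f := fun g => 6 * r g / p) (b := G.card / 6)
    (fun g _ => Finset.mem_range.2 ((Nat.div_lt_iff_lt_mul hp0).2 (by have := hr g; omega)))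
    (by simp) (by
      rw [Finset.card_range, nsmul_eq_mul]
      apply le_of_eq
      push_cast
      ring)
  refine ⟨G.filter fun g => 6 * r g / p = j, Finset.filter_subset _ _, ?_, fun g => r g, ?_⟩
  · rw [div_le_iff₀ (by norm_num)] at hj
    rw [mul_comm]
    exact_mod_cast hj
  intro g g' hg hg'
  have hbd : ∀ g, g ∈ G.filter (fun g => 6 * r g / p = j) → j * p ≤ 6 * r g ∧ 6 * r g < (j + 1) * p :=
    fun g hg => by
      obtain rfl := (Finset.mem_filter.1 hg).2
      exact ⟨Nat.div_mul_le_self _ _, by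
        rw [mul_comm (_ + 1)]; exact Nat.lt_mul_div_succ _ hp0⟩
  set x := ∑ i, g i - ∑ i, g' i with hx
  have hxS : x ∈ S := hS g g' (fun i => (Finset.mem_filter.1 (hg i)).1)
    fun i => (Finset.mem_filter.1 (hg' i)).1
  have hxS' : -x ∈ S := by
    rw [hx, neg_sub]
    exact hS g' g (fun i => (Finset.mem_filter.1 (hg' i)).1) fun i => (Finset.mem_filter.1 (hg i)).1
  set z : ℤ := ∑ i, (r (g i) : ℤ) - ∑ i, (r (g' i) : ℤ) with hz
  have hzp : ((z : ℤ) : ZMod p) = c * (θ x : ZMod p) := by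
    rw [hz, hx]
    push_cast [map_sub, map_sum]
    rw [mul_sub, Finset.mul_sum, Finset.mul_sum]
    congr 1 <;> refine Finset.sum_congr rfl fun i _ => ?_
    · simpa using hrcast (g i)
    · simpa using hrcast (g' i)
  have hzlt : |z| < p := by
    have h1 := fun i => hbd _ (hg i)
    have h2 := fun i => hbd _ (hg' i)
    zify at h1 h2
    rw [hz, Fin.sum_univ_six, Fin.sum_univ_six, abs_lt]
    constructor <;> linarith [h1 0, h1 1, h1 2, h1 3, h1 4, h1 5, h2 0, h2 1, h2 2, h2 3, h2 4, h2 5]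
  have hπ : ∑ i, ((r (g i) : ℕ) : ZMod N) = ∑ i, ((r (g' i) : ℕ) : ZMod N) ↔ (N : ℤ) ∣ z := by
    rw [← ZMod.intCast_zmod_eq_zero_iff_dvd, hz]
    push_cast
    rw [sub_eq_zero]
  have hval : ∀ (w : ℤ) (y : ZMod p), (w : ZMod p) = y → 0 ≤ w → w < p → (y.val : ℤ) = w := by
    rintro w y rfl h1 h2
    lift w to ℕ using h1
    rw [Int.cast_natCast, ZMod.val_natCast_of_lt (by exact_mod_cast h2)]
  have hbad : ∀ y ∈ S, y ≠ 0 → ∀ w : ℤ, (w : ZMod p) = c * (θ y : ZMod p) → 0 ≤ w → w < p →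
      ¬ (N : ℤ) ∣ w := fun y hy hy0 w hw h1 h2 h3 => by
    rw [← hval w _ hw h1 h2, Int.natCast_dvd_natCast] at h3
    exact hc (θ y) (Finset.mem_image_of_mem _ (Finset.mem_erase.2 ⟨hy0, hy⟩)) h3
  rw [hπ, ← sub_eq_zero, ← hx]
  rw [abs_lt] at hzlt
  constructor
  · intro hdvd
    by_contra hx0
    rcases le_total 0 z with h | h
    · exact hbad x hxS hx0 z hzp h hzlt.2 hdvd
    · refine hbad (-x) hxS' (neg_ne_zero.2 hx0) (-z) ?_ (by linarith) (by linarith)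
        ((dvd_neg).2 hdvd)
      rw [map_neg, Int.cast_neg, Int.cast_neg, hzp, mul_neg]
  · intro hx0
    rw [hx0, map_zero, Int.cast_zero, mul_zero, ZMod.intCast_zmod_eq_zero_iff_dvd] at hzp
    rw [Int.eq_zero_of_abs_lt_dvd hzp (abs_lt.2 hzlt)]
    exact dvd_zero _

/-- Bogolyubov's lemma: a Bohr set of bounded rank lies in `H + H - H - H`. -/
theorem exists_bohr_subset_two_sub_two {N : ℕ} [NeZero N] (H : Finset (ZMod N))
    (hH : H.Nonempty) :
    ∃ Γ : Finset (ZMod N), Γ.card * H.card ^ 2 ≤ N ^ 2 ∧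
      ∀ x : ZMod N, (∀ r ∈ Γ, 0 ≤ (ZMod.stdAddChar (r * x)).re) →
        ∃ h₁ ∈ H, ∃ h₂ ∈ H, ∃ h₃ ∈ H, ∃ h₄ ∈ H, x = h₁ + h₂ - h₃ - h₄ := by
  classical
  set e : AddChar (ZMod N) ℂ := ZMod.stdAddChar with he
  have hprim : e.IsPrimitive := ZMod.isPrimitive_stdAddChar N
  have horth : ∀ y : ZMod N, ∑ r, e (r * y) = if y = 0 then (N : ℂ) else 0 := fun y => by
    rw [AddChar.sum_mulShift y hprim, ZMod.card]
    split_ifs <;> simp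
  set F : ZMod N → ℂ := fun r => ∑ h ∈ H, e (r * h) with hF
  set w : ZMod N → ℝ := fun r => ‖F r‖ ^ 2 with hw
  have hw0 : ∀ r, 0 ≤ w r := fun r => by positivity
  have hwF : ∀ r, (w r : ℂ) = ∑ h ∈ H, ∑ h' ∈ H, e (r * (h - h')) := fun r => by
    rw [hw]
    push_cast
    rw [← Complex.mul_conj', hF, map_sum, Finset.sum_mul_sum]
    refine Finset.sum_congr rfl fun h _ => Finset.sum_congr rfl fun h' _ => ?_
    rw [← AddChar.map_neg_eq_conj, ← AddChar.map_add_eq_mul]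
    congr 1
    ring
  have hcard : (0 : ℝ) < H.card := by exact_mod_cast hH.card_pos
  have hN : (0 : ℝ) < N := by exact_mod_cast NeZero.pos N
  have hparseval : ∑ r, w r = N * H.card := by
    have : ((∑ r, w r : ℝ) : ℂ) = (N * H.card : ℝ) := by
      push_cast
      simp_rw [hwF]
      rw [Finset.sum_comm]
      have : ∀ h ∈ H, ∑ r, ∑ h' ∈ H, e (r * (h - h')) = N := fun h hh => by
        rw [Finset.sum_comm]
        simp_rw [horth, sub_eq_zero]
        rw [Finset.sum_ite_eq, if_pos hh]
      rw [Finset.sum_congr rfl this]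
      simp [mul_comm]
    exact_mod_cast this
  have hw00 : w 0 = H.card ^ 2 := by simp [hw, hF]
  refine ⟨Finset.univ.filter fun r => (H.card : ℝ) ^ 3 ≤ N * w r, ?_, fun x hx => ?_⟩
  · have h1 : (Finset.univ.filter fun r => (H.card : ℝ) ^ 3 ≤ N * w r).card • (H.card : ℝ) ^ 3
        ≤ ∑ r, N * w r :=
      (Finset.card_nsmul_le_sum _ _ _ fun r hr => (Finset.mem_filter.1 hr).2).trans
        (Finset.sum_le_sum_of_subset_of_nonneg (Finset.filter_subset _ _)
          fun r _ _ => mul_nonneg hN.le (hw0 r))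
    rw [← Finset.mul_sum, hparseval, nsmul_eq_mul] at h1
    have h2 : ((Finset.univ.filter fun r => (H.card : ℝ) ^ 3 ≤ N * w r).card : ℝ) * H.card ^ 2
        ≤ N ^ 2 := by
      refine le_of_mul_le_mul_right ?_ hcard
      nlinarith
    exact_mod_cast h2
  · by_contra! hno
    have hzero : ∑ r, ((w r : ℂ)) ^ 2 * e (r * -x) = 0 := by
      have h1 : ∀ r, ((w r : ℂ)) ^ 2 * e (r * -x) = ∑ h₁ ∈ H, ∑ h₃ ∈ H, ∑ h₂ ∈ H, ∑ h₄ ∈ H,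
          e (r * ((h₁ - h₃) + (h₂ - h₄) - x)) := fun r => by
        rw [sq, hwF, Finset.sum_mul, Finset.sum_mul]
        refine Finset.sum_congr rfl fun h₁ _ => ?_
        rw [Finset.sum_mul, Finset.sum_mul]
        refine Finset.sum_congr rfl fun h₃ _ => ?_
        rw [Finset.mul_sum, Finset.sum_mul]
        refine Finset.sum_congr rfl fun h₂ _ => ?_
        rw [Finset.mul_sum, Finset.sum_mul]
        refine Finset.sum_congr rfl fun h₄ _ => ?_
        rw [← AddChar.map_add_eq_mul, ← AddChar.map_add_eq_mul]
        congr 1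
        ring
      simp_rw [h1]
      rw [Finset.sum_comm]
      refine Finset.sum_eq_zero fun h₁ hh₁ => ?_
      rw [Finset.sum_comm]
      refine Finset.sum_eq_zero fun h₃ hh₃ => ?_
      rw [Finset.sum_comm]
      refine Finset.sum_eq_zero fun h₂ hh₂ => ?_
      rw [Finset.sum_comm]
      refine Finset.sum_eq_zero fun h₄ hh₄ => ?_
      rw [horth, if_neg]
      intro h
      refine hno h₁ hh₁ h₂ hh₂ h₃ hh₃ h₄ hh₄ ?_
      rw [sub_eq_zero] at h
      rw [← h]; ring
    have hre : ∀ r, (((w r : ℂ)) ^ 2 * e (r * -x)).re = w r ^ 2 * (e (r * x)).re := fun r => by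
      rw [mul_neg, AddChar.map_neg_eq_conj]
      have : ((w r : ℂ)) ^ 2 = ((w r ^ 2 : ℝ) : ℂ) := by push_cast; rfl
      rw [this, Complex.re_ofReal_mul, Complex.conj_re]
    have hsum : ∑ r, w r ^ 2 * (e (r * x)).re = 0 := by
      rw [← Finset.sum_congr rfl fun r _ => hre r, ← Complex.re_sum, hzero, Complex.zero_re]
    have hterm : ∀ r, -(w r * H.card ^ 3) ≤ N * (w r ^ 2 * (e (r * x)).re) := fun r => by
      have h1 : |(e (r * x)).re| ≤ 1 := (Complex.abs_re_le_norm _).trans (by simp)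
      by_cases hr : (H.card : ℝ) ^ 3 ≤ N * w r
      · have h2 := hx r (by simpa using hr)
        have h3 := hw0 r
        have : 0 ≤ N * (w r ^ 2 * (e (r * x)).re) := by positivity
        have : 0 ≤ w r * H.card ^ 3 := by positivity
        linarith
      · push Not at hr
        have h3 := hw0 r
        have h4 := (abs_le.1 h1).1
        have h5 : N * w r * w r ≤ H.card ^ 3 * w r := by gcongr
        have h6 : -(N * w r ^ 2) ≤ N * (w r ^ 2 * (e (r * x)).re) := by
          have : 0 ≤ N * w r ^ 2 := by positivity
          nlinarith
        nlinarith
    have h1 : ∑ r ∈ Finset.univ.erase (0 : ZMod N), -(w r * H.card ^ 3)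
        ≤ ∑ r ∈ Finset.univ.erase (0 : ZMod N), N * (w r ^ 2 * (e (r * x)).re) :=
      Finset.sum_le_sum fun r _ => hterm r
    have h2 : ∑ r ∈ Finset.univ.erase (0 : ZMod N), w r = N * H.card - H.card ^ 2 := by
      rw [← hparseval, ← Finset.add_sum_erase _ _ (Finset.mem_univ (0 : ZMod N)), hw00]; ring
    have h3 : ∑ r ∈ Finset.univ.erase (0 : ZMod N), w r ^ 2 * (e (r * x)).re
        = - (H.card ^ 2) ^ 2 := by
      rw [← Finset.add_sum_erase _ _ (Finset.mem_univ (0 : ZMod N)), hw00] at hsum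
      simp only [zero_mul, AddChar.map_zero_eq_one, Complex.one_re, mul_one] at hsum
      linarith
    rw [Finset.sum_neg_distrib, ← Finset.sum_mul, h2, ← Finset.mul_sum, h3] at h1
    have : (0 : ℝ) < (H.card : ℝ) ^ 5 := by positivity
    nlinarith

theorem re_stdAddChar_intCast {N : ℕ} [NeZero N] (j : ℤ) :
    (ZMod.stdAddChar (j : ZMod N)).re = Real.cos (2 * Real.pi * (j / N)) := by
  rw [ZMod.stdAddChar_coe, ← Complex.exp_ofReal_mul_I_re]
  congr 2
  push_cast
  ring

/-- A Bohr set of bounded rank contains a large proper progression. -/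
theorem exists_gap_in_bohr (D₀ : ℕ) : ∃ Q : ℕ, ∀ (N : ℕ) [NeZero N] (Γ : Finset (ZMod N)),
    Γ.card + 1 ≤ D₀ → ∃ (x : Fin (Γ.card + 1) → ZMod N) (m : Fin (Γ.card + 1) → ℕ),
      (∀ s ∈ intBox m, ∀ r ∈ Γ, 0 ≤ (ZMod.stdAddChar (r * ∑ i, s i • x i)).re) ∧
      Set.InjOn (fun s : Fin (Γ.card + 1) → ℤ => ∑ i, s i • x i) (intBox m) ∧
      N ≤ Q * (intBox m).card := by
  classical
  obtain ⟨C, hC, hgen⟩ := exists_reduced_generators_of_le D₀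
  set q : ℕ := ⌈4 * D₀ * C⌉₊ with hq
  refine ⟨q ^ D₀, fun N _ Γ hΓ => ?_⟩
  set D := Γ.card + 1 with hD
  have hN : (0 : ℝ) < N := by exact_mod_cast NeZero.pos N
  have hD1 : (1 : ℝ) ≤ D := by rw [hD]; push_cast; linarith [(Nat.cast_nonneg Γ.card : (0 : ℝ) ≤ _)]
  have hq4 : 4 * D * C ≤ q := by
    refine le_trans ?_ (Nat.le_ceil _)
    have : (D : ℝ) ≤ D₀ := by exact_mod_cast hΓ
    gcongr
  have hq1 : (1 : ℝ) ≤ q := by nlinarith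
  have hq0 : (0 : ℝ) < q := by linarith
  let φ : (Option Γ → ℤ) →+ (Option Γ → ℝ) :=
    { toFun := fun t o => o.elim ((t none : ℝ) / N)
        fun r => (t none : ℝ) * (r : ZMod N).val / N + t (some r)
      map_zero' := by ext o; cases o <;> simp
      map_add' := fun t t' => by
        ext o
        cases o <;> simp only [Option.elim, Pi.add_apply, Int.cast_add] <;> ring }
  have hφn : ∀ t, φ t none = (t none : ℝ) / N := fun t => rfl
  have hφs : ∀ t r, φ t (some r) = (t none : ℝ) * (r : ZMod N).val / N + t (some r) :=
    fun t r => rfl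
  set p := φ.normSeminormInt
  have hp : ∀ t r, 0 ≤ r → (p t ≤ r ↔ ∀ o, |φ t o| ≤ r) := fun t r hr =>
    pi_norm_le_iff_of_nonneg (x := φ t) hr
  have hp' : ∀ t r, p t ≤ r → ∀ o, |φ t o| ≤ r := fun t r h =>
    (hp t r ((apply_nonneg p t).trans h)).1 h
  have hfin : ∀ r, {t | p t ≤ r}.Finite := fun r => by
    refine (finite_setOf_forall_abs_le fun o : Option Γ => o.elim (r * N)
      fun ρ => r + r * (ρ : ZMod N).val).subset fun t ht o => ?_
    have h1 := hp' t r ht none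
    rw [hφn, abs_div, Nat.abs_cast] at h1
    cases o with
    | none =>
      rw [div_le_iff₀ hN] at h1
      exact h1
    | some ρ =>
      have h2 := hp' t r ht (some ρ)
      rw [hφs] at h2
      have h3 : |(t none : ℝ) * (ρ : ZMod N).val / N| ≤ r * (ρ : ZMod N).val := by
        rw [mul_div_right_comm, abs_mul, abs_div, Nat.abs_cast, Nat.abs_cast]
        gcongr
      change |(t (some ρ) : ℝ)| ≤ r + r * (ρ : ZMod N).val
      have h4 := abs_sub ((t none : ℝ) * (ρ : ZMod N).val / N + t (some ρ))
        ((t none : ℝ) * (ρ : ZMod N).val / N)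
      rw [add_sub_cancel_left] at h4
      linarith
  obtain ⟨b, hb0, hspan, hb⟩ := hgen D hΓ (Option Γ → ℤ) p
    (by rw [Module.finrank_fintype_fun_eq_card, Fintype.card_option, Fintype.card_coe]) hfin
  have hbpos : ∀ i, 0 < p (b i) := fun i => lt_of_le_of_ne (apply_nonneg p _)
    fun h => hb0 i (p.eq_zero_of_finite_balls hfin h.symm)
  set m : Fin D → ℕ := fun i => ⌊(1 / (4 * D)) / p (b i)⌋₊ with hm
  have hcast : ∀ s : Fin D → ℤ, ∑ i, s i • ((b i none : ℤ) : ZMod N)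
      = (((∑ i, s i • b i) none : ℤ) : ZMod N) := fun s => by
    rw [Finset.sum_apply]
    push_cast
    refine Finset.sum_congr rfl fun i _ => ?_
    simp
  have hsmall : ∀ s ∈ intBox m, p (∑ i, s i • b i) ≤ 1 / 4 := fun s hs => by
    refine (p.map_sum_zsmul_le s b (c := 1 / (4 * D)) fun i => ?_).trans_eq ?_
    · have h1 : |(s i : ℝ)| ≤ m i := by exact_mod_cast mem_intBox.1 hs i
      have h2 : (m i : ℝ) ≤ (1 / (4 * D)) / p (b i) := Nat.floor_le (by have := hbpos i; positivity)
      rw [le_div_iff₀ (hbpos i)] at h2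
      exact (mul_le_mul_of_nonneg_right h1 (hbpos i).le).trans h2
    · rw [Fintype.card_fin]
      field_simp
  refine ⟨fun i => (b i none : ℤ), m, fun s hs r hr => ?_, fun s hs s' hs' hss => ?_, ?_⟩
  · rw [hcast]
    set t := ∑ i, s i • b i with ht
    have h1 := hp' t _ (hsmall s hs) (some ⟨r, hr⟩)
    rw [hφs] at h1
    have h2 : r * ((t none : ℤ) : ZMod N) = (((r.val : ℤ) * t none : ℤ) : ZMod N) := by simp
    rw [h2, re_stdAddChar_intCast]
    set u := (t none : ℝ) * r.val / N + t (some ⟨r, hr⟩) with hu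
    have h3 : 2 * Real.pi * (((r.val : ℤ) * t none : ℤ) / N : ℝ)
        = 2 * Real.pi * u - (t (some ⟨r, hr⟩) : ℤ) * (2 * Real.pi) := by
      rw [hu]; push_cast; ring
    rw [h3, Real.cos_sub_int_mul_two_pi]
    have hpi := Real.pi_pos
    obtain ⟨h4, h5⟩ := abs_le.1 h1
    exact Real.cos_nonneg_of_mem_Icc ⟨by nlinarith, by nlinarith⟩
  · simp only [hcast] at hss
    set t := ∑ i, (s i - s' i) • b i with ht
    have htt : t = ∑ i, s i • b i - ∑ i, s' i • b i := by
      rw [ht, ← Finset.sum_sub_distrib]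
      exact Finset.sum_congr rfl fun i _ => sub_smul _ _ _
    have hpt : p t ≤ 1 / 2 := by
      rw [htt]
      exact (map_sub_le_add p _ _).trans (by linarith [hsmall s hs, hsmall s' hs'])
    have ht0 : t none = 0 := by
      have h1 : (N : ℤ) ∣ t none := by
        rw [← ZMod.intCast_zmod_eq_zero_iff_dvd, htt, Pi.sub_apply, Int.cast_sub, hss, sub_self]
      apply Int.eq_zero_of_abs_lt_dvd h1
      have h2 := hp' t _ hpt none
      rw [hφn, abs_div, Nat.abs_cast, div_le_iff₀ hN] at h2
      have : |(t none : ℝ)| < N := by linarith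
      exact_mod_cast this
    have ht00 : t = 0 := by
      ext o
      cases o with
      | none => exact ht0
      | some r =>
        have h2 := hp' t _ hpt (some r)
        rw [hφs, ht0, Int.cast_zero, zero_mul, zero_div, zero_add] at h2
        have h3 : |(t (some r) : ℝ)| < 1 := by linarith
        exact Int.abs_lt_one_iff.1 (by exact_mod_cast h3)
    ext i
    have h1 := hb (fun i => s i - s' i) i
    rw [← ht, ht00, map_zero, mul_zero] at h1
    have h2 : |((s i - s' i : ℤ) : ℝ)| = 0 := by
      by_contra hne
      have := mul_pos (lt_of_le_of_ne (abs_nonneg _) (Ne.symm hne)) (hbpos i)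
      linarith
    rw [abs_eq_zero, Int.cast_eq_zero, sub_eq_zero] at h2
    exact h2
  · let W : ℕ → Option Γ → ℤ := fun j o => o.elim (j : ℤ)
      fun r => -⌊(j : ℝ) * (r : ZMod N).val / N⌋
    have hW : ∀ j < N, ∀ o, 0 ≤ φ (W j) o ∧ φ (W j) o < 1 := fun j hj o => by
      cases o with
      | none =>
        have : (j : ℝ) < N := by exact_mod_cast hj
        rw [hφn]
        change 0 ≤ (((j : ℤ) : ℝ)) / N ∧ ((j : ℤ) : ℝ) / N < 1
        rw [Int.cast_natCast, div_lt_one hN]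
        exact ⟨by positivity, this⟩
      | some r =>
        rw [hφs]
        have : (((W j none : ℤ) : ℝ)) * (r : ZMod N).val / N + (W j (some r) : ℤ)
            = Int.fract ((j : ℝ) * (r : ZMod N).val / N) := by
          change (((j : ℤ) : ℝ)) * (r : ZMod N).val / N
            + ((-⌊(j : ℝ) * (r : ZMod N).val / N⌋ : ℤ) : ℝ) = _
          push_cast
          rw [← sub_eq_add_neg, Int.self_sub_floor]
        rw [this]
        exact ⟨Int.fract_nonneg _, Int.fract_lt_one _⟩
    obtain ⟨c, -, hc⟩ := Finset.exists_le_card_fiber_of_nsmul_le_card_of_maps_to (M := ℝ)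
      (s := Finset.range N) (t := Fintype.piFinset fun _ : Option Γ => Finset.range q)
      (f := fun j o => ⌊q * φ (W j) o⌋₊) (b := N / q ^ D)
      (fun j hj => Fintype.mem_piFinset.2 fun o => by
        obtain ⟨h1, h2⟩ := hW j (Finset.mem_range.1 hj) o
        rw [Finset.mem_range, Nat.floor_lt (by positivity)]
        nlinarith)
      ⟨fun _ => 0, Fintype.mem_piFinset.2 fun _ => Finset.mem_range.2 (by exact_mod_cast hq0)⟩
      (by
        rw [Fintype.card_piFinset, Finset.prod_const, Finset.card_univ, Finset.card_range,
          Fintype.card_option, Fintype.card_coe,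
          Finset.card_range, nsmul_eq_mul, ← hD]
        apply le_of_eq
        push_cast
        field_simp)
    set T := (Finset.range N).filter fun j => (fun o => ⌊q * φ (W j) o⌋₊) = c
    have hTpos : 0 < T.card := by
      have : (0 : ℝ) < N / q ^ D := by positivity
      exact_mod_cast this.trans_le hc
    obtain ⟨j₀, hj₀⟩ := Finset.card_pos.1 hTpos
    have hTm : ∀ j ∈ T, p (W j - W j₀) ≤ 1 / q := fun j hj => by
      rw [hp _ _ (by positivity)]
      intro o
      obtain ⟨h1, h2⟩ := Finset.mem_filter.1 hj
      obtain ⟨h3, h4⟩ := Finset.mem_filter.1 hj₀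
      have h5 : ⌊q * φ (W j) o⌋₊ = ⌊q * φ (W j₀) o⌋₊ := congrFun (h2.trans h4.symm) o
      obtain ⟨ha, -⟩ := hW j (Finset.mem_range.1 h1) o
      obtain ⟨hb, -⟩ := hW j₀ (Finset.mem_range.1 h3) o
      have h6 := Nat.floor_le (show 0 ≤ q * φ (W j) o by positivity)
      have h7 := Nat.floor_le (show 0 ≤ q * φ (W j₀) o by positivity)
      have h8 := Nat.lt_floor_add_one (q * φ (W j) o)
      have h9 := Nat.lt_floor_add_one (q * φ (W j₀) o)
      rw [h5] at h6 h8
      rw [map_sub, Pi.sub_apply, le_div_iff₀ hq0, ← abs_of_pos hq0, ← abs_mul, abs_le]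
      constructor <;> linarith
    choose s hs using fun j => hspan (W j - W j₀)
    have hcardT : T.card ≤ (intBox m).card := by
      refine Finset.card_le_card_of_injOn s (fun j hj => ?_) fun j hj j' hj' hjj => ?_
      · rw [Finset.mem_coe, mem_intBox]
        intro i
        rw [← Int.natCast_natAbs, Nat.cast_le, hm]
        apply Nat.le_floor
        rw [le_div_iff₀ (hbpos i), Nat.cast_natAbs, Int.cast_abs]
        have h1 := hb (s j) i
        rw [← hs j] at h1
        refine h1.trans ((mul_le_mul_of_nonneg_left (hTm j hj) (by linarith)).trans ?_)
        rw [mul_one_div, div_le_div_iff₀ hq0 (by positivity)]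
        linarith
      · have h1 : W j - W j₀ = W j' - W j₀ := by rw [hs j, hs j', hjj]
        have h2 := congrFun (sub_left_injective h1) none
        exact Int.ofNat_inj.1 h2
    have h1 : (N : ℝ) ≤ q ^ D₀ * (intBox m).card := by
      rw [div_le_iff₀ (by positivity), mul_comm] at hc
      refine hc.trans ?_
      gcongr
    exact_mod_cast h1

/-- A function on a box which is additive where this makes sense is linear. -/
theorem exists_eq_sum_smul_of_additive_on_intBox {ι E : Type*} [Fintype ι] [DecidableEq ι]
    [AddCommGroup E] {m : ι → ℕ} {ψ : (ι → ℤ) → E}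
    (h : ∀ s ∈ intBox m, ∀ s' ∈ intBox m, s + s' ∈ intBox m → ψ (s + s') = ψ s + ψ s') :
    ∃ a : ι → E, ∀ s ∈ intBox m, ψ s = ∑ i, s i • a i := by
  refine ⟨fun i => ψ (Pi.single i 1), fun s hs => ?_⟩
  induction hn : ∑ i, (s i).natAbs using Nat.strong_induction_on generalizing s with
  | _ n ih =>
    by_cases hs0 : s = 0
    · subst hs0
      have := h 0 hs 0 hs (by simpa using hs)
      simpa using this
    obtain ⟨i, hi⟩ := Function.ne_iff.1 hs0
    rw [Pi.zero_apply] at hi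
    have hsi := mem_intBox.1 hs i
    have hm : (1 : ℤ) ≤ m i := by have := Int.one_le_abs hi; omega
    have he : Pi.single i (1 : ℤ) ∈ intBox m := mem_intBox.2 fun j => by
      by_cases hj : j = i
      · subst hj; simpa using hm
      · simp [hj]
    have key : ∀ (σ : ℤ) (s' : ι → ℤ), s' = s + Pi.single i σ → (s i + σ).natAbs < (s i).natAbs →
        ψ s' = ∑ j, s' j • ψ (Pi.single j 1) ∧ s' ∈ intBox m := by
      rintro σ s' rfl hlt
      have hbox : s + Pi.single i σ ∈ intBox m := mem_intBox.2 fun j => by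
        by_cases hj : j = i
        · subst hj; simp only [Pi.add_apply, Pi.single_eq_same]; rw [Int.abs_eq_natAbs] at hsi ⊢; omega
        · simpa [hj] using mem_intBox.1 hs j
      refine ⟨ih _ ?_ _ hbox rfl, hbox⟩
      rw [← hn]
      refine Finset.sum_lt_sum (fun j _ => ?_) ⟨i, Finset.mem_univ i, by simpa using hlt⟩
      by_cases hj : j = i
      · subst hj; simpa using hlt.le
      · simp [hj]
    have hsingle : ∀ σ : ℤ, ∑ j, (Pi.single i σ : ι → ℤ) j • ψ (Pi.single j 1)
        = σ • ψ (Pi.single i 1) := fun σ => by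
      rw [Finset.sum_eq_single i (fun j _ hj => by simp [hj]) (by simp), Pi.single_eq_same]
    rcases lt_or_gt_of_ne hi with hneg | hpos
    · obtain ⟨h1, h2⟩ := key 1 _ rfl (by omega)
      rw [h s hs _ he h2] at h1
      rw [← add_right_cancel_iff (a := ψ (Pi.single i 1)), h1]
      simp only [Pi.add_apply, add_smul, Finset.sum_add_distrib, hsingle, one_smul]
    · obtain ⟨h1, h2⟩ := key (-1) _ rfl (by omega)
      have h3 : s = (s + Pi.single i (-1)) + Pi.single i 1 := by
        rw [add_assoc, ← Pi.single_add]; simp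
      have h4 := h _ h2 _ he (by rwa [← h3])
      rw [← h3, h1] at h4
      rw [h4]
      simp only [Pi.add_apply, add_smul, Finset.sum_add_distrib, hsingle]
      simp

theorem card_nsmul_sub_nsmul_le {E : Type*} [AddCommGroup E] [DecidableEq E] {G : Finset E}
    (hG : G.Nonempty) {K : ℕ} (hK : (G + G).card ≤ K * G.card) (m n : ℕ) :
    (m • G - n • G).card ≤ K ^ (m + n) * G.card := by
  have h := Finset.pluennecke_ruzsa_inequality_nsmul_sub_nsmul_add hG G m n
  have hpos : (0 : ℚ≥0) < G.card := by exact_mod_cast hG.card_pos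
  have h2 : ((G + G).card : ℚ≥0) / G.card ≤ K := by
    rw [div_le_iff₀ hpos]; exact_mod_cast hK
  have h3 : ((m • G - n • G).card : ℚ≥0) ≤ K ^ (m + n) * G.card := by
    refine h.trans ?_
    gcongr
  exact_mod_cast h3

theorem exists_reindex_gap {ι E : Type*} [Fintype ι] [DecidableEq ι] [AddCommGroup E]
    (a : ι → E) (m : ι → ℕ) :
    ∃ (b : Fin (Fintype.card ι) → E) (n : Fin (Fintype.card ι) → ℕ),
      ((∀ i, 1 ≤ m i) → ∀ i, 1 ≤ n i) ∧
      (∀ t ∈ intBox m, ∃ t' ∈ intBox n, ∑ i, t i • a i = ∑ i, t' i • b i) ∧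
      (intBox n).card = (intBox m).card := by
  let e := Fintype.equivFin ι
  refine ⟨a ∘ e.symm, m ∘ e.symm, fun h i => h _, fun t ht => ⟨t ∘ e.symm, ?_, ?_⟩, ?_⟩
  · exact mem_intBox.2 fun i => mem_intBox.1 ht _
  · exact (Equiv.sum_comp e.symm fun i => t i • a i).symm
  · rw [card_intBox, card_intBox]
    exact Equiv.prod_comp e.symm fun i => 2 * m i + 1

theorem sum_mem_nsmul_finset {E : Type*} [AddCommGroup E] [DecidableEq E] {G : Finset E} :
    ∀ {n : ℕ} (g : Fin n → E), (∀ i, g i ∈ G) → ∑ i, g i ∈ n • G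
  | 0, g, _ => by simp
  | n + 1, g, hg => by
    rw [Fin.sum_univ_castSucc, succ_nsmul]
    exact Finset.add_mem_add (sum_mem_nsmul_finset _ fun i => hg _) (hg _)

theorem six_sum_iff {E M : Type*} [AddCommGroup E] [AddCommGroup M] {G : Finset E} {π : E → M}
    (h : ∀ g g' : Fin 6 → E, (∀ i, g i ∈ G) → (∀ i, g' i ∈ G) →
      (∑ i, π (g i) = ∑ i, π (g' i) ↔ ∑ i, g i = ∑ i, g' i))
    {a b c d e f a' b' c' d' e' f' : E} (ha : a ∈ G) (hb : b ∈ G) (hc : c ∈ G) (hd : d ∈ G)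
    (he : e ∈ G) (hf : f ∈ G) (ha' : a' ∈ G) (hb' : b' ∈ G) (hc' : c' ∈ G) (hd' : d' ∈ G)
    (he' : e' ∈ G) (hf' : f' ∈ G) :
    π a + π b + π c + π d + π e + π f = π a' + π b' + π c' + π d' + π e' + π f' ↔
      a + b + c + d + e + f = a' + b' + c' + d' + e' + f' := by
  have := h ![a, b, c, d, e, f] ![a', b', c', d', e', f'] (fun i => by fin_cases i <;> assumption)
    (fun i => by fin_cases i <;> assumption)
  rw [Fin.sum_univ_six, Fin.sum_univ_six, Fin.sum_univ_six, Fin.sum_univ_six] at this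
  exact this

/-- A set of small doubling contains a large proper progression in `G + G - G - G`. -/
theorem exists_gap_subset_two_sub_two (k K : ℕ) : ∃ D₀ Q : ℕ, ∀ G : Finset (Fin k → ℤ),
    G.Nonempty → (G + G).card ≤ K * G.card →
      ∃ D ≤ D₀, ∃ (a : Fin D → Fin k → ℤ) (m : Fin D → ℕ),
        (∀ s ∈ intBox m, ∑ i, s i • a i ∈ 2 • G - 2 • G) ∧
        Set.InjOn (fun s : Fin D → ℤ => ∑ i, s i • a i) (intBox m) ∧
        G.card ≤ Q * (intBox m).card := by
  classical
  set D₀ := (6 * K ^ 12) ^ 2 + 1 with hD₀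
  obtain ⟨Q, hQ⟩ := exists_gap_in_bohr D₀
  refine ⟨D₀, 6 * Q, fun G hG hK => ?_⟩
  set S := 6 • G - 6 • G with hS
  have hScard : S.card ≤ K ^ 12 * G.card := card_nsmul_sub_nsmul_le hG hK 6 6
  have hSpos : 0 < S.card := Finset.card_pos.2 ((hG.nsmul).sub hG.nsmul)
  obtain ⟨N, hN⟩ : ∃ N, N = S.card := ⟨_, rfl⟩
  have : NeZero N := ⟨hN ▸ hSpos.ne'⟩
  obtain ⟨G', hG'G, hG', π, hπ₀⟩ := exists_freiman_model G S hG
    (fun g g' hg hg' => Finset.sub_mem_sub (sum_mem_nsmul_finset g hg) (sum_mem_nsmul_finset g' hg'))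
    hN.ge
  have hG'ne : G'.Nonempty := Finset.card_pos.1 (by have := hG.card_pos; omega)
  have hinj : Set.InjOn π G' := fun x hx y hy hxy => by
    have := (six_sum_iff hπ₀ hx hx hx hx hx hx hy hx hx hx hx hx).1 (by rw [hxy])
    linear_combination this
  have hHcard : (G'.image π).card = G'.card := Finset.card_image_of_injOn hinj
  have hHN : G'.card ≤ N := by
    rw [← hHcard]
    exact (Finset.card_le_univ _).trans_eq (ZMod.card N)
  obtain ⟨Γ, hΓ, hbog⟩ := exists_bohr_subset_two_sub_two (G'.image π) (hG'ne.image π)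
  rw [hHcard] at hΓ
  have hΓcard : Γ.card + 1 ≤ D₀ := by
    have h1 : N ≤ 6 * K ^ 12 * G'.card := by
      calc N ≤ K ^ 12 * G.card := hN.trans_le hScard
        _ ≤ K ^ 12 * (6 * G'.card) := Nat.mul_le_mul_left _ hG'
        _ = _ := by ring
    have h2 : Γ.card * G'.card ^ 2 ≤ (6 * K ^ 12) ^ 2 * G'.card ^ 2 := by
      rw [← mul_pow]
      exact hΓ.trans (Nat.pow_le_pow_left h1 2)
    have h3 := Nat.le_of_mul_le_mul_right h2 (by have := hG'ne.card_pos; positivity)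
    omega
  obtain ⟨x, m, hbohr, hxinj, hsize⟩ := hQ N Γ hΓcard
  have hrep : ∀ s ∈ intBox m, ∃ g : Fin 4 → Fin k → ℤ, (∀ i, g i ∈ G') ∧
      ∑ i, s i • x i = π (g 0) + π (g 1) - π (g 2) - π (g 3) := fun s hs => by
    obtain ⟨h₁, hh₁, h₂, hh₂, h₃, hh₃, h₄, hh₄, h⟩ := hbog _ (hbohr s hs)
    obtain ⟨g₁, hg₁, rfl⟩ := Finset.mem_image.1 hh₁
    obtain ⟨g₂, hg₂, rfl⟩ := Finset.mem_image.1 hh₂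
    obtain ⟨g₃, hg₃, rfl⟩ := Finset.mem_image.1 hh₃
    obtain ⟨g₄, hg₄, rfl⟩ := Finset.mem_image.1 hh₄
    refine ⟨![g₁, g₂, g₃, g₄], fun i => ?_, h⟩
    fin_cases i <;> assumption
  choose! g hg hgx using hrep
  have hadd : ∀ s ∈ intBox m, ∀ s' ∈ intBox m, s + s' ∈ intBox m →
      (fun s => g s 0 + g s 1 - g s 2 - g s 3) (s + s')
        = (fun s => g s 0 + g s 1 - g s 2 - g s 3) s
          + (fun s => g s 0 + g s 1 - g s 2 - g s 3) s' := fun s hs s' hs' hss => by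
    have h1 : ∑ i, (s + s') i • x i = ∑ i, s i • x i + ∑ i, s' i • x i := by
      simp [add_mul, Finset.sum_add_distrib]
    rw [hgx s hs, hgx s' hs', hgx _ hss] at h1
    have h2 := (six_sum_iff hπ₀ (hg _ hss 0) (hg _ hss 1) (hg _ hs 2) (hg _ hs 3) (hg _ hs' 2)
      (hg _ hs' 3) (hg _ hss 2) (hg _ hss 3) (hg _ hs 0) (hg _ hs 1) (hg _ hs' 0) (hg _ hs' 1)).1
      (by linear_combination h1)
    simp only
    linear_combination h2
  obtain ⟨a, ha⟩ := exists_eq_sum_smul_of_additive_on_intBox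
    (ψ := fun s => g s 0 + g s 1 - g s 2 - g s 3) hadd
  refine ⟨_, hΓcard, a, m, fun s hs => ?_, fun s hs s' hs' hss => ?_, ?_⟩
  · rw [← ha s hs, sub_sub, two_nsmul]
    exact Finset.sub_mem_sub (Finset.add_mem_add (hG'G (hg s hs 0)) (hG'G (hg s hs 1)))
      (Finset.add_mem_add (hG'G (hg s hs 2)) (hG'G (hg s hs 3)))
  · simp only at hss
    rw [← ha s hs, ← ha s' hs'] at hss
    apply hxinj hs hs'
    change ∑ i, s i • x i = ∑ i, s' i • x i
    rw [hgx s hs, hgx s' hs']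
    have h2 := (six_sum_iff hπ₀ (hg _ hs 0) (hg _ hs 1) (hg _ hs' 2) (hg _ hs' 3) (hg _ hs 0)
      (hg _ hs 0) (hg _ hs' 0) (hg _ hs' 1) (hg _ hs 2) (hg _ hs 3) (hg _ hs 0) (hg _ hs 0)).2
      (by linear_combination hss)
    linear_combination h2
  · calc G.card ≤ 6 * G'.card := hG'
      _ ≤ 6 * (Q * (intBox m).card) := Nat.mul_le_mul_left _ (hHN.trans hsize)
      _ = _ := by ring

/-- Freiman's theorem in `ℤ^k`. -/
theorem exists_gap_superset (k K : ℕ) : ∃ D₀ C : ℕ, ∀ G : Finset (Fin k → ℤ),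
    G.Nonempty → (G + G).card ≤ K * G.card →
      ∃ D ≤ D₀, ∃ (a : Fin D → Fin k → ℤ) (m : Fin D → ℕ), (∀ i, 1 ≤ m i) ∧
        (∀ g ∈ G, ∃ t ∈ intBox m, g = ∑ i, t i • a i) ∧ (intBox m).card ≤ C * G.card := by
  classical
  obtain ⟨D₁, Q, h⟩ := exists_gap_subset_two_sub_two k K
  refine ⟨D₁ + K ^ 5 * Q, 3 ^ D₁ * 3 ^ (K ^ 5 * Q) * K ^ 4, fun G hG hK => ?_⟩
  obtain ⟨D, hD, a, m, hsub, hinj, hcard⟩ := h G hG hK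
  set ψ : (Fin D → ℤ) → Fin k → ℤ := fun s => ∑ i, s i • a i with hψ
  set P := (intBox m).image ψ with hP
  have hPcard : P.card = (intBox m).card := Finset.card_image_of_injOn hinj
  have hPsub : P ⊆ 2 • G - 2 • G := Finset.image_subset_iff.2 hsub
  have hPne : P.Nonempty := ⟨ψ 0, Finset.mem_image_of_mem _ (mem_intBox.2 (by simp))⟩
  have hP4 : P.card ≤ K ^ 4 * G.card :=
    (Finset.card_le_card hPsub).trans (card_nsmul_sub_nsmul_le hG hK 2 2)
  have hGP : (G + P).card ≤ K ^ 5 * Q * P.card := by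
    have h1 : G + P ⊆ 3 • G - 2 • G := by
      have : 3 • G - 2 • G = G + (2 • G - 2 • G) := by
        rw [← add_sub_assoc, ← succ_nsmul']
      rw [this]
      exact Finset.add_subset_add_left hPsub
    have h2 := (Finset.card_le_card h1).trans (card_nsmul_sub_nsmul_le hG hK 3 2)
    rw [hPcard]
    calc _ ≤ _ := h2
      _ ≤ K ^ 5 * (Q * (intBox m).card) := Nat.mul_le_mul_left _ hcard
      _ = _ := by ring
  obtain ⟨F, -, hF, hGF⟩ := Finset.ruzsa_covering_add (K := (K ^ 5 * Q : ℕ)) hPne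
    (by exact_mod_cast hGP)
  replace hF : F.card ≤ K ^ 5 * Q := by exact_mod_cast hF
  let a' : Fin D ⊕ F → Fin k → ℤ := Sum.elim a fun f => f
  let m' : Fin D ⊕ F → ℕ := Sum.elim (fun i => 2 * m i + 1) fun _ => 1
  obtain ⟨b, n, hn1, hn2, hn3⟩ := exists_reindex_gap a' m'
  refine ⟨Fintype.card (Fin D ⊕ F), ?_, b, n, hn1 ?_, fun g hg => ?_, ?_⟩
  · simp only [Fintype.card_sum, Fintype.card_fin, Fintype.card_coe]
    omega
  · rintro (i | f)
    · exact Nat.le_add_left _ _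
    · exact le_refl _
  · obtain ⟨f, hf, w, hw, rfl⟩ := Finset.mem_add.1 (hGF hg)
    obtain ⟨u, hu, u', hu', rfl⟩ := Finset.mem_sub.1 hw
    obtain ⟨s, hs, rfl⟩ := Finset.mem_image.1 hu
    obtain ⟨s', hs', rfl⟩ := Finset.mem_image.1 hu'
    obtain ⟨t, ht, he⟩ := hn2 (Sum.elim (s - s') (Pi.single ⟨f, hf⟩ 1)) (mem_intBox.2 (by
      rintro (i | x)
      · have h1 := mem_intBox.1 hs i
        have h2 := mem_intBox.1 hs' i
        have h3 := abs_sub (s i) (s' i)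
        simp only [Sum.elim_inl, Pi.sub_apply, m']
        push_cast
        linarith
      · by_cases hx : x = ⟨f, hf⟩
        · subst hx; simp [m']
        · simp [m', hx]))
    refine ⟨t, ht, ?_⟩
    rw [← he, Fintype.sum_sum_type]
    simp only [Sum.elim_inl, Sum.elim_inr, a', Pi.sub_apply, sub_smul, Finset.sum_sub_distrib]
    rw [Finset.sum_eq_single (⟨f, hf⟩ : F) (fun x _ hx => by simp [hx]) (by simp)]
    simp only [Pi.single_eq_same, one_smul, hψ]
    abel
  · rw [hn3, card_intBox, Fintype.prod_sum_type]
    simp only [m', Sum.elim_inl, Sum.elim_inr, Finset.prod_const, Finset.card_univ,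
      Fintype.card_coe]
    have h1 : ∏ i, (2 * (2 * m i + 1) + 1) ≤ 3 ^ D * (intBox m).card := by
      have : ∏ _i : Fin D, 3 = 3 ^ D := by simp
      rw [card_intBox, ← this, ← Finset.prod_mul_distrib]
      exact Finset.prod_le_prod' fun i _ => by omega
    calc _ ≤ 3 ^ D * (intBox m).card * (2 * 1 + 1) ^ F.card := Nat.mul_le_mul_right _ h1
      _ ≤ 3 ^ D₁ * (K ^ 4 * G.card) * 3 ^ (K ^ 5 * Q) := by
        rw [← hPcard]
        gcongr <;> norm_num
      _ = _ := by ring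

/-- The half-open cube of side `δ` of the grid `δ ℤ^k` with lowest corner `δ g`. -/
def gridCube {k : ℕ} (δ : ℝ) (g : Fin k → ℤ) : Set (Fin k → ℝ) :=
  Set.univ.pi fun i => Set.Ico (δ * g i) (δ * g i + δ)

theorem mem_gridCube {k : ℕ} {δ : ℝ} (hδ : 0 < δ) {g : Fin k → ℤ} {x : Fin k → ℝ} :
    x ∈ gridCube δ g ↔ ∀ i, ⌊x i / δ⌋ = g i := by
  simp only [gridCube, Set.mem_pi, Set.mem_univ, true_implies, Set.mem_Ico]
  refine forall_congr' fun i => ?_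
  rw [Int.floor_eq_iff, le_div_iff₀ hδ, div_lt_iff₀ hδ]
  constructor <;> rintro ⟨h1, h2⟩ <;> constructor <;> linarith

theorem volume_gridCube {k : ℕ} {δ : ℝ} (g : Fin k → ℤ) :
    volume (gridCube δ g) = ENNReal.ofReal δ ^ k := by
  rw [gridCube, Real.volume_pi_Ico]
  simp

/-- A compact set of positive measure is approximated by a finite subset of a fine grid, with
control on the size of the sumset. -/
theorem exists_grid_approx {k : ℕ} {A : Set (Fin k → ℝ)} (hA : IsCompact A) (hpos : 0 < volume A) :
    ∃ δ : ℝ, 0 < δ ∧ ∃ G : Finset (Fin k → ℤ),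
      (∀ x ∈ A, ∃ g ∈ G, ‖x - δ • fun i => (g i : ℝ)‖ ≤ δ) ∧
      volume A ≤ G.card * ENNReal.ofReal δ ^ k ∧
      ((G + G).card : ℝ≥0∞) * ENNReal.ofReal δ ^ k ≤ 2 * volume (A + A) := by
  classical
  have hne : A.Nonempty := nonempty_of_measure_ne_zero hpos.ne'
  have hAA : IsCompact (A + A) := hA.add hA
  have hAApos : 0 < volume (A + A) := by
    obtain ⟨a, ha⟩ := hne
    refine hpos.trans_le ?_
    rw [← measure_vadd volume a A]
    refine measure_mono ?_
    rintro _ ⟨x, hx, rfl⟩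
    exact Set.add_mem_add ha hx
  have hlt : volume (A + A) < 2 * volume (A + A) := by
    rw [two_mul]
    exact ENNReal.lt_add_right hAA.measure_lt_top.ne hAApos.ne'
  have hev := (tendsto_measure_cthickening_of_isCompact (μ := volume) hAA).eventually
    (gt_mem_nhds hlt)
  obtain ⟨r, hr, hball⟩ := Metric.eventually_nhds_iff.1 hev
  set δ := r / 4 with hδr
  have hδ : 0 < δ := by positivity
  have hthick : volume (Metric.cthickening (2 * δ) (A + A)) < 2 * volume (A + A) := by
    apply hball
    rw [Real.dist_eq, sub_zero, abs_of_pos (by positivity)]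
    linarith
  let φ : (Fin k → ℝ) → Fin k → ℤ := fun x i => ⌊x i / δ⌋
  have hφmem : ∀ x, x ∈ gridCube δ (φ x) := fun x => (mem_gridCube hδ).2 fun i => rfl
  have hfin : (φ '' A).Finite := by
    obtain ⟨R, hR⟩ := hA.isBounded.exists_norm_le
    refine (finite_setOf_forall_abs_le fun _ => R / δ + 1).subset ?_
    rintro _ ⟨x, hx, rfl⟩ i
    have h1 : |x i| ≤ R := (norm_le_pi_norm x i).trans (hR x hx)
    have h2 : |x i / δ| ≤ R / δ := by
      rw [abs_div, abs_of_pos hδ]; gcongr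
    have h3 := Int.floor_le (x i / δ)
    have h4 := Int.lt_floor_add_one (x i / δ)
    rw [abs_le] at h2 ⊢
    constructor <;> simp only [φ] <;> linarith [h2.1, h2.2]
  refine ⟨δ, hδ, hfin.toFinset, fun x hx => ⟨φ x, by simpa using ⟨x, hx, rfl⟩, ?_⟩, ?_, ?_⟩
  · rw [pi_norm_le_iff_of_nonneg hδ.le]
    intro i
    have := hφmem x i (Set.mem_univ i)
    simp only [Set.mem_Ico] at this
    rw [Real.norm_eq_abs, abs_le]
    simp only [Pi.sub_apply, Pi.smul_apply, smul_eq_mul]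
    constructor <;> linarith [this.1, this.2]
  · calc volume A ≤ volume (⋃ g ∈ hfin.toFinset, gridCube δ g) := by
          refine measure_mono fun x hx => ?_
          exact Set.mem_biUnion (by simpa using ⟨x, hx, rfl⟩ : φ x ∈ hfin.toFinset) (hφmem x)
      _ ≤ ∑ g ∈ hfin.toFinset, volume (gridCube δ g) := measure_biUnion_finset_le _ _
      _ = _ := by simp [volume_gridCube]
  · set G := hfin.toFinset with hG
    calc ((G + G).card : ℝ≥0∞) * ENNReal.ofReal δ ^ k
        = ∑ g ∈ G + G, volume (gridCube δ g) := by simp [volume_gridCube]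
      _ = volume (⋃ g ∈ G + G, gridCube δ g) := by
          refine (measure_biUnion_finset ?_ ?_).symm
          · intro g _ g' _ hgg
            refine Set.disjoint_left.2 fun x hx hx' => hgg ?_
            rw [mem_gridCube hδ] at hx hx'
            funext i
            rw [← hx i, hx' i]
          · intro g _
            exact MeasurableSet.univ_pi fun i => measurableSet_Ico
      _ ≤ volume (Metric.cthickening (2 * δ) (A + A)) := by
          refine measure_mono ?_
          refine Set.iUnion₂_subset fun g hg y hy => ?_
          obtain ⟨g₁, hg₁, g₂, hg₂, rfl⟩ := Finset.mem_add.1 hg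
          obtain ⟨x₁, hx₁, rfl⟩ : ∃ x ∈ A, φ x = g₁ := by simpa [hG] using hg₁
          obtain ⟨x₂, hx₂, rfl⟩ : ∃ x ∈ A, φ x = g₂ := by simpa [hG] using hg₂
          refine Metric.mem_cthickening_of_dist_le y (x₁ + x₂) _ _ (Set.add_mem_add hx₁ hx₂) ?_
          rw [dist_pi_le_iff (by positivity)]
          intro i
          have h1 := hφmem x₁ i (Set.mem_univ i)
          have h2 := hφmem x₂ i (Set.mem_univ i)
          have h3 := hy i (Set.mem_univ i)
          simp only [Set.mem_Ico, Pi.add_apply, Int.cast_add, mul_add] at h1 h2 h3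
          rw [Real.dist_eq, abs_le]
          simp only [Pi.add_apply]
          constructor <;> linarith [h1.1, h1.2, h2.1, h2.2, h3.1, h3.2]
      _ ≤ _ := hthick.le

/-- Ruzsa's covering lemma for Lebesgue measure. -/
theorem exists_finset_covering {k : ℕ} {A B : Set (Fin k → ℝ)} (hB : MeasurableSet B)
    (hpos : 0 < volume B) (hfin : volume B < ⊤) {K : ℕ} (h : volume (A + B) ≤ K * volume B) :
    ∃ Y : Finset (Fin k → ℝ), Y.card ≤ K ∧ ∀ x ∈ A, ∃ y ∈ Y, ∃ u ∈ B, ∃ u' ∈ B, x = y + u - u' := by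
  classical
  let p : Finset (Fin k → ℝ) → Prop := fun Y => (Y : Set (Fin k → ℝ)) ⊆ A ∧
    (Y : Set (Fin k → ℝ)).PairwiseDisjoint fun y => y +ᵥ B
  have hp : ∀ Y, p Y → Y.card ≤ K := fun Y hY => by
    have h1 : (Y.card : ℝ≥0∞) * volume B ≤ K * volume B := by
      calc (Y.card : ℝ≥0∞) * volume B = ∑ y ∈ Y, volume (y +ᵥ B) := by simp [measure_vadd]
        _ = volume (⋃ y ∈ Y, y +ᵥ B) :=
          (measure_biUnion_finset hY.2 fun y _ => hB.const_vadd y).symm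
        _ ≤ volume (A + B) := measure_mono (Set.iUnion₂_subset fun y hy => by
          rintro _ ⟨x, hx, rfl⟩
          exact Set.add_mem_add (hY.1 hy) hx)
        _ ≤ _ := h
    have h2 := (ENNReal.mul_le_mul_iff_left hpos.ne' hfin.ne).1 h1
    exact_mod_cast h2
  obtain ⟨Y, hY, hmax⟩ : ∃ Y, p Y ∧ ∀ Y', p Y' → Y'.card ≤ Y.card := by
    have hne : (Finset.card '' {Y | p Y}).Nonempty := ⟨_, ∅, by simp [p], rfl⟩
    have hbdd : BddAbove (Finset.card '' {Y | p Y}) := ⟨K, by rintro _ ⟨Y, hY, rfl⟩; exact hp Y hY⟩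
    obtain ⟨Y, hY, hYs⟩ := Nat.sSup_mem hne hbdd
    exact ⟨Y, hY, fun Y' hY' => hYs ▸ le_csSup hbdd ⟨Y', hY', rfl⟩⟩
  refine ⟨Y, hp Y hY, fun x hx => ?_⟩
  by_contra! hcon
  obtain ⟨b, hb⟩ : B.Nonempty := nonempty_of_measure_ne_zero hpos.ne'
  have hxY : x ∉ Y := fun hxY => hcon x hxY b hb b hb (by abel)
  have := hmax (insert x Y) ⟨by
    rw [Finset.coe_insert]; exact Set.insert_subset hx hY.1, by
    rw [Finset.coe_insert]
    refine hY.2.insert fun y hy _ => ?_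
    rw [Set.disjoint_left]
    rintro _ ⟨u', hu', rfl⟩ ⟨u, hu, hxu⟩
    refine hcon y hy u hu u' hu' ?_
    simp only [vadd_eq_add] at hxu
    rw [hxu]; abel⟩
  rw [Finset.card_insert_of_notMem hxY] at this
  omega

/-- Freiman's theorem in `ℝ^k`: a set of small doubling is covered by the sum of a progression of
bounded rank and a ball, of comparable volume. -/
theorem exists_gap_add_ball_superset (k K : ℕ) : ∃ D₀ C : ℕ, ∀ A : Set (Fin k → ℝ),
    MeasurableSet A → 0 < volume A → volume A < ⊤ → volume (A + A) ≤ K * volume A →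
      ∃ D ≤ D₀, ∃ (a : Fin D → Fin k → ℝ) (m : Fin D → ℕ), (∀ i, 1 ≤ m i) ∧ ∃ δ : ℝ, 0 < δ ∧
        (∀ x ∈ A, ∃ t ∈ intBox m, ‖x - ∑ i, (t i : ℝ) • a i‖ ≤ δ) ∧
        ((intBox m).card : ℝ≥0∞) * ENNReal.ofReal δ ^ k ≤ C * volume A := by
  classical
  obtain ⟨D₁, C₁, hgap⟩ := exists_gap_superset k (4 * K)
  refine ⟨D₁ + 2 * K, 2 ^ D₁ * 3 ^ (2 * K) * 2 ^ k * C₁ * (2 * K), fun A hA hpos hfin hK => ?_⟩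
  obtain ⟨A₀, hA₀A, hA₀, hA₀vol⟩ := hA.exists_isCompact_lt_add hfin.ne
    (ENNReal.half_pos hpos.ne').ne'
  replace hA₀vol : volume A ≤ 2 * volume A₀ := by
    have h1 : volume A / 2 + volume A / 2 ≤ volume A₀ + volume A / 2 := by
      rw [ENNReal.add_halves]; exact hA₀vol.le
    have h2 := (ENNReal.add_le_add_iff_right
      (ENNReal.div_lt_top hfin.ne two_ne_zero).ne).1 h1
    calc volume A = 2 * (volume A / 2) := (ENNReal.mul_div_cancel two_ne_zero ofNat_ne_top).symm
      _ ≤ _ := by gcongr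
  have hA₀pos : 0 < volume A₀ := by
    by_contra! h0
    simp [nonpos_iff_eq_zero.1 h0] at hA₀vol
    exact hpos.ne' hA₀vol
  obtain ⟨δ, hδ, G, hGA, hGvol, hGG⟩ := exists_grid_approx hA₀ hA₀pos
  have hδk0 : ENNReal.ofReal δ ^ k ≠ 0 := pow_ne_zero _ (by simpa using hδ)
  have hδkt : ENNReal.ofReal δ ^ k ≠ ⊤ := ENNReal.pow_ne_top ENNReal.ofReal_ne_top
  have hGne : G.Nonempty := by
    rw [Finset.nonempty_iff_ne_empty]
    rintro rfl
    simp at hGvol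
    exact hA₀pos.ne' hGvol
  have hGG2 : ((G + G).card : ℝ≥0∞) * ENNReal.ofReal δ ^ k ≤ 2 * K * volume A := by
    calc _ ≤ _ := hGG
      _ ≤ 2 * (K * volume A) := by
        gcongr
        exact (measure_mono (Set.add_subset_add hA₀A hA₀A)).trans hK
      _ = _ := by ring
  have hGG4 : (G + G).card ≤ 4 * K * G.card := by
    have h1 : ((G + G).card : ℝ≥0∞) * ENNReal.ofReal δ ^ k
        ≤ (4 * K * G.card : ℕ) * ENNReal.ofReal δ ^ k := by
      calc _ ≤ _ := hGG2
        _ ≤ 2 * K * (2 * (G.card * ENNReal.ofReal δ ^ k)) := by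
          gcongr
          exact hA₀vol.trans (by gcongr)
        _ = _ := by push_cast; ring
    have h2 := (ENNReal.mul_le_mul_iff_left hδk0 hδkt).1 h1
    exact_mod_cast h2
  have hGcard : (G.card : ℝ≥0∞) * ENNReal.ofReal δ ^ k ≤ 2 * K * volume A :=
    le_trans (mul_le_mul_left
      (Nat.cast_le.2 (Finset.card_le_card_add_right hGne)) _) hGG2
  obtain ⟨D, hD, a, m, hm, hGm, hmcard⟩ := hgap G hGne hGG4
  obtain ⟨Y, hYcard, hY⟩ := exists_finset_covering (A := A) (K := 2 * K) hA₀.measurableSet hA₀pos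
    hA₀.measure_lt_top (by
      calc volume (A + A₀) ≤ volume (A + A) := measure_mono (Set.add_subset_add_left hA₀A)
        _ ≤ _ := hK
        _ ≤ K * (2 * volume A₀) := by gcongr
        _ = _ := by push_cast; ring)
  let a' : Fin D ⊕ Y → Fin k → ℝ := Sum.elim (fun i => δ • fun j => (a i j : ℝ)) fun y => y
  let m' : Fin D ⊕ Y → ℕ := Sum.elim (fun i => 2 * m i) fun _ => 1
  obtain ⟨b, n, hn1, hn2, hn3⟩ := exists_reindex_gap a' m'
  refine ⟨Fintype.card (Fin D ⊕ Y), ?_, b, n, hn1 ?_, 2 * δ, by positivity, fun x hx => ?_, ?_⟩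
  · simp only [Fintype.card_sum, Fintype.card_fin, Fintype.card_coe]
    omega
  · rintro (i | f)
    · have := hm i
      simp only [m', Sum.elim_inl]
      omega
    · exact le_refl _
  · have happrox : ∀ u ∈ A₀, ∃ t ∈ intBox m, ‖u - ∑ i, t i • (δ • fun j => (a i j : ℝ))‖ ≤ δ :=
      fun u hu => by
        obtain ⟨g, hg, hug⟩ := hGA u hu
        obtain ⟨t, ht, rfl⟩ := hGm g hg
        refine ⟨t, ht, ?_⟩
        convert hug using 3
        funext j
        simp only [Finset.sum_apply, Pi.smul_apply, Int.cast_sum, Finset.smul_sum]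
        refine Finset.sum_congr rfl fun i _ => ?_
        simp only [smul_eq_mul, zsmul_eq_mul, Int.cast_mul]
        ring
    obtain ⟨y, hy, u, hu, u', hu', rfl⟩ := hY x hx
    obtain ⟨s, hs, hsu⟩ := happrox u hu
    obtain ⟨s', hs', hsu'⟩ := happrox u' hu'
    obtain ⟨t, ht, he⟩ := hn2 (Sum.elim (s - s') (Pi.single ⟨y, hy⟩ 1)) (mem_intBox.2 (by
      rintro (i | x)
      · have h1 := mem_intBox.1 hs i
        have h2 := mem_intBox.1 hs' i
        have h3 := abs_sub (s i) (s' i)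
        simp only [Sum.elim_inl, Pi.sub_apply, m']
        push_cast
        linarith
      · by_cases hx : x = ⟨y, hy⟩
        · subst hx; simp [m']
        · simp [m', hx]))
    refine ⟨t, ht, ?_⟩
    simp only [Int.cast_smul_eq_zsmul ℝ]
    rw [← he, Fintype.sum_sum_type]
    simp only [Sum.elim_inl, Sum.elim_inr, a', Pi.sub_apply, sub_smul, Finset.sum_sub_distrib]
    rw [Finset.sum_eq_single (⟨y, hy⟩ : Y) (fun x _ hx => by simp [hx]) (by simp)]
    simp only [Pi.single_eq_same, one_smul]
    rw [show ∀ p q : Fin k → ℝ, y + u - u' - (p - q + y) = (u - p) - (u' - q) by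
      intro p q; abel]
    exact (norm_sub_le _ _).trans (by linarith)
  · have hcard : (intBox n).card ≤ 2 ^ D₁ * 3 ^ (2 * K) * (C₁ * G.card) := by
      rw [hn3, card_intBox, Fintype.prod_sum_type]
      simp only [m', Sum.elim_inl, Sum.elim_inr, Finset.prod_const, Finset.card_univ,
        Fintype.card_coe]
      have h1 : ∏ i, (2 * (2 * m i) + 1) ≤ 2 ^ D * (intBox m).card := by
        have : ∏ _i : Fin D, 2 = 2 ^ D := by simp
        rw [card_intBox, ← this, ← Finset.prod_mul_distrib]
        exact Finset.prod_le_prod' fun i _ => by omega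
      calc _ ≤ 2 ^ D * (intBox m).card * (2 * 1 + 1) ^ Y.card := Nat.mul_le_mul_right _ h1
        _ ≤ 2 ^ D₁ * (C₁ * G.card) * 3 ^ (2 * K) := by
          gcongr <;> norm_num
        _ = _ := by ring
    rw [ENNReal.ofReal_mul zero_le_two, ENNReal.ofReal_ofNat, mul_pow]
    calc ((intBox n).card : ℝ≥0∞) * (2 ^ k * ENNReal.ofReal δ ^ k)
        ≤ (2 ^ D₁ * 3 ^ (2 * K) * (C₁ * G.card) : ℕ) * (2 ^ k * ENNReal.ofReal δ ^ k) := by gcongr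
      _ = (2 ^ D₁ * 3 ^ (2 * K) * 2 ^ k * C₁ : ℕ) * (G.card * ENNReal.ofReal δ ^ k) := by
        push_cast; ring
      _ ≤ (2 ^ D₁ * 3 ^ (2 * K) * 2 ^ k * C₁ : ℕ) * (2 * K * volume A) := by gcongr
      _ = _ := by push_cast; ring

/-- Every compact subset `S` of `B` satisfies `|S + S| ≥ c|S| - e`. -/
def HasDoublingBound {k : ℕ} (B : Set (Fin k → ℝ)) (c e : ℝ≥0∞) : Prop :=
  ∀ S ⊆ B, IsCompact S → c * volume S ≤ volume (S + S) + e

theorem HasDoublingBound.mono {k : ℕ} {B B' : Set (Fin k → ℝ)} {c e e' : ℝ≥0∞}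
    (h : HasDoublingBound B c e) (hB : B' ⊆ B) (he : e ≤ e') : HasDoublingBound B' c e' :=
  fun S hS hc => (h S (hS.trans hB) hc).trans (by gcongr)

theorem hasDoublingBound_univ (k : ℕ) :
    HasDoublingBound (Set.univ : Set (Fin k → ℝ)) (2 ^ k) 0 := fun S _ _ => by
  have h : volume ((2 : ℝ) • S) = 2 ^ k * volume S := by
    rw [Measure.addHaar_smul_of_nonneg _ zero_le_two, Module.finrank_fin_fun]
    simp [ENNReal.ofReal_pow]
  rw [add_zero, ← h]
  refine measure_mono ?_
  rintro _ ⟨x, hx, rfl⟩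
  exact ⟨x, hx, x, hx, by simp only [two_smul]⟩

/-- The points of `B` whose translate by `t • a` lies in `S`. -/
def translateSlice {k : ℕ} (B S : Set (Fin k → ℝ)) (a : Fin k → ℝ) (t : ℤ) : Set (Fin k → ℝ) :=
  {b | b ∈ B ∧ (t : ℝ) • a + b ∈ S}

theorem isCompact_translateSlice {k : ℕ} {B S : Set (Fin k → ℝ)} (hB : IsCompact B)
    (hS : IsClosed S) (a : Fin k → ℝ) (t : ℤ) : IsCompact (translateSlice B S a t) :=
  hB.inter_right (hS.preimage (by fun_prop : Continuous fun b => (t : ℝ) • a + b))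

theorem volume_le_sum_translateSlice {k : ℕ} {B S : Set (Fin k → ℝ)} {a : Fin k → ℝ}
    {I : Finset ℤ} (hS : ∀ x ∈ S, ∃ t ∈ I, ∃ b ∈ B, x = (t : ℝ) • a + b) :
    volume S ≤ ∑ t ∈ I, volume (translateSlice B S a t) := by
  calc volume S ≤ volume (⋃ t ∈ I, ((t : ℝ) • a) +ᵥ translateSlice B S a t) := by
        refine measure_mono fun x hx => ?_
        obtain ⟨t, ht, b, hb, rfl⟩ := hS x hx
        exact Set.mem_biUnion (by exact ht) ⟨b, ⟨hb, hx⟩, rfl⟩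
    _ ≤ ∑ t ∈ I, volume (((t : ℝ) • a) +ᵥ translateSlice B S a t) := measure_biUnion_finset_le _ _
    _ = _ := by simp [measure_vadd]

theorem sum_translateSlice_le_volume {k : ℕ} {B S : Set (Fin k → ℝ)} {a : Fin k → ℝ}
    {I : Finset ℤ} (hB : IsCompact B) (hS : IsClosed S)
    (hI : ∀ t ∈ I, ∀ t' ∈ I, ∀ b ∈ B, ∀ b' ∈ B, (t : ℝ) • a + b = (t' : ℝ) • a + b' → t = t') :
    ∑ t ∈ I, volume (translateSlice B S a t) ≤ volume S := by
  calc ∑ t ∈ I, volume (translateSlice B S a t)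
      = ∑ t ∈ I, volume (((t : ℝ) • a) +ᵥ translateSlice B S a t) := by simp [measure_vadd]
    _ = volume (⋃ t ∈ I, ((t : ℝ) • a) +ᵥ translateSlice B S a t) := by
        refine (measure_biUnion_finset (fun t ht t' ht' htt => ?_) fun t _ =>
          (isCompact_translateSlice hB hS a t).measurableSet.const_vadd _).symm
        refine Set.disjoint_left.2 ?_
        rintro _ ⟨b, hb, rfl⟩ ⟨b', hb', h⟩
        exact htt (hI t ht t' ht' b hb.1 b' hb'.1 h.symm)
    _ ≤ volume S := measure_mono (Set.iUnion₂_subset fun t _ => by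
        rintro _ ⟨b, hb, rfl⟩
        exact hb.2)

theorem sum_weight_le {J : Finset ℕ} {n : ℕ} (h : ∀ j ∈ J, 2 * j + 1 ≤ n) :
    ∑ j ∈ J, (if j = 0 then 1 else 2) ≤ n := by
  have hr : ∀ r : ℕ, ∑ j ∈ Finset.range (r + 1), (if j = 0 then 1 else 2) = 2 * r + 1 := by
    intro r
    induction r with
    | zero => simp
    | succ r ih => rw [Finset.sum_range_succ, ih]; simp; ring
  rcases Nat.eq_zero_or_pos n with rfl | hn
  · rw [Finset.eq_empty_of_forall_notMem (s := J) fun j hj => by have := h j hj; omega]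
    simp
  · have hsub : J ⊆ Finset.range ((n - 1) / 2 + 1) := fun j hj => by
      have := h j hj
      rw [Finset.mem_range]; omega
    refine (Finset.sum_le_sum_of_subset hsub).trans ?_
    rw [hr]; omega

theorem HasDoublingBound.short_step {k : ℕ} {B : Set (Fin k → ℝ)} {c e : ℝ≥0∞}
    (h : HasDoublingBound B c e) (hB : IsCompact B) (a : Fin k → ℝ) (m : ℕ)
    (hdisj : ∀ t : ℤ, |t| ≤ 4 * m → ∀ b₁ ∈ B + B, ∀ b₂ ∈ B + B, (t : ℝ) • a + b₁ = b₂ → t = 0) :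
    HasDoublingBound {x | ∃ t : ℤ, |t| ≤ m ∧ ∃ b ∈ B, x = (t : ℝ) • a + b} c
      ((2 * m + 1 : ℕ) * e) := by
  intro S hS hSc
  set I := Finset.Icc (-m : ℤ) m with hI
  have hIcard : I.card = 2 * m + 1 := by rw [hI, Int.card_Icc]; omega
  have hmem : ∀ t : ℤ, t ∈ I ↔ |t| ≤ m := fun t => by rw [hI, Finset.mem_Icc, abs_le]
  have h1 : volume S ≤ ∑ t ∈ I, volume (translateSlice B S a t) :=
    volume_le_sum_translateSlice fun x hx => by
      obtain ⟨t, ht, b, hb, rfl⟩ := hS hx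
      exact ⟨t, (hmem t).2 ht, b, hb, rfl⟩
  have h2 : ∑ t ∈ I, volume (translateSlice (B + B) (S + S) a (2 * t)) ≤ volume (S + S) := by
    have h3 := sum_translateSlice_le_volume (a := a) (I := I.image fun t => 2 * t) (hB.add hB)
      (hSc.add hSc).isClosed (by
        intro t ht t' ht' b hb b' hb' hbb
        obtain ⟨s, hs, rfl⟩ := Finset.mem_image.1 ht
        obtain ⟨s', hs', rfl⟩ := Finset.mem_image.1 ht'
        rw [hmem] at hs hs'
        have := hdisj (2 * s - 2 * s') (by rw [abs_le] at *; constructor <;> linarith) b hb b' hb' (by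
          rw [Int.cast_sub, sub_smul, sub_add_eq_add_sub, hbb, add_sub_cancel_left])
        linarith)
    rwa [Finset.sum_image (fun x _ y _ hxy => by simpa using hxy)] at h3
  calc c * volume S ≤ c * ∑ t ∈ I, volume (translateSlice B S a t) := by gcongr
    _ = ∑ t ∈ I, c * volume (translateSlice B S a t) := Finset.mul_sum _ _ _
    _ ≤ ∑ t ∈ I, (volume (translateSlice (B + B) (S + S) a (2 * t)) + e) := by
      refine Finset.sum_le_sum fun t _ => ?_
      refine (h _ (fun b hb => hb.1) (isCompact_translateSlice hB hSc.isClosed a t)).trans ?_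
      gcongr
      rintro _ ⟨b, hb, b', hb', rfl⟩
      refine ⟨Set.add_mem_add hb.1 hb'.1, ?_⟩
      have := Set.add_mem_add hb.2 hb'.2
      convert this using 1
      push_cast
      module
    _ ≤ _ := by
      rw [Finset.sum_add_distrib, Finset.sum_const, hIcard, nsmul_eq_mul]
      gcongr

theorem card_le_card_filter_add {k : ℕ} {B S : Set (Fin k → ℝ)} {a : Fin k → ℝ} {I : Finset ℤ}
    {j : ℕ} {y y' : Fin k → ℝ} [DecidablePred fun t => y ∈ translateSlice B S a t]
    [DecidablePred fun t => y' ∈ translateSlice B S a t]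
    [DecidablePred fun t => y + y' ∈ translateSlice (B + B) (S + S) a t]
    (hy : j < (I.filter fun t => y ∈ translateSlice B S a t).card)
    (hy' : j < (I.filter fun t => y' ∈ translateSlice B S a t).card) :
    2 * j + 1 ≤ ((I + I).filter fun t => y + y' ∈ translateSlice (B + B) (S + S) a t).card := by
  have h := cauchy_davenport_add_of_linearOrder_isCancelAdd
    (Finset.card_pos.1 (Nat.zero_lt_of_lt hy)) (Finset.card_pos.1 (Nat.zero_lt_of_lt hy'))
  refine le_trans (by omega) (h.trans (Finset.card_le_card fun u hu => ?_))
  obtain ⟨t, ht, t', ht', rfl⟩ := Finset.mem_add.1 hu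
  rw [Finset.mem_filter] at ht ht' ⊢
  refine ⟨Finset.add_mem_add ht.1 ht'.1, Set.add_mem_add ht.2.1 ht'.2.1, ?_⟩
  have := Set.add_mem_add ht.2.2 ht'.2.2
  convert this using 1
  push_cast
  module

theorem HasDoublingBound.long_step {k : ℕ} {B : Set (Fin k → ℝ)} {c e : ℝ≥0∞}
    (h : HasDoublingBound B c e) (hB : IsCompact B) (a : Fin k → ℝ) (m : ℕ)
    (hdisj : ∀ t : ℤ, |t| ≤ 4 * m → ∀ b₁ ∈ B + B, ∀ b₂ ∈ B + B, (t : ℝ) • a + b₁ = b₂ → t = 0) :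
    HasDoublingBound {x | ∃ t : ℤ, |t| ≤ m ∧ ∃ b ∈ B, x = (t : ℝ) • a + b} (2 * c)
      (c * volume B + 2 * (2 * m + 1 : ℕ) * e) := by
  classical
  intro S hS hSc
  set I := Finset.Icc (-m : ℤ) m with hI
  have hIcard : I.card = 2 * m + 1 := by rw [hI, Int.card_Icc]; omega
  have hmem : ∀ t : ℤ, t ∈ I ↔ |t| ≤ m := fun t => by rw [hI, Finset.mem_Icc, abs_le]
  have h1 : volume S ≤ ∑ t ∈ I, volume (translateSlice B S a t) :=
    volume_le_sum_translateSlice fun x hx => by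
      obtain ⟨t, ht, b, hb, rfl⟩ := hS hx
      exact ⟨t, (hmem t).2 ht, b, hb, rfl⟩
  have h2 : ∑ t ∈ I + I, volume (translateSlice (B + B) (S + S) a t) ≤ volume (S + S) := by
    refine sum_translateSlice_le_volume (hB.add hB) (hSc.add hSc).isClosed ?_
    intro t ht t' ht' b hb b' hb' hbb
    obtain ⟨s, hs, r, hr, rfl⟩ := Finset.mem_add.1 ht
    obtain ⟨s', hs', r', hr', rfl⟩ := Finset.mem_add.1 ht'
    rw [hmem] at hs hs' hr hr'
    have := hdisj (s + r - (s' + r')) (by rw [abs_le] at *; constructor <;> linarith) b hb b' hb' (by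
      rw [Int.cast_sub, sub_smul, sub_add_eq_add_sub, hbb, add_sub_cancel_left])
    linarith
  let A : ℤ → Set (Fin k → ℝ) := translateSlice B S a
  have hAc : ∀ t, IsCompact (A t) := fun t => isCompact_translateSlice hB hSc.isClosed a t
  obtain ⟨T, hT⟩ : ∃ T : ℕ → Set (Fin k → ℝ),
      ∀ j b, b ∈ T j ↔ j < (I.filter fun t => b ∈ A t).card :=
    ⟨fun j => {b | j < (I.filter fun t => b ∈ A t).card}, fun _ _ => Iff.rfl⟩
  have hTeq : ∀ j, T j = ⋃ J ∈ I.powersetCard (j + 1), ⋂ t ∈ J, A t := fun j => by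
    ext b
    simp only [hT, Set.mem_iUnion, Set.mem_iInter, exists_prop,
      Finset.mem_powersetCard]
    constructor
    · intro hb
      obtain ⟨J, hJ, hJc⟩ := Finset.exists_subset_card_eq (Nat.succ_le_of_lt hb)
      exact ⟨J, ⟨hJ.trans (Finset.filter_subset _ _), hJc⟩, fun t ht => (Finset.mem_filter.1 (hJ ht)).2⟩
    · rintro ⟨J, ⟨hJ, hJc⟩, hb⟩
      rw [← Nat.succ_le_iff, Nat.succ_eq_add_one, ← hJc]
      exact Finset.card_le_card fun t ht => Finset.mem_filter.2 ⟨hJ ht, hb t ht⟩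
  have hTc : ∀ j, IsCompact (T j) := fun j => by
    rw [hTeq]
    refine Finset.isCompact_biUnion _ fun J hJ => ?_
    have hJne : J.Nonempty := Finset.card_pos.1 (by rw [(Finset.mem_powersetCard.1 hJ).2]; omega)
    obtain ⟨t₀, ht₀⟩ := hJne
    exact (hAc t₀).of_isClosed_subset (isClosed_biInter fun t _ => (hAc t).isClosed)
      (Set.biInter_subset_of_mem ht₀)
  have hTB : ∀ j, T j ⊆ B := fun j b hb => by
    obtain ⟨t, ht⟩ := Finset.card_pos.1 (Nat.zero_lt_of_lt ((hT j b).1 hb))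
    exact (Finset.mem_filter.1 ht).2.1
  have h3 : ∑ t ∈ I, volume (A t) = ∑ j ∈ Finset.range (2 * m + 1), volume (T j) := by
    simp_rw [← fun t => lintegral_indicator_one (μ := volume) (hAc t).measurableSet,
      ← fun j => lintegral_indicator_one (μ := volume) (hTc j).measurableSet]
    rw [← lintegral_finsetSum _ fun t _ => measurable_one.indicator (hAc t).measurableSet,
      ← lintegral_finsetSum _ fun t _ => measurable_one.indicator (hTc t).measurableSet]
    refine lintegral_congr fun b => ?_
    simp only [Set.indicator_apply, Pi.one_apply, Finset.sum_boole]
    have : (Finset.range (2 * m + 1)).filter (fun j => b ∈ T j)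
        = Finset.range (I.filter fun t => b ∈ A t).card := by
      ext j
      simp only [hT, Finset.mem_filter, Finset.mem_range]
      have := (Finset.card_filter_le I fun t => b ∈ A t).trans_eq hIcard
      omega
    rw [this, Finset.card_range]
  have h4 : ∑ j ∈ Finset.range (2 * m + 1), (if j = 0 then 1 else 2 : ℕ) * volume (T j + T j)
      ≤ volume (S + S) := by
    refine le_trans ?_ h2
    have hUc : ∀ t, IsCompact (translateSlice (B + B) (S + S) a t) := fun t =>
      isCompact_translateSlice (hB.add hB) (hSc.add hSc).isClosed a t
    have hind : ∀ j, Measurable ((T j + T j).indicator (1 : (Fin k → ℝ) → ℝ≥0∞)) := fun j =>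
      measurable_one.indicator ((hTc j).add (hTc j)).measurableSet
    have hvT : ∀ j, ((if j = 0 then 1 else 2 : ℕ) : ℝ≥0∞) * volume (T j + T j)
        = ∫⁻ z, (if j = 0 then 1 else 2 : ℕ) * (T j + T j).indicator 1 z := fun j => by
      rw [lintegral_const_mul _ (hind j),
        lintegral_indicator_one ((hTc j).add (hTc j)).measurableSet]
    simp_rw [← fun t => lintegral_indicator_one (μ := volume) (hUc t).measurableSet, hvT]
    rw [← lintegral_finsetSum _ fun t _ => measurable_one.indicator (hUc t).measurableSet,
      ← lintegral_finsetSum _ fun j _ => (hind j).const_mul _]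
    refine lintegral_mono fun z => ?_
    simp only [Set.indicator_apply, Pi.one_apply, Finset.sum_boole, mul_ite, mul_one, mul_zero]
    rw [← Finset.sum_filter, ← Nat.cast_sum, Nat.cast_le]
    refine sum_weight_le fun j hj => ?_
    obtain ⟨y, hy, y', hy', rfl⟩ := (Finset.mem_filter.1 hj).2
    exact card_le_card_filter_add ((hT j y).1 hy) ((hT j y').1 hy')
  have h5 : 2 * ∑ j ∈ Finset.range (2 * m + 1), volume (T j) = volume (T 0)
      + ∑ j ∈ Finset.range (2 * m + 1), (if j = 0 then 1 else 2 : ℕ) * volume (T j) := by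
    rw [Finset.sum_range_succ', Finset.sum_range_succ']
    simp only [Nat.add_eq_zero_iff, one_ne_zero, and_false, if_false, if_true, Nat.cast_one, one_mul,
      Nat.cast_ofNat, ← Finset.mul_sum]
    ring
  calc 2 * c * volume S ≤ 2 * c * ∑ j ∈ Finset.range (2 * m + 1), volume (T j) := by
        rw [← h3]; gcongr
    _ = c * volume (T 0)
        + ∑ j ∈ Finset.range (2 * m + 1), (if j = 0 then 1 else 2 : ℕ) * (c * volume (T j)) := by
        rw [mul_comm 2 c, mul_assoc, h5, mul_add, Finset.mul_sum]
        congr 1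
        exact Finset.sum_congr rfl fun j _ => by ring
    _ ≤ c * volume B + ∑ j ∈ Finset.range (2 * m + 1),
          ((if j = 0 then 1 else 2 : ℕ) * volume (T j + T j) + 2 * e) := by
        gcongr with j
        · exact hTB 0
        · calc ((if j = 0 then 1 else 2 : ℕ) : ℝ≥0∞) * (c * volume (T j))
              ≤ (if j = 0 then 1 else 2 : ℕ) * (volume (T j + T j) + e) := by
                gcongr
                exact h _ (hTB j) (hTc j)
            _ ≤ _ := by
                rw [mul_add]
                gcongr
                split_ifs <;> norm_num
    _ ≤ _ := by
        rw [Finset.sum_add_distrib, Finset.sum_const, Finset.card_range, nsmul_eq_mul]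
        rw [show c * volume B + (∑ j ∈ Finset.range (2 * m + 1),
          (if j = 0 then 1 else 2 : ℕ) * volume (T j + T j) + (2 * m + 1 : ℕ) * (2 * e))
          = (∑ j ∈ Finset.range (2 * m + 1), (if j = 0 then 1 else 2 : ℕ) * volume (T j + T j))
            + (c * volume B + 2 * (2 * m + 1 : ℕ) * e) by ring]
        gcongr

theorem convex_symParallelotope {k : ℕ} (v : Fin k → Fin k → ℝ) :
    Convex ℝ (symParallelotope v) := fun x hx y hy r s hr hs hrs =>
  smul_add_smul_mem_symParallelotope hx hy (by rw [abs_of_nonneg hr, abs_of_nonneg hs, hrs])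

theorem neg_mem_symParallelotope {k : ℕ} {v : Fin k → Fin k → ℝ} {y : Fin k → ℝ}
    (hy : y ∈ symParallelotope v) : -y ∈ symParallelotope v := by
  simpa using smul_mem_symParallelotope hy (s := -1) (by simp)

theorem sum_mem_smul_symParallelotope {k : ℕ} {v : Fin k → Fin k → ℝ} :
    ∀ {n : ℕ} (f : Fin n → Fin k → ℝ), (∀ i, f i ∈ symParallelotope v) →
      ∑ i, f i ∈ (n : ℝ) • symParallelotope v
  | 0, f, _ => ⟨0, mem_symParallelotope.2 ⟨0, by simp, by simp⟩, by simp⟩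
  | n + 1, f, hf => by
    rw [Fin.sum_univ_castSucc, Nat.cast_succ,
      (convex_symParallelotope v).add_smul (Nat.cast_nonneg n) zero_le_one, one_smul]
    exact Set.add_mem_add (sum_mem_smul_symParallelotope _ fun i => hf _) (hf _)

theorem smul_symParallelotope_mono {k : ℕ} (v : Fin k → Fin k → ℝ) {r s : ℝ} (hr : 0 ≤ r)
    (hs : 0 < s) (h : r ≤ s) : r • symParallelotope v ⊆ s • symParallelotope v := by
  rintro _ ⟨y, hy, rfl⟩
  refine ⟨(r / s) • y, smul_mem_symParallelotope hy ?_, ?_⟩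
  · rw [abs_of_nonneg (by positivity)]
    exact (div_le_one hs).2 h
  · simp only [smul_smul]
    rw [mul_div_cancel₀ _ hs.ne']

/-- The sum of a generalized arithmetic progression and a set. -/
def gapAdd {ι : Type*} [Fintype ι] [DecidableEq ι] {k : ℕ} (a : ι → Fin k → ℝ) (m : ι → ℕ)
    (Q : Set (Fin k → ℝ)) : Set (Fin k → ℝ) :=
  {x | ∃ t ∈ intBox m, ∃ q ∈ Q, x = ∑ i, (t i : ℝ) • a i + q}

section gapAdd

variable {ι : Type*} [Fintype ι] [DecidableEq ι] {k : ℕ}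

theorem gapAdd_eq_biUnion (a : ι → Fin k → ℝ) (m : ι → ℕ) (Q : Set (Fin k → ℝ)) :
    gapAdd a m Q = ⋃ t ∈ intBox m, (∑ i, (t i : ℝ) • a i) +ᵥ Q := by
  ext x
  simp only [gapAdd, Set.mem_ofPred_eq, Set.mem_iUnion, exists_prop, Set.mem_vadd_set, vadd_eq_add,
    eq_comm (a := x)]

theorem isCompact_gapAdd (a : ι → Fin k → ℝ) (m : ι → ℕ) {Q : Set (Fin k → ℝ)} (hQ : IsCompact Q) :
    IsCompact (gapAdd a m Q) := by
  rw [gapAdd_eq_biUnion]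
  exact Finset.isCompact_biUnion _ fun t _ => hQ.vadd _

theorem volume_gapAdd_le (a : ι → Fin k → ℝ) (m : ι → ℕ) (Q : Set (Fin k → ℝ)) :
    volume (gapAdd a m Q) ≤ (intBox m).card * volume Q := by
  rw [gapAdd_eq_biUnion]
  exact (measure_biUnion_finset_le _ _).trans (by simp [measure_vadd])

theorem exists_of_mem_gapAdd_add_gapAdd {a : ι → Fin k → ℝ} {m : ι → ℕ} {Q : Set (Fin k → ℝ)}
    {x : Fin k → ℝ} (hx : x ∈ gapAdd a m Q + gapAdd a m Q) :
    ∃ t : ι → ℤ, (∀ i, |t i| ≤ 2 * m i) ∧ ∃ q ∈ Q, ∃ q' ∈ Q,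
      x = ∑ i, (t i : ℝ) • a i + (q + q') := by
  obtain ⟨_, ⟨t, ht, q, hq, rfl⟩, _, ⟨t', ht', q', hq', rfl⟩, rfl⟩ := hx
  refine ⟨t + t', fun i => ?_, q, hq, q', hq', ?_⟩
  · have h1 := mem_intBox.1 ht i
    have h2 := mem_intBox.1 ht' i
    exact (abs_add_le _ _).trans (by linarith)
  · simp only [Pi.add_apply, Int.cast_add, add_smul, Finset.sum_add_distrib]
    abel

theorem gapAdd_insert_subset (a : ι → Fin k → ℝ) (m : ι → ℕ) (Q : Set (Fin k → ℝ)) (i : ι)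
    (I : Finset ι) :
    gapAdd a (fun j => if j ∈ insert i I then m j else 0) Q ⊆
      {x | ∃ t : ℤ, |t| ≤ m i ∧ ∃ b ∈ gapAdd a (fun j => if j ∈ I then m j else 0) Q,
        x = (t : ℝ) • a i + b} := by
  rintro _ ⟨s, hs, q, hq, rfl⟩
  rw [mem_intBox] at hs
  refine ⟨s i, by simpa using hs i, _, ⟨Function.update s i 0, mem_intBox.2 fun j => ?_, q, hq, rfl⟩,
    ?_⟩
  · by_cases hj : j = i
    · subst hj; rw [Function.update_self, abs_zero]; exact Int.natCast_nonneg _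
    · simpa [hj] using hs j
  · rw [← add_assoc]
    congr 1
    rw [← sub_eq_iff_eq_add, ← Finset.sum_sub_distrib,
      Finset.sum_eq_single i (fun j _ hj => by simp [hj]) (by simp)]
    simp

end gapAdd

/-- Each generator of large length in a sufficiently proper progression doubles the constant in
the lower bound for sumsets. -/
theorem hasDoublingBound_gapAdd {k D : ℕ} {a : Fin D → Fin k → ℝ} {m : Fin D → ℕ}
    {v : Fin k → Fin k → ℝ}
    (hrel : ∀ t : Fin D → ℤ, (∀ i, |t i| ≤ 4 * m i) →
      ∑ i, (t i : ℝ) • a i ∈ (4 : ℝ) • symParallelotope v → t = 0)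
    {T : ℕ} {η : ℝ≥0∞} (hη : 2 ^ (k + D) ≤ η * T) (I : Finset (Fin D)) :
    HasDoublingBound (gapAdd a (fun i => if i ∈ I then m i else 0) (symParallelotope v))
      (2 ^ (k + (I.filter fun i => T ≤ m i).card))
      (3 ^ I.card * η * ((∏ i ∈ I, (2 * m i + 1) : ℕ) * volume (symParallelotope v))) := by
  induction I using Finset.induction_on with
  | empty => exact (hasDoublingBound_univ k).mono (Set.subset_univ _) zero_le
  | insert i I hi ih =>
    have hB : IsCompact (gapAdd a (fun i => if i ∈ I then m i else 0) (symParallelotope v)) :=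
      isCompact_gapAdd _ _ (isCompact_symParallelotope v)
    have hdisj : ∀ t : ℤ, |t| ≤ 4 * m i →
        ∀ b₁ ∈ gapAdd a (fun i => if i ∈ I then m i else 0) (symParallelotope v)
          + gapAdd a (fun i => if i ∈ I then m i else 0) (symParallelotope v),
        ∀ b₂ ∈ gapAdd a (fun i => if i ∈ I then m i else 0) (symParallelotope v)
          + gapAdd a (fun i => if i ∈ I then m i else 0) (symParallelotope v),
        (t : ℝ) • a i + b₁ = b₂ → t = 0 := by
      intro t ht b₁ hb₁ b₂ hb₂ h
      obtain ⟨t₁, ht₁, q₁, hq₁, q₁', hq₁', rfl⟩ := exists_of_mem_gapAdd_add_gapAdd hb₁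
      obtain ⟨t₂, ht₂, q₂, hq₂, q₂', hq₂', rfl⟩ := exists_of_mem_gapAdd_add_gapAdd hb₂
      have h1 : t₁ i = 0 := by simpa [hi] using ht₁ i
      have h2 : t₂ i = 0 := by simpa [hi] using ht₂ i
      have h0 := hrel (Pi.single i t + t₁ - t₂) (fun j => ?_) ?_
      · have := congrFun h0 i
        simpa [h1, h2] using this
      · by_cases hj : j = i
        · subst hj; simpa [h1, h2] using ht
        · have h3 := ht₁ j
          have h4 := ht₂ j
          have h5 : ((if j ∈ I then m j else 0 : ℕ) : ℤ) ≤ m j := by split_ifs <;> simp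
          simp only [Pi.sub_apply, Pi.add_apply, Pi.single_eq_of_ne hj, zero_add]
          exact (abs_sub _ _).trans (by linarith)
      · have h3 : ∑ j, (((Pi.single i t + t₁ - t₂ : Fin D → ℤ) j : ℤ) : ℝ) • a j
            = ∑ l, ![q₂, q₂', -q₁, -q₁'] l := by
          have h4 : ∑ j, (((Pi.single i t : Fin D → ℤ) j : ℤ) : ℝ) • a j = (t : ℝ) • a i := by
            rw [Finset.sum_eq_single i (fun j _ hj => by simp [hj]) (by simp), Pi.single_eq_same]
          simp only [Pi.sub_apply, Pi.add_apply, Int.cast_sub, Int.cast_add, sub_smul, add_smul,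
            Finset.sum_sub_distrib, Finset.sum_add_distrib, h4, Fin.sum_univ_four]
          change _ = q₂ + q₂' + -q₁ + -q₁'
          rw [← sub_eq_zero] at h ⊢
          rw [← h]
          abel
        rw [h3]
        refine sum_mem_smul_symParallelotope ![q₂, q₂', -q₁, -q₁'] fun l => ?_
        fin_cases l
        · exact hq₂
        · exact hq₂'
        · exact neg_mem_symParallelotope hq₁
        · exact neg_mem_symParallelotope hq₁'
    rw [Finset.filter_insert, Finset.card_insert_of_notMem hi, Finset.prod_insert hi]
    split_ifs with hT
    · rw [Finset.card_insert_of_notMem (by simp [hi]), ← add_assoc, pow_succ, mul_comm _ 2]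
      refine (ih.long_step hB (a i) (m i) hdisj).mono (gapAdd_insert_subset a m _ i I) ?_
      have hvol : volume (gapAdd a (fun i => if i ∈ I then m i else 0) (symParallelotope v))
          ≤ (∏ i ∈ I, (2 * m i + 1) : ℕ) * volume (symParallelotope v) := by
        refine (volume_gapAdd_le _ _ _).trans (le_of_eq ?_)
        rw [card_intBox, ← Finset.prod_filter_mul_prod_filter_not Finset.univ (· ∈ I)]
        rw [Finset.prod_congr rfl (g := fun i => 2 * m i + 1) (fun j hj => by
          simp [(Finset.mem_filter.1 hj).2]), Finset.prod_eq_one (s := Finset.univ.filter (· ∉ I))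
          (fun j hj => by simp [(Finset.mem_filter.1 hj).2]), Finset.filter_univ_mem, mul_one]
      set W : ℝ≥0∞ := (∏ i ∈ I, (2 * m i + 1) : ℕ) * volume (symParallelotope v) with hW
      have hc : (2 : ℝ≥0∞) ^ (k + (I.filter fun i => T ≤ m i).card) ≤ η * (2 * m i + 1 : ℕ) := by
        calc (2 : ℝ≥0∞) ^ (k + (I.filter fun i => T ≤ m i).card) ≤ 2 ^ (k + D) := by
              have := Finset.card_le_univ (I.filter fun i => T ≤ m i)
              rw [Fintype.card_fin] at this
              gcongr
              norm_num
          _ ≤ η * T := hη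
          _ ≤ _ := by gcongr; omega
      have h3 : (1 : ℝ≥0∞) ≤ 3 ^ I.card := one_le_pow₀ (by norm_num)
      calc _ ≤ 3 ^ I.card * (η * (2 * m i + 1 : ℕ)) * W
            + 2 * (2 * m i + 1 : ℕ) * (3 ^ I.card * η * W) := by
            gcongr
            exact hc.trans (le_mul_of_one_le_left zero_le h3)
        _ = _ := by rw [hW]; push_cast; ring
    · refine (ih.short_step hB (a i) (m i) hdisj).mono (gapAdd_insert_subset a m _ i I) ?_
      calc _ ≤ 3 * (((2 * m i + 1 : ℕ) : ℝ≥0∞) * (3 ^ I.card * η *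
            ((∏ i ∈ I, (2 * m i + 1) : ℕ) * volume (symParallelotope v)))) :=
            le_mul_of_one_le_left zero_le (by norm_num)
        _ = _ := by push_cast; ring

/-- The subprogression spanned by the generators with index in `J`. -/
def gapOn {k D : ℕ} (a : Fin D → Fin k → ℝ) (m : Fin D → ℕ) (J : Finset (Fin D)) :
    Set (Fin k → ℝ) :=
  {x | ∃ t ∈ intBox m, (∀ i ∉ J, t i = 0) ∧ x = ∑ i, (t i : ℝ) • a i}

section gapOn

variable {k D : ℕ} {a : Fin D → Fin k → ℝ} {m : Fin D → ℕ}

theorem ncard_gapOn_le {J : Finset (Fin D)} {m' : Fin D → ℕ} (h : ∀ i ∈ J, m i ≤ m' i) :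
    (gapOn a m J).Finite ∧ (gapOn a m J).ncard ≤ (intBox m').card := by
  have hsub : gapOn a m J ⊆ (fun t : Fin D → ℤ => ∑ i, (t i : ℝ) • a i) '' (intBox m') := by
    rintro _ ⟨t, ht, htJ, rfl⟩
    refine ⟨t, mem_intBox.2 fun i => ?_, rfl⟩
    by_cases hi : i ∈ J
    · exact (mem_intBox.1 ht i).trans (by exact_mod_cast h i hi)
    · simp [htJ i hi]
  have hfin : ((fun t : Fin D → ℤ => ∑ i, (t i : ℝ) • a i) '' (intBox m' : Set _)).Finite :=
    (intBox m').finite_toSet.image _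
  refine ⟨hfin.subset hsub, (Set.ncard_le_ncard hsub hfin).trans ?_⟩
  exact (Set.ncard_image_le (intBox m').finite_toSet).trans_eq (Set.ncard_coe_finset _)

theorem sum_mem_gapOn {J : Finset (Fin D)} {n : ℕ} {f : Fin n → Fin k → ℝ}
    (hf : ∀ i, f i ∈ gapOn a m J) :
    ∃ t : Fin D → ℤ, (∀ i, |t i| ≤ n * m i) ∧ (∀ i ∉ J, t i = 0) ∧
      ∑ i, f i = ∑ i, (t i : ℝ) • a i := by
  choose t ht htJ hft using hf
  refine ⟨∑ j, t j, fun i => ?_, fun i hi => ?_, ?_⟩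
  · rw [Finset.sum_apply]
    refine (Finset.abs_sum_le_sum_abs _ _).trans ?_
    refine (Finset.sum_le_card_nsmul _ _ (m i : ℤ) fun j _ => mem_intBox.1 (ht j) i).trans ?_
    simp
  · rw [Finset.sum_apply]
    exact Finset.sum_eq_zero fun j _ => htJ j i hi
  · simp only [Finset.sum_apply, Int.cast_sum, Finset.sum_smul]
    rw [Finset.sum_comm]
    exact Finset.sum_congr rfl fun j _ => hft j

theorem sum_mem_gapOn_compl_add_gapOn {t : Fin D → ℤ} (ht : t ∈ intBox m) (J : Finset (Fin D)) :
    ∑ i, (t i : ℝ) • a i ∈ gapOn a m Jᶜ + gapOn a m J := by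
  rw [mem_intBox] at ht
  refine ⟨_, ⟨fun i => if i ∈ J then 0 else t i, mem_intBox.2 fun i => ?_, fun i hi => ?_, rfl⟩, _,
    ⟨fun i => if i ∈ J then t i else 0, mem_intBox.2 fun i => ?_, fun i hi => ?_, rfl⟩, ?_⟩
  · split_ifs
    · simp
    · exact ht i
  · simp [Finset.notMem_compl.1 hi]
  · split_ifs
    · exact ht i
    · simp
  · simp [hi]
  · simp only
    rw [← Finset.sum_add_distrib]
    refine Finset.sum_congr rfl fun i _ => ?_
    split_ifs <;> simp

variable {L : ℕ} {v : Fin k → Fin k → ℝ}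

theorem isSymGAPProperFull_gapOn
    (hrel : ∀ t : Fin D → ℤ, (∀ i, |t i| ≤ L * m i) →
      ∑ i, (t i : ℝ) • a i ∈ (L : ℝ) • symParallelotope v → t = 0)
    {J : Finset (Fin D)} {s n : ℕ} (hs : 2 * s ≤ L) (hn : ∀ i ∈ J, n ≤ 2 * m i + 1) :
    IsSymGAPProperFull k J.card s n (gapOn a m J) := by
  classical
  let e : Fin J.card ≃ J := J.equivFin.symm
  let ext : (Fin J.card → ℤ) → Fin D → ℤ := fun t i => if h : i ∈ J then t (e.symm ⟨i, h⟩) else 0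
  have hext : ∀ t j, ext t (e j) = t j := fun t j => by simp [ext]
  have hext0 : ∀ t, ∀ i ∉ J, ext t i = 0 := fun t i hi => by simp [ext, hi]
  have hcases : ∀ (p : Fin D → Prop), (∀ i ∉ J, p i) → (∀ j, p (e j)) → ∀ i, p i := by
    intro p h1 h2 i
    by_cases hi : i ∈ J
    · simpa using h2 (e.symm ⟨i, hi⟩)
    · exact h1 i hi
  have hsum : ∀ t : Fin D → ℤ, (∀ i ∉ J, t i = 0) →
      ∑ i, (t i : ℝ) • a i = ∑ j, (t (e j) : ℝ) • a (e j) := fun t ht => by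
    rw [Equiv.sum_comp e fun i : J => (t i : ℝ) • a i, Finset.sum_coe_sort J fun i => (t i : ℝ) • a i]
    exact (Finset.sum_subset (Finset.subset_univ J) fun i _ hi => by simp [ht i hi]).symm
  have hsum' : ∀ t, ∑ i, (ext t i : ℝ) • a i = ∑ j, (t j : ℝ) • a (e j) := fun t => by
    rw [hsum _ (hext0 t)]; simp only [hext]
  refine ⟨fun j => a (e j), fun j => m (e j), ?_, ?_, fun j => hn _ (e j).2⟩
  · ext x
    constructor
    · rintro ⟨t, ht, htJ, rfl⟩
      exact ⟨fun j => t (e j), fun j => mem_intBox.1 ht _, (hsum t htJ).symm⟩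
    · rintro ⟨t, ht, rfl⟩
      refine ⟨ext t, mem_intBox.2 (hcases _ (fun i hi => ?_) fun j => ?_), hext0 t, (hsum' t).symm⟩
      · simp [hext0 t i hi]
      · rw [hext]; exact ht j
  · intro t ht t' ht' htt
    simp only at htt
    have h0 := hrel (ext t - ext t') (hcases _ (fun i hi => ?_) fun j => ?_) ?_
    · funext j
      have := congrFun h0 (e j)
      simp only [Pi.sub_apply, hext, Pi.zero_apply] at this
      linarith
    · simp only [Pi.sub_apply, hext0 _ i hi, sub_self, abs_zero]
      positivity
    · simp only [Pi.sub_apply, hext]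
      have h1 := ht j
      have h2 := ht' j
      push_cast at h1 h2
      have h3 : ((2 * s : ℕ) : ℤ) * m (e j) ≤ L * m (e j) := by gcongr
      push_cast at h3
      exact (abs_sub _ _).trans (by linarith)
    · have h1 : ∑ i, (((ext t - ext t') i : ℤ) : ℝ) • a i = 0 := by
        simp only [Pi.sub_apply, Int.cast_sub, sub_smul, Finset.sum_sub_distrib, hsum']
        rw [htt, sub_self]
      rw [h1]
      exact ⟨0, mem_symParallelotope.2 ⟨0, by simp, by simp⟩, by simp⟩

theorem isSeparated_iterSumset_gapOn
    (hrel : ∀ t : Fin D → ℤ, (∀ i, |t i| ≤ L * m i) →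
      ∑ i, (t i : ℝ) • a i ∈ (L : ℝ) • symParallelotope v → t = 0)
    (J : Finset (Fin D)) {s : ℕ} (hs0 : 1 ≤ s) (hs : 2 * s ≤ L) :
    IsSeparated ((s : ℝ) • symParallelotope v) (iterSumset s (gapOn a m J)) := by
  rintro _ ⟨f, hf, rfl⟩ _ ⟨f', hf', rfl⟩ hne hmem
  obtain ⟨t, ht, -, h⟩ := sum_mem_gapOn hf
  obtain ⟨t', ht', -, h'⟩ := sum_mem_gapOn hf'
  rw [h, h'] at hne hmem
  refine hne ?_
  have h0 := hrel (t - t') (fun i => ?_) ?_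
  · rw [sub_eq_zero.1 h0]
  · have h3 : ((2 * s : ℕ) : ℤ) * m i ≤ L * m i := by gcongr
    push_cast at h3
    exact (abs_sub _ _).trans (by linarith [ht i, ht' i])
  · have h1 : ∑ i, (((t - t') i : ℤ) : ℝ) • a i
        = ∑ i, (t i : ℝ) • a i - ∑ i, (t' i : ℝ) • a i := by
      simp only [Pi.sub_apply, Int.cast_sub, sub_smul, Finset.sum_sub_distrib]
    rw [h1]
    refine smul_symParallelotope_mono v (Nat.cast_nonneg s) ?_ ?_ hmem
    · exact_mod_cast (by omega : 0 < L)
    · exact_mod_cast (by omega : s ≤ L)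

theorem isSeparated_iterSumset_gapOn_compl
    (hrel : ∀ t : Fin D → ℤ, (∀ i, |t i| ≤ L * m i) →
      ∑ i, (t i : ℝ) • a i ∈ (L : ℝ) • symParallelotope v → t = 0)
    (J : Finset (Fin D)) {s j : ℕ} (hj : 1 ≤ j) (hjs : j ≤ s) (hs : 2 * s ^ 2 ≤ L) :
    IsSeparated (iterSumset (s * j) {x | (j : ℝ) • x ∈ gapOn a m J + symParallelotope v})
      (iterSumset s (gapOn a m Jᶜ)) := by
  rintro _ ⟨f, hf, rfl⟩ _ ⟨f', hf', rfl⟩ hne ⟨g, hg, hfg⟩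
  obtain ⟨t, ht, htJ, h⟩ := sum_mem_gapOn hf
  obtain ⟨t', ht', htJ', h'⟩ := sum_mem_gapOn hf'
  choose p hp q hq hpq using hg
  obtain ⟨r, hr, hrJ, hpr⟩ := sum_mem_gapOn hp
  have hsj : s * j ≤ s ^ 2 := by rw [pow_two]; exact Nat.mul_le_mul_left _ hjs
  have hsj1 : 1 ≤ s * j := Nat.one_le_iff_ne_zero.2 (Nat.mul_ne_zero (by omega) (by omega))
  rw [h, h'] at hne hfg
  refine hne ?_
  have hJ : ∀ i ∈ J, t i = 0 ∧ t' i = 0 := fun i hi =>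
    ⟨htJ i (by simpa using hi), htJ' i (by simpa using hi)⟩
  have h0 := hrel ((j : ℤ) • (t - t') - r) (fun i => ?_) ?_
  · have htt : t = t' := by
      funext i
      by_cases hi : i ∈ J
      · rw [(hJ i hi).1, (hJ i hi).2]
      · have := congrFun h0 i
        simp only [Pi.sub_apply, Pi.smul_apply, hrJ i hi, sub_zero, Pi.zero_apply, smul_eq_mul,
          mul_eq_zero, Nat.cast_eq_zero] at this
        rcases this with h | h
        · omega
        · linarith
    rw [htt]
  · have h3 : ((2 * s ^ 2 : ℕ) : ℤ) * m i ≤ L * m i := by gcongr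
    have h4 : ((s * j : ℕ) : ℤ) * m i ≤ (s ^ 2 : ℕ) * m i := by gcongr
    push_cast at h3 h4
    have h5 : (0 : ℤ) ≤ (s : ℤ) ^ 2 * m i := by positivity
    by_cases hi : i ∈ J
    · simp only [Pi.sub_apply, Pi.smul_apply, (hJ i hi).1, (hJ i hi).2, sub_self, smul_zero, zero_sub,
        abs_neg]
      have := hr i
      push_cast at this
      linarith
    · simp only [Pi.sub_apply, Pi.smul_apply, hrJ i hi, sub_zero, smul_eq_mul, abs_mul, Nat.abs_cast]
      have h6 : |t i - t' i| ≤ 2 * (s * m i) := (abs_sub _ _).trans (by linarith [ht i, ht' i])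
      have h7 : (j : ℤ) * |t i - t' i| ≤ j * (2 * (s * m i)) := by gcongr
      linarith
  · have h1 : ∑ i, ((((j : ℤ) • (t - t') - r) i : ℤ) : ℝ) • a i = ∑ x, q x := by
      have h2 : ∑ x, q x = ∑ x, (j : ℝ) • g x - ∑ x, p x := by
        rw [← Finset.sum_sub_distrib]
        exact Finset.sum_congr rfl fun x _ => by simp only at hpq; rw [← hpq x]; abel
      rw [h2, ← Finset.smul_sum, ← hfg, hpr]
      simp only [Pi.sub_apply, Pi.smul_apply, smul_eq_mul, Int.cast_sub, Int.cast_mul, sub_smul,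
        Finset.sum_sub_distrib, Int.cast_natCast, mul_smul, ← Finset.smul_sum, smul_sub]
    rw [h1]
    refine smul_symParallelotope_mono v (Nat.cast_nonneg (s * j)) ?_ ?_
      (sum_mem_smul_symParallelotope q hq)
    · exact_mod_cast (by omega : 0 < L)
    · exact_mod_cast (by omega : s * j ≤ L)

end gapOn

/-- A set of doubling less than `2 ^ (k + d + 1)` which is covered efficiently by a sufficiently
proper progression plus a parallelotope involves at most `d` long generators. -/
theorem card_long_le {k d D : ℕ} {A : Set (Fin k → ℝ)} (hA : MeasurableSet A)
    (hpos : 0 < volume A) (hfin : volume A < ⊤) {ε : ℝ}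
    (hAA : volume (A + A) ≤ ENNReal.ofReal (2 ^ (k + d + 1) - ε) * volume A)
    {a : Fin D → Fin k → ℝ} {m : Fin D → ℕ} {v : Fin k → Fin k → ℝ}
    (hrel : ∀ t : Fin D → ℤ, (∀ i, |t i| ≤ 4 * m i) →
      ∑ i, (t i : ℝ) • a i ∈ (4 : ℝ) • symParallelotope v → t = 0)
    (hsub : A ⊆ gapAdd a m (symParallelotope v)) {C T : ℕ}
    (hC : ((intBox m).card : ℝ≥0∞) * volume (symParallelotope v) ≤ C * volume A) (hT0 : 0 < T)
    (hT : 3 ^ D * 2 ^ (k + D) * C < min ε (2 ^ (k + d + 1)) * T) :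
    (Finset.univ.filter fun i => T ≤ m i).card ≤ d := by
  classical
  by_contra! hcon
  have hT0' : (0 : ℝ) < T := by exact_mod_cast hT0
  have hη : (2 : ℝ≥0∞) ^ (k + D) ≤ ENNReal.ofReal (2 ^ (k + D) / T) * T := by
    rw [← ENNReal.ofReal_natCast, ← ENNReal.ofReal_mul (by positivity), div_mul_cancel₀ _ hT0'.ne',
      ENNReal.ofReal_pow zero_le_two, ENNReal.ofReal_ofNat]
  have hb := hasDoublingBound_gapAdd hrel hη Finset.univ
  simp only [Finset.mem_univ, if_true, Finset.card_univ, Fintype.card_fin, ← card_intBox] at hb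
  have h1 : (2 : ℝ≥0∞) ^ (k + d + 1) * volume A
      ≤ volume (A + A) + 3 ^ D * ENNReal.ofReal (2 ^ (k + D) / T) * (C * volume A) := by
    conv_lhs => rw [hA.measure_eq_iSup_isCompact_of_ne_top hfin.ne]
    simp only [ENNReal.mul_iSup]
    refine iSup_le fun S => iSup_le fun hS => iSup_le fun hSc => ?_
    calc (2 : ℝ≥0∞) ^ (k + d + 1) * volume S
        ≤ 2 ^ (k + (Finset.univ.filter fun i => T ≤ m i).card) * volume S :=
          mul_le_mul_left (pow_le_pow_right₀ (by norm_num) (by omega)) _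
      _ ≤ _ := hb S (hS.trans hsub) hSc
      _ ≤ _ := by gcongr
  have h2 : (2 : ℝ≥0∞) ^ (k + d + 1) * volume A
      ≤ (ENNReal.ofReal (2 ^ (k + d + 1) - ε)
        + ENNReal.ofReal (3 ^ D * (2 ^ (k + D) / T) * C)) * volume A := by
    refine h1.trans ((add_le_add hAA le_rfl).trans (le_of_eq ?_))
    rw [ENNReal.ofReal_mul (by positivity), ENNReal.ofReal_mul (by positivity),
      ENNReal.ofReal_pow zero_le_three, ENNReal.ofReal_ofNat, ENNReal.ofReal_natCast]
    ring
  have h3 := (ENNReal.mul_le_mul_iff_left hpos.ne' hfin.ne).1 h2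
  have h4 : (2 : ℝ≥0∞) ^ (k + d + 1) = ENNReal.ofReal (2 ^ (k + d + 1)) := by
    rw [ENNReal.ofReal_pow zero_le_two, ENNReal.ofReal_ofNat]
  have h5 : (3 : ℝ) ^ D * (2 ^ (k + D) / T) * C < min ε (2 ^ (k + d + 1)) := by
    rw [show (3 : ℝ) ^ D * (2 ^ (k + D) / T) * C = 3 ^ D * 2 ^ (k + D) * C / T by ring,
      div_lt_iff₀ hT0']
    exact hT
  have h6 : (0 : ℝ) ≤ 3 ^ D * (2 ^ (k + D) / T) * C := by positivity
  rw [h4] at h3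
  rcases le_total ε (2 ^ (k + d + 1)) with hε | hε
  · rw [← ENNReal.ofReal_add (by linarith) h6, ENNReal.ofReal_le_ofReal_iff (by linarith)] at h3
    rw [min_eq_left hε] at h5
    linarith
  · rw [ENNReal.ofReal_of_nonpos (sub_nonpos.2 hε), zero_add, ENNReal.ofReal_le_ofReal_iff h6] at h3
    rw [min_eq_right hε] at h5
    linarith

theorem stmt_12 (k d : ℕ) (hk : 1 ≤ k) (ε : ℝ) (hε : 0 < ε)
    (l n : ℕ → ℕ) (hl : ∀ i, i ≤ d → 1 ≤ l i) (hn : ∀ i, i ≤ d → 1 ≤ n i) :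
    ∃ C : ℝ, 0 < C ∧
      ∀ A : Set (Fin k → ℝ), MeasurableSet A → 0 < volume A → volume A < ⊤ →
        volume (A + A) ≤ ENNReal.ofReal (2 ^ (k + d + 1) - ε) * volume A →
        ∃ (d' : ℕ) (X P Q : Set (Fin k → ℝ)), d' ≤ d ∧ X.Finite ∧
          IsSymGAPProperFull k d' (l d') (n d') P ∧ IsSymParallelotope k Q ∧
          A ⊆ X + P + Q ∧ (X.ncard : ℝ) ≤ C ∧
          (P.ncard : ℝ≥0∞) * volume Q ≤ ENNReal.ofReal C * volume A ∧
          (∀ j : ℕ, 1 ≤ j → j ≤ l d' →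
            IsSeparated (iterSumset (l d' * j) {x | (j : ℝ) • x ∈ P + Q})
              (iterSumset (l d') X)) ∧
          IsSeparated (((l d' : ℝ)) • Q) (iterSumset (l d') P) := by
  classical
  obtain ⟨D₀, C₁, hS⟩ := exists_gap_add_ball_superset k (2 ^ (k + d + 1))
  obtain ⟨L, hL⟩ : ∃ L, L = 4 + 2 * ∑ i ∈ Finset.range (d + 1), l i ^ 2 := ⟨_, rfl⟩
  have hLl : ∀ i ≤ d, 2 * l i ^ 2 ≤ L := fun i hi => by
    have := Finset.single_le_sum (f := fun i => l i ^ 2) (fun _ _ => Nat.zero_le _)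
      (Finset.mem_range.2 (by omega : i < d + 1))
    omega
  obtain ⟨C₂, hC₂, hG⟩ := exists_gap_of_gap_add_ball k L D₀
  obtain ⟨C₃, hC₃⟩ : ∃ C₃, C₃ = (4 * C₂) ^ k * C₂ ^ D₀ * C₁ := ⟨_, rfl⟩
  obtain ⟨T₀, hT₀⟩ : ∃ T₀ : ℕ, 3 ^ D₀ * 2 ^ (k + D₀) * C₃ / min ε (2 ^ (k + d + 1)) < T₀ :=
    exists_nat_gt _
  have hmin : 0 < min ε (2 ^ (k + d + 1)) := lt_min hε (by positivity)
  obtain ⟨T, hT⟩ : ∃ T, T = T₀ + 1 + ∑ i ∈ Finset.range (d + 1), n i := ⟨_, rfl⟩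
  have hTn : ∀ i ≤ d, n i ≤ T := fun i hi => by
    have := Finset.single_le_sum (f := n) (fun _ _ => Nat.zero_le _)
      (Finset.mem_range.2 (by omega : i < d + 1))
    omega
  refine ⟨((2 * T + 1) ^ D₀ + C₃ : ℕ), by positivity, fun A hA hpos hfin hAA => ?_⟩
  obtain ⟨D, hD, a, m, hm, δ, hδ, hcov, hvol⟩ := hS A hA hpos hfin (hAA.trans (by
    gcongr
    refine (ENNReal.ofReal_le_ofReal (sub_le_self _ hε.le)).trans_eq ?_
    rw [ENNReal.ofReal_pow zero_le_two, ENNReal.ofReal_ofNat]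
    push_cast
    rfl))
  obtain ⟨D', hD', a', m', v, hsub, hsup, hrel⟩ := hG D hD a m hm δ hδ
  have hQ : ((intBox m').card : ℝ≥0∞) * volume (symParallelotope v) ≤ C₃ * volume A := by
    refine (card_mul_volume_symParallelotope_le (by omega) hC₂ hδ hrel hsup).trans ?_
    calc _ ≤ (((4 * C₂) ^ k * C₂ ^ D₀ : ℕ) : ℝ≥0∞) * (C₁ * volume A) := by gcongr
      _ = _ := by rw [hC₃]; push_cast; ring
  have hAx : ∀ x ∈ A, ∃ t ∈ intBox m', x - ∑ i, (t i : ℝ) • a' i ∈ symParallelotope v :=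
    fun x hx => by
      obtain ⟨t, ht, htx⟩ := hcov x hx
      obtain ⟨t', ht', h⟩ := hsub t ht _ htx
      exact ⟨t', ht', by simpa using h⟩
  set J := Finset.univ.filter fun i => T ≤ m' i with hJ
  have hJd : J.card ≤ d := by
    refine card_long_le (a := a') hA hpos hfin hAA (fun t ht h => hrel t (fun i => (ht i).trans ?_) ?_)
      (fun x hx => ?_) hQ (by omega) ?_
    · have : (4 : ℤ) ≤ L := by omega
      gcongr
    · refine smul_symParallelotope_mono v (by norm_num) ?_ ?_ h
      · exact_mod_cast (by omega : 0 < L)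
      · exact_mod_cast (by omega : 4 ≤ L)
    · obtain ⟨t, ht, h⟩ := hAx x hx
      exact ⟨t, ht, _, h, by abel⟩
    · have hDD : D' ≤ D₀ := hD'.trans hD
      calc (3 : ℝ) ^ D' * 2 ^ (k + D') * C₃ ≤ 3 ^ D₀ * 2 ^ (k + D₀) * C₃ := by
            gcongr <;> norm_num
        _ < T₀ * min ε (2 ^ (k + d + 1)) := (div_lt_iff₀ hmin).1 hT₀
        _ ≤ min ε (2 ^ (k + d + 1)) * T := by
            rw [mul_comm]
            gcongr
            omega
  have hlJ : 1 ≤ l J.card := hl _ hJd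
  have hL1 : 2 * l J.card ^ 2 ≤ L := hLl _ hJd
  have hL2 : 2 * l J.card ≤ L :=
    le_trans (Nat.mul_le_mul_left 2 (Nat.le_self_pow two_ne_zero _)) hL1
  have hX := ncard_gapOn_le (a := a') (m := m') (J := Jᶜ) (m' := fun _ => T) fun i hi => by
    simp only [hJ, Finset.mem_compl, Finset.mem_filter, Finset.mem_univ, true_and, not_le] at hi
    exact hi.le
  refine ⟨J.card, gapOn a' m' Jᶜ, gapOn a' m' J, symParallelotope v, hJd, hX.1,
    isSymGAPProperFull_gapOn hrel hL2 fun i hi => ?_, ⟨v, rfl⟩, fun x hx => ?_, ?_, ?_,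
    fun j hj hjl => isSeparated_iterSumset_gapOn_compl hrel J hj hjl hL1,
    isSeparated_iterSumset_gapOn hrel J hlJ hL2⟩
  · have h1 := (Finset.mem_filter.1 hi).2
    have h2 := hTn _ hJd
    omega
  · obtain ⟨t, ht, h⟩ := hAx x hx
    exact ⟨_, sum_mem_gapOn_compl_add_gapOn ht J, _, h, by simp⟩
  · have h1 : (gapOn a' m' Jᶜ).ncard ≤ (2 * T + 1) ^ D₀ := by
      refine hX.2.trans ?_
      rw [card_intBox, Finset.prod_const, Finset.card_univ, Fintype.card_fin]
      exact Nat.pow_le_pow_right (by omega) (hD'.trans hD)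
    exact_mod_cast h1.trans (Nat.le_add_right _ _)
  · rw [ENNReal.ofReal_natCast]
    calc ((gapOn a' m' J).ncard : ℝ≥0∞) * volume (symParallelotope v)
        ≤ (intBox m').card * volume (symParallelotope v) := by
          gcongr
          exact (ncard_gapOn_le fun i _ => le_rfl).2
      _ ≤ C₃ * volume A := hQ
      _ ≤ _ := by
          gcongr
          omega
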